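/- arXiv:2509.09410 — 5 statements merged into one kernel-verified Lean document; each statement's English description precedes it below -/
import Mathlib

section
/- Flux-corrector bounds with a macroscopic parameter, linear in the x-Lipschitz constant (Theorem 4.7): Let n ≥ 2, d ≥ 1, λ ∈ (0,1], C₀ ≥ 1, Λ₀ > 0, L₀ ≥ 0. Let A : ℝ^d × (ℝ^d)^n → ℝ^{d×d} be smooth, multiperiodic in y for each x, λ-elliptic in y for each x, with sup over x of ‖|D^ℓ A(x,·)|‖_{L∞} ≤ C₀·Λ₀^ℓ·ℓ! and sup over x of ‖|D^ℓ(∇ₓA)(x,·)|‖_{L∞} ≤ L₀·Λ₀^ℓ·ℓ! for all ℓ ∈ ℕ. Then there exist constants C̃ ≥ 1, c > 0, C ≥ 1, depending only on d, n, λ, C₀, Λ₀ and independent of L₀, such that the following holds. Let 1 ≥ ε₁ > ⋯ > εₙ > 0 satisfy ε_{j+1} ≤ C̃⁻¹·εⱼ for 1 ≤ j ≤ n−1, δᵢ = εᵢ/ε₁, and τ ∈ (0,1] with τ ≥ max over 1 ≤ i ≤ n−1 of e^{−c·εᵢ/ε_{i+1}}. Let 𝒳¹,…,𝒳^d : ℝ^d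 × (ℝ^d)^n → ℝ be smooth, multiperiodic in y, solving for each x and j: −∇̂·(A(x,·) ∇̂𝒳ʲ(x,·)) + τ²·𝒳ʲ(x,·) = ∇̂·(A(x,·) eⱼ) pointwise; let Ā(x) ∈ ℝ^{d×d} have entries Ā(x)ᵢⱼ = ⟨A(x,·)ᵢⱼ + Σₖ A(x,·)ᵢₖ·(∇̂𝒳ʲ(x,·))ₖ⟩; and let 𝒰 : ℝ^d × (ℝ^d)^n → ℝ^{d×d} be smooth, multiperiodic in y, with, entrywise and for each x, −Δ̂𝒰ᵢⱼ(x,·) + τ²·𝒰ᵢⱼ(x,·) = Ā(x)ᵢⱼ − A(x,·)ᵢⱼ − Σₖ A(x,·)ᵢₖ·(∇̂𝒳ʲ(x,·))ₖ pointwise. Then sup over x of (‖∇̂²𝒰(x,·)‖_{L∞} + ‖∇̂𝒰(x,·)‖_{L∞} + ‖𝒰(x,·)‖_{L∞}) ≤ C and sup over x of (‖∇̂²(∇ₓ𝒰)(x,·)‖_{L∞} + ‖∇̂(∇ₓ𝒰)(x,·)‖_{L∞} + ‖(∇ₓ𝒰)(x,·)‖_{L∞}) ≤ C·L₀. -/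
open MeasureTheory Real

noncomputable section

namespace MS

/-- Points of `(ℝ^d)^n`. -/
abbrev Dom (d n : ℕ) := Fin n → Fin d → ℝ

/-- Partial derivative of `u` in the coordinate direction `y_i^k`. -/
def pd {d n : ℕ} (i : Fin n) (k : Fin d) (u : Dom d n → ℝ) (y : Dom d n) : ℝ :=
  fderiv ℝ u y (Pi.single i (Pi.single k 1))

/-- Multiperiodicity: invariance under integer translations in each argument. -/
def MPeriodic {d n : ℕ} (u : Dom d n → ℝ) : Prop :=
  ∀ (y : Dom d n) (z : Fin n → Fin d → ℤ), u (fun i k => y i k + (z i k : ℝ)) = u y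

/-- The unit periodicity cell `[0,1]^{d × n}`. -/
def cell (d n : ℕ) : Set (Dom d n) := Set.Icc 0 1

/-- Pointwise `|D^ℓ u|`: the sum, over all ℓ-tuples of coordinate directions, of the
absolute values of the corresponding ℓ-th order partial derivatives of the scalar `u`. -/
def DAbs {d n : ℕ} (ℓ : ℕ) (u : Dom d n → ℝ) (y : Dom d n) : ℝ :=
  ∑ idx : Fin ℓ → Fin n × Fin d,
    |iteratedFDeriv ℝ ℓ u y fun m => Pi.single (idx m).1 (Pi.single (idx m).2 1)|

/-- L² norm over the unit cell. -/
def L2 {d n : ℕ} (F : Dom d n → ℝ) : ℝ :=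
  Real.sqrt (∫ y in cell d n, (F y) ^ 2)

/-- k-th component of the truncated directional gradient `Σ_{i<m} δ_i⁻¹ ∂/∂y_i^k`;
with `m = n` this is the k-th component of `∇̂`. -/
def gradHatC {d n : ℕ} (δ : Fin n → ℝ) (m : ℕ) (k : Fin d) (u : Dom d n → ℝ) (y : Dom d n) : ℝ :=
  ∑ i : Fin n, if (i : ℕ) < m then (δ i)⁻¹ * pd i k u y else 0

/-- λ-ellipticity of a matrix-valued map: `ξ·Aξ ≥ λ|ξ|²` and `|Aξ| ≤ λ⁻¹|ξ|`. -/
def Elliptic {d n : ℕ} (lam : ℝ) (A : Dom d n → Fin d → Fin d → ℝ) : Prop :=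
  ∀ (y : Dom d n) (ξ : Fin d → ℝ),
    (lam * ∑ k, ξ k ^ 2 ≤ ∑ k, ξ k * ∑ l, A y k l * ξ l) ∧
    Real.sqrt (∑ k, (∑ l, A y k l * ξ l) ^ 2) ≤ lam⁻¹ * Real.sqrt (∑ k, ξ k ^ 2)

/-- Partial derivative in the m-th macroscopic direction of a parameter-dependent function. -/
def pdx {N : ℕ} {E : Type*} [NormedAddCommGroup E] [NormedSpace ℝ E]
    (m : Fin N) (u : (Fin N → ℝ) → E) (x : Fin N → ℝ) : E :=
  fderiv ℝ u x (Pi.single m 1)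

section Abstract

variable {S : Type*} [CommRing S] [Algebra ℝ S]

/-- The `L²` seminorm attached to a linear functional `I` on a commutative algebra. -/
def sNorm (I : S →ₗ[ℝ] ℝ) (u : S) : ℝ := √(I (u * u))

variable {I : S →ₗ[ℝ] ℝ}

lemma sNorm_nonneg (u : S) : 0 ≤ sNorm I u := Real.sqrt_nonneg _

lemma sNorm_sq (hI : ∀ u, 0 ≤ I (u * u)) (u : S) : sNorm I u ^ 2 = I (u * u) :=
  Real.sq_sqrt (hI u)

lemma map_mul_sq_le (hI : ∀ u, 0 ≤ I (u * u)) (u v : S) :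
    I (u * v) ^ 2 ≤ I (u * u) * I (v * v) := by
  have h : ∀ t : ℝ, 0 ≤ I (v * v) * (t * t) + (2 * I (u * v)) * t + I (u * u) := by
    intro t
    have := hI (u + t • v)
    have e : (u + t • v) * (u + t • v) = (t * t) • (v * v) + (2 * t) • (u * v) + u * u := by
      simp only [Algebra.smul_def, map_mul, map_ofNat]; ring
    rw [e] at this
    simp only [map_add, map_smul, smul_eq_mul] at this
    linarith
  have := discrim_le_zero h
  unfold discrim at this
  linarith

lemma abs_map_mul_le (hI : ∀ u, 0 ≤ I (u * u)) (u v : S) :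
    |I (u * v)| ≤ sNorm I u * sNorm I v := by
  unfold sNorm
  rw [← Real.sqrt_mul (hI u)]
  exact Real.abs_le_sqrt (map_mul_sq_le hI u v)

lemma sNorm_add_le (hI : ∀ u, 0 ≤ I (u * u)) (u v : S) :
    sNorm I (u + v) ≤ sNorm I u + sNorm I v := by
  have h : I ((u + v) * (u + v)) ≤ (sNorm I u + sNorm I v) ^ 2 := by
    have e : (u + v) * (u + v) = u * u + (u * v + u * v) + v * v := by ring
    have h1 := abs_map_mul_le hI u v
    rw [e, map_add, map_add, map_add, ← sNorm_sq hI u, ← sNorm_sq hI v]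
    nlinarith [le_abs_self (I (u * v))]
  exact Real.sqrt_le_iff.2 ⟨add_nonneg (sNorm_nonneg _) (sNorm_nonneg _), h⟩

lemma sNorm_zero : sNorm I (0 : S) = 0 := by simp [sNorm]

lemma sNorm_neg (u : S) : sNorm I (-u) = sNorm I u := by simp [sNorm]

lemma sNorm_smul (r : ℝ) (u : S) : sNorm I (r • u) = |r| * sNorm I u := by
  unfold sNorm
  rw [smul_mul_smul_comm, map_smul, smul_eq_mul, Real.sqrt_mul (mul_self_nonneg r),
    Real.sqrt_mul_self_eq_abs]

lemma sNorm_sum_le (hI : ∀ u, 0 ≤ I (u * u)) {ι : Type*} (s : Finset ι) (f : ι → S) :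
    sNorm I (∑ i ∈ s, f i) ≤ ∑ i ∈ s, sNorm I (f i) := by
  classical
  induction s using Finset.induction_on with
  | empty => simp [sNorm_zero]
  | insert a s ha ih =>
    rw [Finset.sum_insert ha, Finset.sum_insert ha]
    exact (sNorm_add_le hI _ _).trans (by gcongr)

lemma iterate_derivation_mul (D : Derivation ℝ S S) (n : ℕ) (a b : S) :
    D^[n] (a * b) =
      ∑ ij ∈ Finset.HasAntidiagonal.antidiagonal n, n.choose ij.1 • (D^[ij.1] a * D^[ij.2] b) := by
  induction n with
  | zero => simp
  | succ n ih =>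
    rw [Finset.sum_antidiagonal_choose_succ_nsmul (M := S) (fun i j => D^[i] a * D^[j] b) n,
      Function.iterate_succ_apply', ih, map_sum, ← Finset.sum_add_distrib]
    refine Finset.sum_congr rfl fun ij hij => ?_
    rw [n.choose_symm_of_eq_add (Finset.HasAntidiagonal.mem_antidiagonal.1 hij).symm, map_nsmul,
      Derivation.leibniz, ← smul_add, Function.iterate_succ_apply', Function.iterate_succ_apply']
    simp only [smul_eq_mul]
    ring

lemma iterate_derivation_add (D : Derivation ℝ S S) (n : ℕ) (a b : S) :
    D^[n] (a + b) = D^[n] a + D^[n] b := by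
  induction n with
  | zero => rfl
  | succ n ih => simp only [Function.iterate_succ_apply', ih, map_add]

lemma iterate_derivation_neg (D : Derivation ℝ S S) (n : ℕ) (a : S) :
    D^[n] (-a) = -D^[n] a := by
  induction n with
  | zero => rfl
  | succ n ih => simp only [Function.iterate_succ_apply', ih, map_neg]

lemma iterate_derivation_smul (D : Derivation ℝ S S) (n : ℕ) (r : ℝ) (a : S) :
    D^[n] (r • a) = r • D^[n] a := by
  induction n with
  | zero => rfl
  | succ n ih => simp only [Function.iterate_succ_apply', ih, Derivation.map_smul]

lemma iterate_derivation_sum (D : Derivation ℝ S S) (n : ℕ) {ι : Type*} (s : Finset ι)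
    (f : ι → S) : D^[n] (∑ i ∈ s, f i) = ∑ i ∈ s, D^[n] (f i) := by
  induction n with
  | zero => rfl
  | succ n ih => simp only [Function.iterate_succ_apply', ih, map_sum]

lemma iterate_derivation_comm (D E : Derivation ℝ S S) (h : ∀ u, D (E u) = E (D u)) (n : ℕ)
    (a : S) : D^[n] (E a) = E (D^[n] a) := by
  induction n with
  | zero => rfl
  | succ n ih => simp only [Function.iterate_succ_apply', ih, h]

lemma sum_antidiagonal_pow_le {M M' : ℝ} (hM : 0 ≤ M) (h : 2 * M ≤ M') (n : ℕ) :
    ∑ ij ∈ Finset.HasAntidiagonal.antidiagonal n, M ^ (ij.1 + 1) * M' ^ ij.2 ≤ 2 * M * M' ^ n := by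
  induction n with
  | zero => simp; linarith
  | succ n ih =>
    rw [Finset.Nat.sum_antidiagonal_succ]
    have e : ∑ p ∈ Finset.HasAntidiagonal.antidiagonal n, M ^ (p.1 + 1 + 1) * M' ^ p.2
        = M * ∑ p ∈ Finset.HasAntidiagonal.antidiagonal n, M ^ (p.1 + 1) * M' ^ p.2 := by
      rw [Finset.mul_sum]; exact Finset.sum_congr rfl fun _ _ => by ring
    simp only [zero_add, pow_one] at *
    rw [e]
    have h0 : 0 ≤ M' := by linarith
    have h1 : M * ∑ p ∈ Finset.HasAntidiagonal.antidiagonal n, M ^ (p.1 + 1) * M' ^ p.2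
        ≤ M * (2 * M * M' ^ n) := by gcongr
    have h2 : M * (2 * M) * M' ^ n ≤ M * M' * M' ^ n := by gcongr
    rw [pow_succ]
    nlinarith

/-- Analytic-type bounds on a coefficient, in terms of its multiplication operators. -/
def MulGevrey (I : S →ₗ[ℝ] ℝ) (D : Derivation ℝ S S) (K M : ℝ) (a : S) : Prop :=
  ∀ (j : ℕ) (u : S), sNorm I (D^[j] a * u) ≤ K * M ^ j * (j.factorial : ℝ) * sNorm I u

/-- Analytic-type bounds in the `L²` seminorm. -/
def Gevrey (I : S →ₗ[ℝ] ℝ) (D : Derivation ℝ S S) (K M : ℝ) (f : S) : Prop :=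
  ∀ j : ℕ, sNorm I (D^[j] f) ≤ K * M ^ j * (j.factorial : ℝ)

lemma sNorm_leibniz_remainder_le (hI : ∀ u, 0 ≤ I (u * u)) {D : Derivation ℝ S S}
    {K M K' M' : ℝ} (hK : 0 ≤ K) (hM : 0 ≤ M) (hK' : 0 ≤ K') (hMM : 2 * M ≤ M')
    {a f : S} (ha : MulGevrey I D K M a) (n : ℕ)
    (hf : ∀ j ≤ n, sNorm I (D^[j] f) ≤ K' * M' ^ j * (j.factorial : ℝ)) :
    sNorm I (D^[n + 1] (a * f) - a * D^[n + 1] f)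
      ≤ 2 * K * K' * M * M' ^ n * ((n + 1).factorial : ℝ) := by
  rw [iterate_derivation_mul, Finset.Nat.sum_antidiagonal_succ]
  simp only [Nat.choose_zero_right, Function.iterate_zero, id, one_smul, add_sub_cancel_left]
  refine (sNorm_sum_le hI _ _).trans ?_
  have key : ∀ p ∈ Finset.HasAntidiagonal.antidiagonal n,
      sNorm I ((n + 1).choose (p.1 + 1) • (D^[p.1 + 1] a * D^[p.2] f))
        ≤ K * K' * ((n + 1).factorial : ℝ) * (M ^ (p.1 + 1) * M' ^ p.2) := by
    intro p hp
    rw [Finset.HasAntidiagonal.mem_antidiagonal] at hp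
    have hc : (((n + 1).choose (p.1 + 1) : ℕ) : ℝ) * ((p.1 + 1).factorial : ℝ)
        * (p.2.factorial : ℝ) = ((n + 1).factorial : ℝ) := by
      have := Nat.choose_mul_factorial_mul_factorial (n := n + 1) (k := p.1 + 1) (by omega)
      rw [show n + 1 - (p.1 + 1) = p.2 by omega] at this
      exact_mod_cast this
    rw [← Nat.cast_smul_eq_nsmul ℝ, sNorm_smul, abs_of_nonneg (by positivity)]
    have h1 := ha (p.1 + 1) (D^[p.2] f)
    have h2 := hf p.2 (by omega)
    calc _ ≤ (((n + 1).choose (p.1 + 1) : ℕ) : ℝ) *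
          (K * M ^ (p.1 + 1) * ((p.1 + 1).factorial : ℝ)
            * (K' * M' ^ p.2 * (p.2.factorial : ℝ))) := by
          refine mul_le_mul_of_nonneg_left (h1.trans ?_) (by positivity)
          exact mul_le_mul_of_nonneg_left h2 (by positivity)
      _ = _ := by rw [← hc]; ring
  refine (Finset.sum_le_sum key).trans ?_
  rw [← Finset.mul_sum]
  have := sum_antidiagonal_pow_le hM hMM n
  calc _ ≤ K * K' * ((n + 1).factorial : ℝ) * (2 * M * M' ^ n) := by gcongr
    _ = _ := by ring

lemma Gevrey.mul (hI : ∀ u, 0 ≤ I (u * u)) {D : Derivation ℝ S S}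
    {K M K' M' : ℝ} (hK : 0 ≤ K) (hM : 0 ≤ M) (hK' : 0 ≤ K') (hMM : 2 * M ≤ M')
    {a f : S} (ha : MulGevrey I D K M a) (hf : Gevrey I D K' M' f) :
    Gevrey I D (2 * K * K') M' (a * f) := by
  intro ℓ
  have h0 := (ha 0 (D^[ℓ] f)).trans
    (mul_le_mul_of_nonneg_left (hf ℓ) (by positivity))
  simp only [Function.iterate_zero, id, pow_zero, mul_one, Nat.factorial_zero, Nat.cast_one] at h0
  have hM' : 0 ≤ M' := by linarith
  have hp : 0 ≤ K * K' := by positivity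
  cases ℓ with
  | zero =>
    simp only [Function.iterate_zero, id, pow_zero, Nat.factorial_zero, Nat.cast_one] at h0 ⊢
    nlinarith
  | succ n =>
    have h1 := sNorm_leibniz_remainder_le hI hK hM hK' hMM ha n fun j _ => hf j
    have h2 := sNorm_add_le hI (a * D^[n + 1] f) (D^[n + 1] (a * f) - a * D^[n + 1] f)
    rw [add_sub_cancel] at h2
    refine h2.trans ((add_le_add h0 h1).trans ?_)
    have h3 : (K * K' * M' ^ n * ((n + 1).factorial : ℝ)) * (2 * M)
      ≤ (K * K' * M' ^ n * ((n + 1).factorial : ℝ)) * M' := by gcongr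
    rw [pow_succ]
    nlinarith

lemma Gevrey.add (hI : ∀ u, 0 ≤ I (u * u)) {D : Derivation ℝ S S} {K K' M : ℝ} {f g : S}
    (hf : Gevrey I D K M f) (hg : Gevrey I D K' M g) : Gevrey I D (K + K') M (f + g) := by
  intro j
  rw [iterate_derivation_add, add_mul, add_mul]
  exact (sNorm_add_le hI _ _).trans (add_le_add (hf j) (hg j))

lemma Gevrey.neg {D : Derivation ℝ S S} {K M : ℝ} {f : S}
    (hf : Gevrey I D K M f) : Gevrey I D K M (-f) := by
  intro j
  rw [iterate_derivation_neg, sNorm_neg]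
  exact hf j

lemma Gevrey.sum (hI : ∀ u, 0 ≤ I (u * u)) {D : Derivation ℝ S S} {ι : Type*} [Fintype ι]
    {K M : ℝ} {f : ι → S} (hf : ∀ i, Gevrey I D K M (f i)) :
    Gevrey I D (Fintype.card ι * K) M (∑ i, f i) := by
  intro j
  rw [iterate_derivation_sum]
  refine (sNorm_sum_le hI _ _).trans ((Finset.sum_le_sum fun i _ => hf i j).trans_eq ?_)
  simp only [Finset.sum_const, Finset.card_univ, nsmul_eq_mul]
  ring

lemma Gevrey.mono {D : Derivation ℝ S S} {K K' M M' : ℝ} {f : S} (hK : 0 ≤ K)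
    (hf : Gevrey I D K M f) (hKK : K ≤ K') (hM : 0 ≤ M) (hMM : M ≤ M') :
    Gevrey I D K' M' f := by
  intro j
  refine (hf j).trans ?_
  have : 0 ≤ K' := hK.trans hKK
  gcongr

lemma MulGevrey.gevrey {D : Derivation ℝ S S} {K M : ℝ} {a : S} (ha : MulGevrey I D K M a)
    (h1 : sNorm I (1 : S) = 1) : Gevrey I D K M a := by
  intro j
  simpa [h1] using ha j 1

/-- Energy estimate for all iterated derivatives of a solution of a coercive divergence-form
equation, uniformly in the zeroth-order term. -/
theorem gevrey_energy (hI : ∀ u, 0 ≤ I (u * u)) {ι : Type*} [Fintype ι]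
    {D : Derivation ℝ S S} {G : ι → Derivation ℝ S S} (hDG : ∀ k u, D (G k u) = G k (D u))
    (hG : ∀ k u, I (G k u) = 0) {A : ι → ι → S} {lam K M K' M' t : ℝ}
    (hlam : 0 < lam) (hK : 0 ≤ K) (hM : 0 ≤ M) (hK' : 0 ≤ K') (hMM : 2 * M ≤ M')
    (hMK : 4 * (Fintype.card ι : ℝ) ^ 2 * K * M ≤ lam * M') (ht : 0 ≤ t)
    (hco : ∀ g : ι → S, lam * ∑ k, I (g k * g k) ≤ I (∑ k, g k * ∑ l, A k l * g l))
    (hA : ∀ k l, MulGevrey I D K M (A k l)) {w : S} {F : ι → S}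
    (heq : -(∑ k, G k (∑ l, A k l * G l w)) + t • w = ∑ k, G k (F k))
    (hF : ∀ k, Gevrey I D K' M' (F k)) (k : ι) :
    Gevrey I D (2 * Fintype.card ι * K' / lam) M' (G k w) := by
  have hM' : 0 ≤ M' := by linarith
  set N : ℝ := (Fintype.card ι : ℝ) with hN
  have hN0 : 0 ≤ N := by positivity
  set C : ℝ := 2 * N * K' / lam with hC
  have hC0 : 0 ≤ C := by positivity
  have hparts : ∀ k u v, I (G k u * v) = -I (u * G k v) := by
    intro k u v
    have h := hG k (u * v)
    rw [Derivation.leibniz, smul_eq_mul, smul_eq_mul, map_add, mul_comm v] at h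
    linarith
  set E : ℕ → ℝ := fun ℓ => ∑ k, I (D^[ℓ] (G k w) * D^[ℓ] (G k w)) with hE
  have hE0 : ∀ ℓ, 0 ≤ E ℓ := fun ℓ => Finset.sum_nonneg fun k _ => hI _
  have hle : ∀ ℓ k, sNorm I (D^[ℓ] (G k w)) ≤ √(E ℓ) := fun ℓ k =>
    Real.sqrt_le_sqrt (Finset.single_le_sum
      (f := fun k => I (D^[ℓ] (G k w) * D^[ℓ] (G k w))) (fun k _ => hI _) (Finset.mem_univ k))
  set R : ℕ → ι → ι → S := fun ℓ k l => D^[ℓ] (A k l * G l w) - A k l * D^[ℓ] (G l w) with hR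
  have henergy : ∀ ℓ, lam * E ℓ ≤ √(E ℓ) *
      ∑ k, (∑ l, sNorm I (R ℓ k l) + sNorm I (D^[ℓ] (F k))) := by
    intro ℓ
    have h1 := congrArg (fun u => I (D^[ℓ] u * D^[ℓ] w)) heq
    simp only [iterate_derivation_add, iterate_derivation_neg, iterate_derivation_smul,
      iterate_derivation_sum, iterate_derivation_comm D _ (hDG _), add_mul, neg_mul,
      Finset.sum_mul, smul_mul_assoc, map_add, map_neg, map_sum, map_smul, smul_eq_mul] at h1
    simp only [hparts, Finset.sum_neg_distrib, neg_neg] at h1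
    simp only [← iterate_derivation_comm D _ (hDG _)] at h1
    have h2 := hco fun k => D^[ℓ] (G k w)
    have h3 : I (∑ k, D^[ℓ] (G k w) * ∑ l, A k l * D^[ℓ] (G l w))
        = ∑ k, ∑ l, I (D^[ℓ] (A k l * G l w) * D^[ℓ] (G k w))
          - ∑ k, ∑ l, I (R ℓ k l * D^[ℓ] (G k w)) := by
      rw [map_sum, ← Finset.sum_sub_distrib]
      refine Finset.sum_congr rfl fun k _ => ?_
      rw [← map_sum I, ← map_sum I, ← map_sub]
      congr 1
      simp only [hR, sub_mul, Finset.sum_sub_distrib, ← Finset.sum_mul]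
      ring
    have h4 : 0 ≤ t * I (D^[ℓ] w * D^[ℓ] w) := mul_nonneg ht (hI _)
    have h5 : ∀ k (u : S), -I (u * D^[ℓ] (G k w)) ≤ √(E ℓ) * sNorm I u := by
      intro k u
      have := abs_map_mul_le hI u (D^[ℓ] (G k w))
      have h6 := mul_le_mul_of_nonneg_left (hle ℓ k) (sNorm_nonneg (I := I) u)
      linarith [neg_abs_le (I (u * D^[ℓ] (G k w)))]
    have h6 : -∑ k, ∑ l, I (R ℓ k l * D^[ℓ] (G k w)) ≤ √(E ℓ) * ∑ k, ∑ l, sNorm I (R ℓ k l) := by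
      simp only [Finset.mul_sum, ← Finset.sum_neg_distrib]
      exact Finset.sum_le_sum fun k _ => Finset.sum_le_sum fun l _ => h5 k _
    have h7 : -∑ k, I (D^[ℓ] (F k) * D^[ℓ] (G k w)) ≤ √(E ℓ) * ∑ k, sNorm I (D^[ℓ] (F k)) := by
      simp only [Finset.mul_sum, ← Finset.sum_neg_distrib]
      exact Finset.sum_le_sum fun k _ => h5 k _
    rw [Finset.sum_add_distrib, mul_add]
    linarith
  have hdiv : ∀ ℓ, lam * √(E ℓ) ≤ ∑ k, (∑ l, sNorm I (R ℓ k l) + sNorm I (D^[ℓ] (F k))) := by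
    intro ℓ
    have h := henergy ℓ
    rcases (Real.sqrt_nonneg (E ℓ)).eq_or_lt with h0 | h0
    · rw [← h0, mul_zero]
      exact Finset.sum_nonneg fun k _ =>
        add_nonneg (Finset.sum_nonneg fun l _ => sNorm_nonneg _) (sNorm_nonneg _)
    · refine le_of_mul_le_mul_left ?_ h0
      calc √(E ℓ) * (lam * √(E ℓ)) = lam * (√(E ℓ) * √(E ℓ)) := by ring
        _ = lam * E ℓ := by rw [Real.mul_self_sqrt (hE0 ℓ)]
        _ ≤ _ := h
  have hlC : lam * C = 2 * N * K' := by rw [hC]; field_simp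
  have main : ∀ ℓ, √(E ℓ) ≤ C * M' ^ ℓ * (ℓ.factorial : ℝ) := by
    intro ℓ
    induction ℓ using Nat.strong_induction_on with
    | _ ℓ ih =>
    refine le_of_mul_le_mul_left ((hdiv ℓ).trans ?_) hlam
    cases ℓ with
    | zero =>
      have : ∀ k, ∑ l, sNorm I (R 0 k l) + sNorm I (D^[0] (F k)) ≤ K' := by
        intro k
        have := hF k 0
        simpa [hR, sNorm_zero] using this
      refine (Finset.sum_le_sum fun k _ => this k).trans ?_
      simp only [Finset.sum_const, Finset.card_univ, nsmul_eq_mul, ← hN, pow_zero,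
        Nat.factorial_zero, Nat.cast_one, mul_one, hlC]
      nlinarith [mul_nonneg hN0 hK']
    | succ n =>
      have : ∀ k, ∑ l, sNorm I (R (n + 1) k l) + sNorm I (D^[n + 1] (F k)) ≤
          N * (2 * K * C * M * M' ^ n * ((n + 1).factorial : ℝ))
            + K' * M' ^ (n + 1) * ((n + 1).factorial : ℝ) := by
        intro k
        refine add_le_add ?_ (hF k _)
        refine (Finset.sum_le_sum fun l _ => sNorm_leibniz_remainder_le hI hK hM hC0 hMM
          (hA k l) n fun j hj => (hle j l).trans (ih j (by omega))).trans_eq ?_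
        simp [hN]
      refine (Finset.sum_le_sum fun k _ => this k).trans ?_
      simp only [Finset.sum_const, Finset.card_univ, nsmul_eq_mul, ← hN]
      have hP : 0 ≤ C * M' ^ n * ((n + 1).factorial : ℝ) := by positivity
      have h1 := mul_le_mul_of_nonneg_left hMK hP
      have h2 : lam * (C * M' ^ (n + 1) * ((n + 1).factorial : ℝ))
        = lam * C * (M' ^ (n + 1) * ((n + 1).factorial : ℝ)) := by ring
      have h3 : lam * C * (M' ^ (n + 1) * ((n + 1).factorial : ℝ))
        = 2 * N * K' * (M' ^ (n + 1) * ((n + 1).factorial : ℝ)) := by rw [hlC]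
      have h4 : C * M' ^ n * ((n + 1).factorial : ℝ) * (lam * M')
        = lam * (C * M' ^ (n + 1) * ((n + 1).factorial : ℝ)) := by ring
      nlinarith
  exact fun ℓ => (hle ℓ k).trans (main ℓ)

end Abstract

section Modes

variable {S : Type*} [CommRing S] [Algebra ℝ S] {I : S →ₗ[ℝ] ℝ}

/-- Size of the Fourier coefficient of `f` at the mode spanned by `c` and `s`. -/
def modeAbs (I : S →ₗ[ℝ] ℝ) (c s f : S) : ℝ := |I (f * c)| + |I (f * s)|

/-- `c` and `s` behave under `D` like `cos` and `sin` of a phase with frequency `θ`. -/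
def IsMode (D : Derivation ℝ S S) (θ : ℝ) (c s : S) : Prop := D c = -(θ • s) ∧ D s = θ • c

lemma modeAbs_nonneg (c s f : S) : 0 ≤ modeAbs I c s f := by unfold modeAbs; positivity

lemma modeAbs_add_le (c s f g : S) :
    modeAbs I c s (f + g) ≤ modeAbs I c s f + modeAbs I c s g := by
  unfold modeAbs
  rw [add_mul, add_mul, map_add, map_add]
  linarith [abs_add_le (I (f * c)) (I (g * c)), abs_add_le (I (f * s)) (I (g * s))]

lemma IsMode.map_mul {D : Derivation ℝ S S} (hD : ∀ u, I (D u) = 0) {θ : ℝ} {c s : S}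
    (h : IsMode D θ c s) (f : S) : I (D f * c) = θ * I (f * s) ∧ I (D f * s) = -θ * I (f * c) := by
  have h1 := hD (f * c)
  have h2 := hD (f * s)
  rw [Derivation.leibniz, smul_eq_mul, smul_eq_mul, map_add, mul_comm c] at h1
  rw [Derivation.leibniz, smul_eq_mul, smul_eq_mul, map_add, mul_comm s] at h2
  rw [h.1, mul_neg, map_neg, mul_smul_comm, map_smul, smul_eq_mul] at h1
  rw [h.2, mul_smul_comm, map_smul, smul_eq_mul] at h2
  constructor <;> linarith

lemma IsMode.modeAbs_map {D : Derivation ℝ S S} (hD : ∀ u, I (D u) = 0) {θ : ℝ} {c s : S}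
    (h : IsMode D θ c s) (f : S) : modeAbs I c s (D f) = |θ| * modeAbs I c s f := by
  unfold modeAbs
  rw [(h.map_mul hD f).1, (h.map_mul hD f).2, abs_mul, abs_mul, abs_neg]
  ring

lemma IsMode.modeAbs_iterate {D : Derivation ℝ S S} (hD : ∀ u, I (D u) = 0) {θ : ℝ} {c s : S}
    (h : IsMode D θ c s) (f : S) (j : ℕ) :
    modeAbs I c s (D^[j] f) = |θ| ^ j * modeAbs I c s f := by
  induction j with
  | zero => simp
  | succ j ih => rw [Function.iterate_succ_apply', h.modeAbs_map hD, ih, pow_succ]; ring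

lemma modeAbs_le (hI : ∀ u, 0 ≤ I (u * u)) {c s : S} (hc : sNorm I c ≤ 1) (hs : sNorm I s ≤ 1)
    (f : S) : modeAbs I c s f ≤ 2 * sNorm I f := by
  have h1 := abs_map_mul_le hI f c
  have h2 := abs_map_mul_le hI f s
  have h3 := mul_le_mul_of_nonneg_left hc (sNorm_nonneg (I := I) f)
  have h4 := mul_le_mul_of_nonneg_left hs (sNorm_nonneg (I := I) f)
  unfold modeAbs
  linarith

lemma mul_exp_le_of_factorial_bound {a r K : ℝ} (h : ∀ j : ℕ, a * r ^ j ≤ K * (j.factorial : ℝ)) :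
    a * Real.exp (r / 2) ≤ 2 * K := by
  have h1 : HasSum (fun j : ℕ => (r / 2) ^ j / (j.factorial : ℝ)) (Real.exp (r / 2)) := by
    rw [Real.exp_eq_exp_ℝ]; exact NormedSpace.expSeries_div_hasSum_exp (r / 2)
  have h2 : HasSum (fun j : ℕ => K * (1 / 2 : ℝ) ^ j) (K * 2) := hasSum_geometric_two.mul_left K
  rw [mul_comm 2 K]
  refine hasSum_le (fun j => ?_) (h1.mul_left a) h2
  have hf : (0 : ℝ) < (j.factorial : ℝ) := by positivity
  rw [div_pow, one_div, inv_pow, ← mul_div_assoc, div_le_iff₀ hf, ← mul_div_assoc,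
    div_le_iff₀ (by positivity : (0 : ℝ) < 2 ^ j)]
  calc a * r ^ j ≤ K * (j.factorial : ℝ) := h j
    _ = _ := by field_simp

/-- Analytic bounds give exponentially small Fourier coefficients. -/
lemma Gevrey.modeAbs_le (hI : ∀ u, 0 ≤ I (u * u)) {D : Derivation ℝ S S}
    (hD : ∀ u, I (D u) = 0) {θ K M : ℝ} (hM : 0 < M) {c s f : S} (h : IsMode D θ c s)
    (hc : sNorm I c ≤ 1) (hs : sNorm I s ≤ 1) (hf : Gevrey I D K M f) :
    modeAbs I c s f ≤ 4 * K * Real.exp (-(|θ| / (2 * M))) := by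
  have h1 : ∀ j : ℕ, modeAbs I c s f * (|θ| / M) ^ j ≤ 2 * K * (j.factorial : ℝ) := by
    intro j
    have h2 := (MS.modeAbs_le hI hc hs (D^[j] f)).trans
      (mul_le_mul_of_nonneg_left (hf j) zero_le_two)
    rw [h.modeAbs_iterate hD] at h2
    rw [div_pow, ← mul_div_assoc, div_le_iff₀ (by positivity)]
    linarith
  have h2 := mul_exp_le_of_factorial_bound h1
  rw [div_div, mul_comm M 2] at h2
  rw [Real.exp_neg, ← div_eq_mul_inv, le_div_iff₀ (Real.exp_pos _)]
  linarith

/-- A mode turns the resolvent equation into multiplication by the symbol. -/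
lemma modeAbs_resolvent {ι : Type*} [Fintype ι] {G : ι → Derivation ℝ S S}
    (hG : ∀ k u, I (G k u) = 0) {κ : ι → ℝ} {c s : S} (h : ∀ k, IsMode (G k) (κ k) c s)
    {t : ℝ} (ht : 0 ≤ t) (U : S) :
    modeAbs I c s (-(∑ k, G k (G k U)) + t • U) = (∑ k, κ k ^ 2 + t) * modeAbs I c s U := by
  have e1 : ∀ k, I (G k (G k U) * c) = -(κ k ^ 2 * I (U * c)) := fun k => by
    rw [((h k).map_mul (hG k) _).1, ((h k).map_mul (hG k) _).2]; ring
  have e2 : ∀ k, I (G k (G k U) * s) = -(κ k ^ 2 * I (U * s)) := fun k => by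
    rw [((h k).map_mul (hG k) _).2, ((h k).map_mul (hG k) _).1]; ring
  have hn : 0 ≤ ∑ k, κ k ^ 2 + t := add_nonneg (Finset.sum_nonneg fun _ _ => sq_nonneg _) ht
  have e (z : S) (hz : ∀ k, I (G k (G k U) * z) = -(κ k ^ 2 * I (U * z))) :
      I ((-(∑ k, G k (G k U)) + t • U) * z) = (∑ k, κ k ^ 2 + t) * I (U * z) := by
    rw [add_mul, neg_mul, Finset.sum_mul, smul_mul_assoc, map_add, map_neg, map_sum, map_smul,
      smul_eq_mul, Finset.sum_congr rfl fun k _ => hz k, Finset.sum_neg_distrib, neg_neg, add_mul,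
      Finset.sum_mul]
  rw [modeAbs, e c e1, e s e2, abs_mul, abs_mul, abs_of_nonneg hn, ← mul_add, modeAbs]

end Modes

section Periodic

variable {d n : ℕ}

/-- Smooth functions of `(x, y)` which are multiperiodic in `y`. -/
def SmoothPer (d n : ℕ) : Subalgebra ℝ ((Fin d → ℝ) × Dom d n → ℝ) where
  carrier := {u | ContDiff ℝ (⊤ : ℕ∞) u ∧ ∀ x, MPeriodic fun y => u (x, y)}
  mul_mem' ha hb := ⟨ha.1.mul hb.1, fun x y z => congrArg₂ (· * ·) (ha.2 x y z) (hb.2 x y z)⟩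
  add_mem' ha hb := ⟨ha.1.add hb.1, fun x y z => congrArg₂ (· + ·) (ha.2 x y z) (hb.2 x y z)⟩
  algebraMap_mem' _ := ⟨contDiff_const, fun _ _ _ => rfl⟩

instance : CoeFun (SmoothPer d n) (fun _ => (Fin d → ℝ) × Dom d n → ℝ) := ⟨Subtype.val⟩

lemma SmoothPer.contDiff (u : SmoothPer d n) : ContDiff ℝ (⊤ : ℕ∞) (u : _ → ℝ) := u.2.1

lemma SmoothPer.differentiable (u : SmoothPer d n) : Differentiable ℝ (u : _ → ℝ) :=
  (SmoothPer.contDiff u).differentiable (by simp)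

lemma SmoothPer.periodic (u : SmoothPer d n) (x : Fin d → ℝ) : MPeriodic fun y => u (x, y) :=
  u.2.2 x

lemma contDiff_fderiv_apply {E : Type*} [NormedAddCommGroup E] [NormedSpace ℝ E] {u : E → ℝ}
    (hu : ContDiff ℝ (⊤ : ℕ∞) u) (w : E) : ContDiff ℝ (⊤ : ℕ∞) fun p => fderiv ℝ u p w :=
  (hu.fderiv_right (m := (⊤ : ℕ∞)) (by simp)).clm_apply contDiff_const

/-- Differentiation in the direction `w`, as a derivation. -/
def dirDeriv (w : (Fin d → ℝ) × Dom d n) : Derivation ℝ (SmoothPer d n) (SmoothPer d n) :=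
  Derivation.mk'
    { toFun := fun u => ⟨fun p => fderiv ℝ u p w, contDiff_fderiv_apply (SmoothPer.contDiff u) w, by
        intro x y z
        have h : ∀ p, u (p + (0, fun i k => (z i k : ℝ))) = u p := fun p => by
          have := (SmoothPer.periodic u) p.1 p.2 z
          simpa [Prod.add_def, Pi.add_def] using! this
        have h2 := fderiv_comp_add_right (𝕜 := ℝ) (f := (u : _ → ℝ)) (x := (x, y))
          ((0, fun i k => (z i k : ℝ)) : (Fin d → ℝ) × Dom d n)
        simp only [h] at h2
        have e : ((x, y) + (0, fun i k => (z i k : ℝ)) : (Fin d → ℝ) × Dom d n)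
          = (x, fun i k => y i k + (z i k : ℝ)) := by
          simp [Prod.add_def, Pi.add_def]
        rw [e] at h2
        change fderiv ℝ u (x, fun i k => y i k + (z i k : ℝ)) w = fderiv ℝ u (x, y) w
        rw [← h2]⟩
      map_add' := fun u v => by
        ext p
        change fderiv ℝ ((u : _ → ℝ) + (v : _ → ℝ)) p w = fderiv ℝ u p w + fderiv ℝ v p w
        rw [fderiv_add ((SmoothPer.differentiable u) p) ((SmoothPer.differentiable v) p)]; rfl
      map_smul' := fun r u => by
        ext p
        change fderiv ℝ (r • (u : _ → ℝ)) p w = r * fderiv ℝ u p w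
        rw [fderiv_const_smul ((SmoothPer.differentiable u) p)]; rfl }
    fun u v => by
      ext p
      change fderiv ℝ ((u : _ → ℝ) * (v : _ → ℝ)) p w = u p * fderiv ℝ v p w + v p * fderiv ℝ u p w
      rw [fderiv_mul ((SmoothPer.differentiable u) p) ((SmoothPer.differentiable v) p)]; rfl

lemma dirDeriv_apply (w : (Fin d → ℝ) × Dom d n) (u : SmoothPer d n) (p) :
    dirDeriv w u p = fderiv ℝ u p w := rfl

lemma dirDeriv_comm (w w' : (Fin d → ℝ) × Dom d n) (u : SmoothPer d n) :
    dirDeriv w (dirDeriv w' u) = dirDeriv w' (dirDeriv w u) := by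
  ext p
  have hd : DifferentiableAt ℝ (fderiv ℝ (u : _ → ℝ)) p :=
    ((SmoothPer.contDiff u).fderiv_right (m := (⊤ : ℕ∞)) (by simp)).differentiable (by simp) p
  have h : ∀ a b, dirDeriv a (dirDeriv b u) p = fderiv ℝ (fderiv ℝ (u : _ → ℝ)) p a b := by
    intro a b
    change fderiv ℝ (fun q => fderiv ℝ (u : _ → ℝ) q b) p a = _
    rw [fderiv_clm_apply hd (by fun_prop)]
    simp
  rw [h, h]
  exact ((SmoothPer.contDiff u).contDiffAt.isSymmSndFDerivAt
    (by simpa using! (WithTop.coe_le_coe.2 (le_top : (2 : ℕ∞) ≤ ⊤)))).eq w w'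

lemma fderiv_slice (u : SmoothPer d n) (x : Fin d → ℝ) (y v : Dom d n) :
    fderiv ℝ (fun y' => u (x, y')) y v = dirDeriv (0, v) u (x, y) := by
  rw [dirDeriv_apply]
  have h1 : HasFDerivAt (fun y' : Dom d n => (x, y'))
      (ContinuousLinearMap.inr ℝ (Fin d → ℝ) (Dom d n)) y := hasFDerivAt_prodMk_right x y
  have h2 := (((SmoothPer.differentiable u) (x, y)).hasFDerivAt.comp y h1).fderiv
  change fderiv ℝ ((u : _ → ℝ) ∘ fun y' => (x, y')) y v = _
  rw [h2]; simp

lemma pdx_slice (u : SmoothPer d n) (x : Fin d → ℝ) (y : Dom d n) (m : Fin d) :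
    pdx m (fun x' => u (x', y)) x = dirDeriv (Pi.single m 1, 0) u (x, y) := by
  rw [dirDeriv_apply, pdx]
  have h1 : HasFDerivAt (fun x' : Fin d → ℝ => (x', y))
      (ContinuousLinearMap.inl ℝ (Fin d → ℝ) (Dom d n)) x := hasFDerivAt_prodMk_left x y
  have h2 := (((SmoothPer.differentiable u) (x, y)).hasFDerivAt.comp x h1).fderiv
  change fderiv ℝ ((u : _ → ℝ) ∘ fun x' => (x', y)) x _ = _
  rw [h2]; simp

/-- The direction of `ℝ^d × (ℝ^d)^n` along which `∇̂ₖ` differentiates. -/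
def hatDir (δ : Fin n → ℝ) (k : Fin d) : (Fin d → ℝ) × Dom d n :=
  (0, ∑ i, (δ i)⁻¹ • Pi.single i (Pi.single k 1))

lemma gradHatC_slice (δ : Fin n → ℝ) (k : Fin d) (u : SmoothPer d n) (x : Fin d → ℝ)
    (y : Dom d n) :
    gradHatC δ n k (fun y' => u (x, y')) y = dirDeriv (hatDir δ k) u (x, y) := by
  rw [hatDir, ← fderiv_slice, map_sum]
  simp [gradHatC, pd]

lemma iteratedFDeriv_slice (u : SmoothPer d n) (x : Fin d → ℝ) (v : Dom d n) (ℓ : ℕ)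
    (y : Dom d n) : iteratedFDeriv ℝ ℓ (fun y' => u (x, y')) y (fun _ => v)
      = (dirDeriv (0, v))^[ℓ] u (x, y) := by
  induction ℓ generalizing y with
  | zero => simp
  | succ ℓ ih =>
    rw [Function.iterate_succ_apply', iteratedFDeriv_succ_apply_left, ← fderiv_slice]
    have hc : ContDiff ℝ (⊤ : ℕ∞) fun y' => u (x, y') :=
      (SmoothPer.contDiff u).comp (contDiff_const.prodMk contDiff_id)
    have hd : DifferentiableAt ℝ (iteratedFDeriv ℝ ℓ fun y' => u (x, y')) y :=
      hc.differentiable_iteratedFDeriv (by exact_mod_cast WithTop.coe_lt_top _) y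
    simp only [← ih]
    rw [fderiv_continuousMultilinear_apply_const hd]
    simp [Fin.tail_def]

lemma abs_iterate_dirDeriv_le_DAbs (u : SmoothPer d n) (x : Fin d → ℝ) (s : Fin n × Fin d) (ℓ : ℕ)
    (y : Dom d n) :
    |(dirDeriv (0, Pi.single s.1 (Pi.single s.2 1)))^[ℓ] u (x, y)|
      ≤ DAbs ℓ (fun y' => u (x, y')) y := by
  rw [← iteratedFDeriv_slice]
  exact Finset.single_le_sum (f := fun idx : Fin ℓ → Fin n × Fin d =>
    |iteratedFDeriv ℝ ℓ (fun y' => u (x, y')) y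
      fun m => Pi.single (idx m).1 (Pi.single (idx m).2 1)|)
    (fun _ _ => abs_nonneg _) (Finset.mem_univ fun _ => s)

end Periodic

section Cell

variable {d n : ℕ}

lemma isCompact_cell : IsCompact (cell d n) := isCompact_Icc

lemma restrict_cell_eq : (volume : Measure (Dom d n)).restrict (cell d n) =
    Measure.pi fun _ : Fin n => Measure.pi fun _ : Fin d =>
      (volume : Measure ℝ).restrict (Set.Ioc 0 1) := by
  have h1 : cell d n = Set.univ.pi fun _ => Set.univ.pi fun _ => Set.Icc (0 : ℝ) 1 := by
    ext y
    simp [cell, Pi.le_def]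
  rw [h1, volume_pi, Measure.restrict_pi_pi]
  congr 1
  funext _
  rw [volume_pi, Measure.restrict_pi_pi]
  congr 1
  funext _
  exact (Measure.restrict_congr_set Ioc_ae_eq_Icc).symm

instance : IsProbabilityMeasure ((volume : Measure ℝ).restrict (Set.Ioc 0 1)) := ⟨by simp⟩

instance : IsProbabilityMeasure ((volume : Measure (Dom d n)).restrict (cell d n)) := by
  rw [restrict_cell_eq]; infer_instance

lemma measurePreserving_uncurry {ι κ X : Type*} [Fintype ι] [Fintype κ] [MeasurableSpace X]
    (μ : Measure X) [SigmaFinite μ] :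
    MeasurePreserving (fun (y : ι → κ → X) (s : ι × κ) => y s.1 s.2)
      (Measure.pi fun _ => Measure.pi fun _ => μ) (Measure.pi fun _ => μ) := by
  have hm : Measurable fun (y : ι → κ → X) (s : ι × κ) => y s.1 s.2 :=
    (MeasurableEquiv.curry ι κ X).symm.measurable
  refine ⟨hm, (Measure.pi_eq fun s hs => ?_).symm⟩
  rw [Measure.map_apply hm (MeasurableSet.univ_pi hs)]
  have e : (fun (y : ι → κ → X) (s : ι × κ) => y s.1 s.2) ⁻¹' Set.univ.pi s
      = Set.univ.pi fun i => Set.univ.pi fun k => s (i, k) := by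
    ext y
    simp
  rw [e, Measure.pi_pi, Fintype.prod_prod_type]
  exact Finset.prod_congr rfl fun i _ => Measure.pi_pi _ _

/-- The projection of `(ℝ^d)^n` onto the torus. -/
def torusMk (y : Dom d n) : UnitAddTorus (Fin n × Fin d) := fun s => (y s.1 s.2 : UnitAddCircle)

lemma isOpenQuotientMap_torusMk : IsOpenQuotientMap (torusMk (d := d) (n := n)) :=
  (IsOpenQuotientMap.piMap fun _ : Fin n × Fin d => QuotientAddGroup.isOpenQuotientMap_mk).comp
    (Homeomorph.piCurry (X := Fin n) (Y := Fin d) (Z := ℝ)).symm.isOpenQuotientMap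

lemma measurePreserving_cell_uncurry :
    MeasurePreserving (fun (y : Dom d n) (s : Fin n × Fin d) => y s.1 s.2)
      (volume.restrict (cell d n))
      (volume.restrict {x : Fin n × Fin d → ℝ | ∀ s, x s ∈ Set.Ioc (0 : ℝ) 1}) := by
  have h : {x : Fin n × Fin d → ℝ | ∀ s, x s ∈ Set.Ioc (0 : ℝ) 1}
      = Set.univ.pi fun _ => Set.Ioc (0 : ℝ) 1 := by
    ext x
    simp
  rw [restrict_cell_eq, h, volume_pi, Measure.restrict_pi_pi]
  exact measurePreserving_uncurry _

lemma measurePreserving_torusMk : MeasurePreserving (torusMk (d := d) (n := n))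
    (volume.restrict (cell d n)) volume := by
  rw [restrict_cell_eq]
  refine MeasurePreserving.comp (g := fun (x : Fin n × Fin d → ℝ) s => (x s : UnitAddCircle))
    (measurePreserving_pi _ _ fun _ => ?_) (measurePreserving_uncurry _)
  simpa using UnitAddCircle.measurePreserving_mk 0

lemma exists_torus_lift {f : Dom d n → ℝ} (hf : Continuous f) (hp : MPeriodic f) :
    ∃ F : C(UnitAddTorus (Fin n × Fin d), ℝ), ∀ y, F (torusMk y) = f y := by
  have hq := (isOpenQuotientMap_torusMk (d := d) (n := n)).isQuotientMap
  have hker : ∀ a b : Dom d n, torusMk a = torusMk b → f a = f b := by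
    intro a b hab
    have h : ∀ i k, ∃ z : ℤ, a i k + z = b i k := by
      intro i k
      have h1 : (a i k : UnitAddCircle) = (b i k : UnitAddCircle) :=
        congrFun hab (i, k)
      rw [QuotientAddGroup.eq, AddSubgroup.mem_zmultiples_iff] at h1
      obtain ⟨z, hz⟩ := h1
      exact ⟨z, by simp at hz; linarith⟩
    choose z hz using h
    rw [← hp a z]
    exact congrArg f (funext fun i => funext fun k => hz i k)
  let pr : C(Dom d n, UnitAddTorus (Fin n × Fin d)) := ⟨torusMk, hq.continuous⟩
  refine ⟨Topology.IsQuotientMap.lift (f := pr) hq ⟨f, hf⟩ fun a b h => hker a b h, fun y => ?_⟩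
  exact congrArg (fun g : C(Dom d n, ℝ) => g y)
    (Topology.IsQuotientMap.lift_comp (f := pr) hq ⟨f, hf⟩ fun a b h => hker a b h)

lemma setIntegral_cell_add {f : Dom d n → ℝ} (hf : Continuous f) (hp : MPeriodic f)
    (a : Dom d n) : ∫ y in cell d n, f (y + a) = ∫ y in cell d n, f y := by
  obtain ⟨F, hF⟩ := exists_torus_lift hf hp
  have hadd : ∀ y, torusMk (y + a) = torusMk y + torusMk a := fun y => rfl
  have hmp := measurePreserving_torusMk (d := d) (n := n)
  have key : ∀ G : C(UnitAddTorus (Fin n × Fin d), ℝ),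
      ∫ y in cell d n, G (torusMk y) = ∫ t, G t := by
    intro G
    rw [← hmp.map_eq, integral_map hmp.measurable.aemeasurable G.continuous.aestronglyMeasurable]
  simp only [← hF, hadd]
  have h2 := key ⟨fun t => F (t + torusMk a), by fun_prop⟩
  simp only [ContinuousMap.coe_mk] at h2
  rw [h2, key F]
  exact integral_add_right_eq_self (fun t => F t) (torusMk a)

lemma SmoothPer.continuous (u : SmoothPer d n) : Continuous (u : _ → ℝ) :=
  (SmoothPer.contDiff u).continuous

lemma SmoothPer.integrable (u : SmoothPer d n) (x : Fin d → ℝ) :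
    IntegrableOn (fun y => u (x, y)) (cell d n) :=
  ((SmoothPer.continuous u).comp (Continuous.prodMk_right x)).continuousOn.integrableOn_compact
    isCompact_cell

/-- The average over the periodicity cell at a fixed macroscopic point. -/
def cellInt (x : Fin d → ℝ) : SmoothPer d n →ₗ[ℝ] ℝ where
  toFun u := ∫ y in cell d n, u (x, y)
  map_add' u v := integral_add (SmoothPer.integrable u x) (SmoothPer.integrable v x)
  map_smul' r u := integral_const_mul r fun y => u (x, y)

lemma cellInt_apply (x : Fin d → ℝ) (u : SmoothPer d n) :
    cellInt x u = ∫ y in cell d n, u (x, y) := rfl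

lemma cellInt_mono (x : Fin d → ℝ) {u v : SmoothPer d n} (h : ∀ y, u (x, y) ≤ v (x, y)) :
    cellInt x u ≤ cellInt x v :=
  integral_mono (SmoothPer.integrable u x) (SmoothPer.integrable v x) h

lemma cellInt_mul_self_nonneg (x : Fin d → ℝ) (u : SmoothPer d n) : 0 ≤ cellInt x (u * u) :=
  integral_nonneg fun y => mul_self_nonneg (u (x, y))

lemma sNorm_cellInt_one (x : Fin d → ℝ) : sNorm (cellInt x) (1 : SmoothPer d n) = 1 := by
  have : cellInt x (1 * 1 : SmoothPer d n) = 1 := by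
    rw [mul_one, cellInt_apply]
    change ∫ _ in cell d n, (1 : ℝ) = 1
    simp
  rw [sNorm, this, Real.sqrt_one]

lemma sNorm_mul_le (x : Fin d → ℝ) {a : SmoothPer d n} {K : ℝ} (hK : 0 ≤ K)
    (ha : ∀ y, |a (x, y)| ≤ K) (u : SmoothPer d n) :
    sNorm (cellInt x) (a * u) ≤ K * sNorm (cellInt x) u := by
  have h : cellInt x (a * u * (a * u)) ≤ cellInt x ((K ^ 2) • (u * u)) := by
    refine cellInt_mono x fun y => ?_
    change a (x, y) * u (x, y) * (a (x, y) * u (x, y)) ≤ K ^ 2 * (u (x, y) * u (x, y))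
    have h1 := sq_le_sq' (by linarith [neg_le_of_abs_le (ha y)]) (le_of_abs_le (ha y))
    nlinarith [mul_self_nonneg (u (x, y))]
  rw [map_smul, smul_eq_mul] at h
  refine (Real.sqrt_le_sqrt h).trans_eq ?_
  rw [Real.sqrt_mul (sq_nonneg K), Real.sqrt_sq hK]
  rfl

lemma hasDerivAt_setIntegral_cell (u : SmoothPer d n) (x : Fin d → ℝ)
    (w : (Fin d → ℝ) × Dom d n) :
    HasDerivAt (fun t : ℝ => ∫ y in cell d n, u ((x, y) + t • w)) (cellInt x (dirDeriv w u)) 0 := by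
  have hc : ∀ v : SmoothPer d n, Continuous fun p : ℝ × Dom d n => v ((x, p.2) + p.1 • w) :=
    fun v => (SmoothPer.continuous v).comp (by fun_prop)
  have hcy : ∀ (v : SmoothPer d n) (t : ℝ), Continuous fun y : Dom d n => v ((x, y) + t • w) :=
    fun v t => (hc v).comp (Continuous.prodMk_right t)
  obtain ⟨B, hB⟩ := ((isCompact_closedBall (0 : ℝ) 1).prod
    (isCompact_cell (d := d) (n := n))).exists_bound_of_continuousOn
    (hc (dirDeriv w u)).continuousOn
  have h := (hasDerivAt_integral_of_dominated_loc_of_deriv_le (μ := volume.restrict (cell d n))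
    (F := fun (t : ℝ) y => u ((x, y) + t • w)) (x₀ := 0)
    (F' := fun t y => dirDeriv w u ((x, y) + t • w)) (bound := fun _ => B)
    (Metric.closedBall_mem_nhds 0 one_pos)
    (Filter.Eventually.of_forall fun t => (hcy u t).aestronglyMeasurable)
    ((hcy u 0).continuousOn.integrableOn_compact isCompact_cell)
    (hcy _ 0).aestronglyMeasurable
    ((ae_restrict_mem isCompact_cell.measurableSet).mono fun y hy t ht => hB (t, y) ⟨ht, hy⟩)
    (integrable_const B)
    (Filter.Eventually.of_forall fun y t _ => by
      have h1 : HasDerivAt (fun s : ℝ => (x, y) + s • w) w t := by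
        simpa using ((hasDerivAt_id t).smul_const w).const_add (x, y)
      exact ((SmoothPer.differentiable u _).hasFDerivAt.comp_hasDerivAt t h1))).2
  simpa [cellInt_apply] using h

lemma cellInt_dirDeriv_snd (x : Fin d → ℝ) (v : Dom d n) (u : SmoothPer d n) :
    cellInt x (dirDeriv (0, v) u) = 0 := by
  have h := hasDerivAt_setIntegral_cell u x (0, v)
  have hc : ∀ t : ℝ, ∫ y in cell d n, u ((x, y) + t • (0, v)) = ∫ y in cell d n, u (x, y) := by
    intro t
    have h1 := setIntegral_cell_add ((SmoothPer.continuous u).comp (Continuous.prodMk_right x))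
      (SmoothPer.periodic u x) (t • v)
    simpa using h1
  simp only [hc] at h
  exact h.unique (hasDerivAt_const _ _)

lemma cellInt_dirDeriv_fst {u : SmoothPer d n} (hu : ∀ x, cellInt x u = 0) (x e : Fin d → ℝ) :
    cellInt x (dirDeriv (e, 0) u) = 0 := by
  have h := hasDerivAt_setIntegral_cell u x (e, 0)
  have hc : ∀ t : ℝ, ∫ y in cell d n, u ((x, y) + t • (e, 0)) = 0 := by
    intro t
    rw [← hu (x + t • e), cellInt_apply]
    simp
  simp only [hc] at h
  exact h.unique (hasDerivAt_const _ _)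

end Cell

section Fourier

variable {d n : ℕ}

/-- The linear phase with frequency `k`. -/
def phase (k : Fin n × Fin d → ℤ) : ((Fin d → ℝ) × Dom d n) →L[ℝ] ℝ :=
  (2 * π) • ∑ s, (k s : ℝ) • ((ContinuousLinearMap.proj s.2).comp
    ((ContinuousLinearMap.proj s.1).comp (ContinuousLinearMap.snd ℝ (Fin d → ℝ) (Dom d n))))

lemma phase_apply (k : Fin n × Fin d → ℤ) (p : (Fin d → ℝ) × Dom d n) :
    phase k p = 2 * π * ∑ s, (k s : ℝ) * p.2 s.1 s.2 := by
  simp [phase]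

lemma phase_add_int (k : Fin n × Fin d → ℤ) (x : Fin d → ℝ) (y : Dom d n)
    (z : Fin n → Fin d → ℤ) : phase k (x, fun i l => y i l + (z i l : ℝ))
      = phase k (x, y) + ((∑ s, k s * z s.1 s.2 : ℤ) : ℝ) * (2 * π) := by
  simp only [phase_apply, mul_add, Finset.sum_add_distrib]
  push_cast
  ring

/-- The cosine of the phase with frequency `k`. -/
def cosMode (k : Fin n × Fin d → ℤ) : SmoothPer d n :=
  ⟨fun p => cos (phase k p), (phase k).contDiff.cos, fun x y z => by
    simp only [phase_add_int, Real.cos_add_int_mul_two_pi]⟩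

/-- The sine of the phase with frequency `k`. -/
def sinMode (k : Fin n × Fin d → ℤ) : SmoothPer d n :=
  ⟨fun p => sin (phase k p), (phase k).contDiff.sin, fun x y z => by
    simp only [phase_add_int, Real.sin_add_int_mul_two_pi]⟩

lemma isMode_dirDeriv (w : (Fin d → ℝ) × Dom d n) (k : Fin n × Fin d → ℤ) :
    IsMode (dirDeriv w) (phase k w) (cosMode k) (sinMode k) := by
  constructor
  · ext p
    change fderiv ℝ (fun p => cos (phase k p)) p w = -(phase k w * sin (phase k p))
    rw [((phase k).hasFDerivAt (x := p)).cos.fderiv]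
    simp [mul_comm]
  · ext p
    change fderiv ℝ (fun p => sin (phase k p)) p w = phase k w * cos (phase k p)
    rw [((phase k).hasFDerivAt (x := p)).sin.fderiv]
    simp [mul_comm]

lemma sNorm_cosMode_le (x : Fin d → ℝ) (k : Fin n × Fin d → ℤ) :
    sNorm (cellInt x) (cosMode k) ≤ 1 := by
  have h := sNorm_mul_le x (a := cosMode k) zero_le_one (fun y => abs_cos_le_one _) 1
  rwa [mul_one, sNorm_cellInt_one, mul_one] at h

lemma sNorm_sinMode_le (x : Fin d → ℝ) (k : Fin n × Fin d → ℤ) :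
    sNorm (cellInt x) (sinMode k) ≤ 1 := by
  have h := sNorm_mul_le x (a := sinMode k) zero_le_one (fun y => abs_sin_le_one _) 1
  rwa [mul_one, sNorm_cellInt_one, mul_one] at h

/-- Size of the Fourier coefficient of `u (x, ·)` at the frequency `k`. -/
def coeffAbs (x : Fin d → ℝ) (k : Fin n × Fin d → ℤ) (u : SmoothPer d n) : ℝ :=
  modeAbs (cellInt x) (cosMode k) (sinMode k) u

lemma coeffAbs_nonneg (x : Fin d → ℝ) (k : Fin n × Fin d → ℤ) (u : SmoothPer d n) :
    0 ≤ coeffAbs x k u := modeAbs_nonneg _ _ _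

lemma mFourier_torusMk (k : Fin n × Fin d → ℤ) (x : Fin d → ℝ) (y : Dom d n) :
    UnitAddTorus.mFourier (-k) (torusMk y)
      = (cos (phase k (x, y)) : ℂ) - Complex.I * (sin (phase k (x, y)) : ℂ) := by
  have h : UnitAddTorus.mFourier (-k) (torusMk y) = Complex.exp (((-phase k (x, y) : ℝ) : ℂ)
      * Complex.I) := by
    change ∏ s, fourier (-k s) ((y s.1 s.2 : ℝ) : UnitAddCircle) = _
    simp only [fourier_coe_apply, phase_apply]
    rw [← Complex.exp_sum]
    congr 1
    push_cast
    rw [Finset.mul_sum, ← Finset.sum_neg_distrib, Finset.sum_mul]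
    refine Finset.sum_congr rfl fun s _ => ?_
    ring
  rw [h, Complex.exp_mul_I, ← Complex.ofReal_cos, ← Complex.ofReal_sin, cos_neg, sin_neg]
  push_cast
  ring

lemma integral_complex_eq_cellInt (x : Fin d → ℝ) (u v : SmoothPer d n) :
    ∫ y in cell d n, ((u (x, y) : ℂ) - Complex.I * (v (x, y) : ℂ))
      = (cellInt x u : ℂ) - Complex.I * (cellInt x v : ℂ) := by
  have hu : IntegrableOn (fun y => (u (x, y) : ℂ)) (cell d n) := (SmoothPer.integrable u x).ofReal
  have hv : IntegrableOn (fun y => (v (x, y) : ℂ)) (cell d n) := (SmoothPer.integrable v x).ofReal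
  rw [integral_sub hu (hv.const_mul _), integral_const_mul, integral_complex_ofReal,
    integral_complex_ofReal]
  rfl

/-- Pointwise bound by the sum of the Fourier coefficients. -/
lemma abs_le_tsum_coeffAbs (x : Fin d → ℝ) (u : SmoothPer d n)
    (h : Summable fun k => coeffAbs x k u) (y : Dom d n) : |u (x, y)| ≤ ∑' k, coeffAbs x k u := by
  obtain ⟨F, hF⟩ := exists_torus_lift
    ((SmoothPer.continuous u).comp (Continuous.prodMk_right x)) (SmoothPer.periodic u x)
  let Fc : C(UnitAddTorus (Fin n × Fin d), ℂ) := ⟨fun t => (F t : ℂ), by fun_prop⟩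
  have hcoeff : ∀ k, UnitAddTorus.mFourierCoeff Fc k
      = (cellInt x (u * cosMode k) : ℂ) - Complex.I * (cellInt x (u * sinMode k) : ℂ) := by
    intro k
    rw [UnitAddTorus.mFourierCoeff_eq_integral _ k 0]
    simp only [Pi.zero_apply, zero_add]
    rw [← measurePreserving_cell_uncurry.map_eq,
      integral_map measurePreserving_cell_uncurry.measurable.aemeasurable]
    · have e : ∀ y : Dom d n, UnitAddTorus.mFourier (-k) (torusMk y) • Fc (torusMk y)
          = (((u * cosMode k) (x, y) : ℝ) : ℂ)
            - Complex.I * (((u * sinMode k) (x, y) : ℝ) : ℂ) := by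
        intro y
        have e2 : Fc (torusMk y) = ((u (x, y) : ℝ) : ℂ) := congrArg (fun r : ℝ => (r : ℂ)) (hF y)
        have e3 : (u * cosMode k) (x, y) = u (x, y) * cos (phase k (x, y)) := rfl
        have e4 : (u * sinMode k) (x, y) = u (x, y) * sin (phase k (x, y)) := rfl
        rw [mFourier_torusMk k x, e2, e3, e4, smul_eq_mul]
        push_cast
        ring
      change ∫ y in cell d n, UnitAddTorus.mFourier (-k) (torusMk y) • Fc (torusMk y) = _
      rw [← integral_complex_eq_cellInt]
      exact integral_congr_ae (Filter.Eventually.of_forall e)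
    · refine Continuous.aestronglyMeasurable ?_
      fun_prop
  have hnorm : ∀ k, ‖UnitAddTorus.mFourierCoeff Fc k‖ ≤ coeffAbs x k u := by
    intro k
    rw [hcoeff]
    refine (norm_sub_le _ _).trans_eq ?_
    simp [coeffAbs, modeAbs]
  have hs := h.of_norm_bounded hnorm
  have hsum := UnitAddTorus.hasSum_mFourier_series_apply_of_summable hs (torusMk y)
  have hle : ∀ k, ‖UnitAddTorus.mFourierCoeff Fc k • UnitAddTorus.mFourier k (torusMk y)‖
      ≤ coeffAbs x k u := by
    intro k
    rw [norm_smul]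
    refine (mul_le_of_le_one_right (norm_nonneg _) ?_).trans (hnorm k)
    exact ((UnitAddTorus.mFourier k).norm_coe_le_norm _).trans_eq UnitAddTorus.mFourier_norm
  have h1 := tsum_of_norm_bounded h.hasSum hle
  rw [hsum.tsum_eq] at h1
  have e2 : Fc (torusMk y) = ((u (x, y) : ℝ) : ℂ) := congrArg (fun r : ℝ => (r : ℂ)) (hF y)
  rwa [e2, Complex.norm_real, Real.norm_eq_abs] at h1

end Fourier

section SmallDivisors

variable {d n : ℕ}

lemma summable_exp_neg_mul_abs {b : ℝ} (hb : 0 < b) :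
    Summable fun z : ℤ => rexp (-(b * |(z : ℝ)|)) := by
  have h : Summable fun j : ℕ => rexp (-(b * j)) := by
    have h1 := Real.summable_exp_nat_mul_iff (a := -b)
    simpa [mul_comm] using h1.2 (by linarith)
  exact Summable.of_nat_of_neg (by simpa using h) (by simpa using h)

lemma summable_prod_pi {ι κ : Type*} [Fintype ι] {f : κ → ℝ} (hf : ∀ z, 0 ≤ f z)
    (hs : Summable f) : Summable fun k : ι → κ => ∏ s, f (k s) := by
  classical
  refine summable_of_sum_le (c := ∏ _s : ι, ∑' z, f z)
    (fun k => Finset.prod_nonneg fun s _ => hf _) fun u => ?_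
  have hsub : u ⊆ Fintype.piFinset fun s => u.image fun k => k s := fun k hk =>
    Fintype.mem_piFinset.2 fun s => Finset.mem_image_of_mem _ hk
  refine (Finset.sum_le_sum_of_subset_of_nonneg hsub
    fun k _ _ => Finset.prod_nonneg fun s _ => hf _).trans ?_
  rw [← Finset.prod_univ_sum]
  exact Finset.prod_le_prod (fun s _ => Finset.sum_nonneg fun _ _ => hf _)
    fun s _ => hs.sum_le_tsum _ fun _ _ => hf _

/-- The `ℓ¹` size of a frequency. -/
def freqAbs {ι : Type*} [Fintype ι] (k : ι → ℤ) : ℝ := ∑ s, |(k s : ℝ)|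

lemma freqAbs_nonneg {ι : Type*} [Fintype ι] (k : ι → ℤ) : 0 ≤ freqAbs k :=
  Finset.sum_nonneg fun _ _ => abs_nonneg _

lemma summable_exp_neg_mul_freqAbs (ι : Type*) [Fintype ι] {b : ℝ} (hb : 0 < b) :
    Summable fun k : ι → ℤ => rexp (-(b * freqAbs k)) := by
  refine (summable_prod_pi (ι := ι) (fun _ => (exp_pos _).le)
    (summable_exp_neg_mul_abs hb)).congr fun k => ?_
  rw [← Real.exp_sum, freqAbs, Finset.mul_sum, Finset.sum_neg_distrib]

lemma phase_hatDir (δ : Fin n → ℝ) (l : Fin d) (k : Fin n × Fin d → ℤ) :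
    phase k (hatDir δ l) = 2 * π * ∑ i, (δ i)⁻¹ * (k (i, l) : ℝ) := by
  rw [phase_apply, hatDir, Fintype.sum_prod_type]
  congr 1
  refine Finset.sum_congr rfl fun i _ => ?_
  have h : ∀ l', (∑ j, (δ j)⁻¹ • (Pi.single j (Pi.single l 1) : Dom d n)) i l'
      = if l' = l then (δ i)⁻¹ else 0 := by
    intro l'
    rw [Finset.sum_apply, Finset.sum_apply, Finset.sum_eq_single i]
    · simp [Pi.single_apply]
    · intro j _ hj
      simp [Pi.single_eq_of_ne' hj]
    · simp
  simp only [h]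
  simp [mul_comm]

/-- A nonzero frequency is either non-resonant, or so large that it exceeds a scale ratio. -/
lemma small_divisor {δ : Fin n → ℝ} (hpos : ∀ i, 0 < δ i) (hle : ∀ i, δ i ≤ 1)
    (hanti : Antitone δ) {k : Fin n × Fin d → ℤ} (hk : k ≠ 0) :
    (∃ l, π ≤ |phase k (hatDir δ l)|) ∨
      ∃ i j : Fin n, (i : ℕ) + 1 = j ∧ δ i / (2 * δ j) ≤ freqAbs k := by
  classical
  by_contra! hcon
  obtain ⟨h1, h2⟩ := hcon
  obtain ⟨⟨i₀, l₀⟩, hs⟩ := Function.ne_iff.1 hk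
  obtain ⟨m, hm, hmax⟩ := (Finset.univ.filter fun i : Fin n => ∃ l, k (i, l) ≠ 0).exists_max_image id
    ⟨i₀, by simpa using ⟨l₀, hs⟩⟩
  obtain ⟨l, hl⟩ := (Finset.mem_filter.1 hm).2
  have hz : ∀ i, m < i → k (i, l) = 0 := by
    intro i hi
    by_contra h
    exact absurd (hmax i (by simpa using ⟨l, h⟩)) (not_le.2 hi)
  have hrest : |∑ i ∈ Finset.univ.erase m, (δ i)⁻¹ * (k (i, l) : ℝ)| ≤ (δ m)⁻¹ / 2 := by
    rcases Nat.eq_zero_or_pos (m : ℕ) with h0 | hmpos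
    · rw [Finset.sum_eq_zero]
      · rw [abs_zero]
        exact div_nonneg (inv_nonneg.2 (hpos m).le) zero_le_two
      · intro i hi
        have : m < i := by
          have := Finset.ne_of_mem_erase hi
          rw [Fin.lt_def]; rw [Ne, Fin.ext_iff] at this; omega
        simp [hz i this]
    · let p : Fin n := ⟨m - 1, by omega⟩
      have hp := h2 p m (by simp [p]; omega)
      have hb : ∀ i ∈ Finset.univ.erase m,
          |(δ i)⁻¹ * (k (i, l) : ℝ)| ≤ (δ p)⁻¹ * |(k (i, l) : ℝ)| := by
        intro i hi
        rw [abs_mul, abs_of_pos (inv_pos.2 (hpos i))]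
        rcases lt_or_gt_of_ne (Finset.ne_of_mem_erase hi) with h | h
        · refine mul_le_mul_of_nonneg_right ?_ (abs_nonneg _)
          refine inv_anti₀ (hpos p) (hanti ?_)
          rw [Fin.le_def]; rw [Fin.lt_def] at h; simp only [p]; omega
        · simp [hz i h]
      have hsum : ∑ i, |(k (i, l) : ℝ)| ≤ freqAbs k := by
        rw [freqAbs, Fintype.sum_prod_type]
        exact Finset.sum_le_sum fun i _ => Finset.single_le_sum
          (f := fun l' => |(k (i, l') : ℝ)|) (fun _ _ => abs_nonneg _) (Finset.mem_univ l)
      calc _ ≤ ∑ i ∈ Finset.univ.erase m, (δ p)⁻¹ * |(k (i, l) : ℝ)| :=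
            (Finset.abs_sum_le_sum_abs _ _).trans (Finset.sum_le_sum hb)
        _ ≤ ∑ i, (δ p)⁻¹ * |(k (i, l) : ℝ)| := Finset.sum_le_sum_of_subset_of_nonneg
            (Finset.erase_subset _ _) fun i _ _ =>
              mul_nonneg (inv_nonneg.2 (hpos p).le) (abs_nonneg _)
        _ ≤ (δ p)⁻¹ * freqAbs k := by
            rw [← Finset.mul_sum]
            exact mul_le_mul_of_nonneg_left hsum (inv_nonneg.2 (hpos p).le)
        _ ≤ (δ p)⁻¹ * (δ p / (2 * δ m)) :=
            mul_le_mul_of_nonneg_left hp.le (inv_nonneg.2 (hpos p).le)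
        _ = (δ m)⁻¹ / 2 := by
            have := (hpos p).ne'
            have := (hpos m).ne'
            field_simp
  have hone : (1 : ℝ) ≤ |(k (m, l) : ℝ)| := by exact_mod_cast Int.one_le_abs hl
  have hmain : (1 : ℝ) ≤ (δ m)⁻¹ := (one_le_inv₀ (hpos m)).2 (hle m)
  have hT : 1 / 2 ≤ |∑ i, (δ i)⁻¹ * (k (i, l) : ℝ)| := by
    rw [← Finset.add_sum_erase _ _ (Finset.mem_univ m)]
    have h3 := abs_sub_abs_le_abs_add ((δ m)⁻¹ * (k (m, l) : ℝ))
      (∑ i ∈ Finset.univ.erase m, (δ i)⁻¹ * (k (i, l) : ℝ))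
    have h4 : (δ m)⁻¹ ≤ |(δ m)⁻¹ * (k (m, l) : ℝ)| := by
      rw [abs_mul, abs_of_pos (inv_pos.2 (hpos m))]
      exact le_mul_of_one_le_right (inv_nonneg.2 (hpos m).le) hone
    linarith
  have h5 := h1 l
  rw [phase_hatDir, abs_mul, abs_of_pos Real.two_pi_pos] at h5
  nlinarith [Real.pi_pos]

lemma symbol_mul_le {σ t a B E : ℝ} (hσ : 0 ≤ σ) (ht : 0 < t) (ht1 : t ≤ 1) (ha : 0 ≤ a)
    (hB : 0 ≤ B) (hE : 0 ≤ E) (hE1 : E ≤ 1) (h : (σ + t) * a ≤ B * E ^ 2)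
    (hd : 1 ≤ σ ∨ E ≤ t) : (1 + σ) * a ≤ 2 * B * E := by
  have hBE : 0 ≤ B * E := mul_nonneg hB hE
  rcases hd with hd | hd
  · have h1 : (1 + σ) * a ≤ 2 * ((σ + t) * a) := by nlinarith
    nlinarith
  · have h1 : t * ((1 + σ) * a) ≤ t * (B * E) := by
      have h2 : t * (1 + σ) ≤ σ + t := by nlinarith
      nlinarith
    have := le_of_mul_le_mul_left h1 ht
    linarith

lemma exists_abs_ge_freqAbs_div (k : Fin n × Fin d → ℤ) (hk : k ≠ 0) :
    ∃ s, freqAbs k / (n * d) ≤ |(k s : ℝ)| := by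
  obtain ⟨s₀, -⟩ := Function.ne_iff.1 hk
  have hN : (0 : ℝ) < n * d := by
    have h1 : 0 < n := s₀.1.pos
    have h2 : 0 < d := s₀.2.pos
    positivity
  by_contra! hcon
  have h := Finset.sum_lt_sum_of_nonempty ⟨s₀, Finset.mem_univ s₀⟩ fun s _ => hcon s
  rw [Finset.sum_const, Finset.card_univ, Fintype.card_prod, Fintype.card_fin, Fintype.card_fin,
    nsmul_eq_mul] at h
  push_cast at h
  rw [mul_div_cancel₀ _ hN.ne'] at h
  exact lt_irrefl _ h

end SmallDivisors

section Resolvent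

variable {d n : ℕ}

/-- The coordinate derivation `∂ / ∂ y_i^k`, `s = (i, k)`. -/
def coordDeriv (s : Fin n × Fin d) : Derivation ℝ (SmoothPer d n) (SmoothPer d n) :=
  dirDeriv (0, Pi.single s.1 (Pi.single s.2 1))

/-- The derivation `∇̂ₖ`. -/
def hatDeriv (δ : Fin n → ℝ) (k : Fin d) : Derivation ℝ (SmoothPer d n) (SmoothPer d n) :=
  dirDeriv (hatDir δ k)

lemma cellInt_hatDeriv (x : Fin d → ℝ) (δ : Fin n → ℝ) (k : Fin d) (u : SmoothPer d n) :
    cellInt x (hatDeriv δ k u) = 0 := cellInt_dirDeriv_snd x _ u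

lemma cellInt_coordDeriv (x : Fin d → ℝ) (s : Fin n × Fin d) (u : SmoothPer d n) :
    cellInt x (coordDeriv s u) = 0 := cellInt_dirDeriv_snd x _ u

lemma isMode_hatDeriv (δ : Fin n → ℝ) (l : Fin d) (k : Fin n × Fin d → ℤ) :
    IsMode (hatDeriv δ l) (phase k (hatDir δ l)) (cosMode k) (sinMode k) := isMode_dirDeriv _ k

lemma phase_coord (k : Fin n × Fin d → ℤ) (s : Fin n × Fin d) :
    phase k (0, Pi.single s.1 (Pi.single s.2 1)) = 2 * π * k s := by
  rw [phase_apply, Finset.sum_eq_single s]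
  · simp
  · rintro ⟨i, l⟩ - hne
    by_cases hi : i = s.1
    · subst hi
      have hl : l ≠ s.2 := fun h => hne (Prod.ext rfl h)
      simp [hl]
    · simp [hi]
  · simp

lemma isMode_coordDeriv (s : Fin n × Fin d) (k : Fin n × Fin d → ℤ) :
    IsMode (coordDeriv s) (2 * π * k s) (cosMode k) (sinMode k) := by
  rw [← phase_coord]
  exact isMode_dirDeriv _ k

lemma coeffAbs_le_of_gevrey {x : Fin d → ℝ} {K M : ℝ} (hK : 0 ≤ K) (hM : 0 < M)
    {g : SmoothPer d n} (hg : ∀ s, Gevrey (cellInt x) (coordDeriv s) K M g)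
    {k : Fin n × Fin d → ℤ} (hk : k ≠ 0) :
    coeffAbs x k g ≤ 4 * K * rexp (-(π / (M * (n * d)) * freqAbs k)) := by
  obtain ⟨s, hs⟩ := exists_abs_ge_freqAbs_div k hk
  have hI := cellInt_mul_self_nonneg (n := n) x
  have hmode := isMode_coordDeriv s k
  have h : coeffAbs x k g ≤ _ := Gevrey.modeAbs_le hI (cellInt_coordDeriv x s) hM hmode
    (sNorm_cosMode_le x k) (sNorm_sinMode_le x k) (hg s)
  refine h.trans ?_
  rw [abs_mul, abs_of_pos Real.two_pi_pos]
  refine mul_le_mul_of_nonneg_left (Real.exp_le_exp.2 (neg_le_neg ?_)) (by positivity)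
  calc π / (M * (n * d)) * freqAbs k = π / M * (freqAbs k / (n * d)) := by
        rw [div_mul_eq_div_div]; ring
    _ ≤ π / M * |(k s : ℝ)| := by gcongr
    _ = 2 * π * |(k s : ℝ)| / (2 * M) := by field_simp

lemma coeffAbs_eq_zero_of_macroscopic {x : Fin d → ℝ} {f : SmoothPer d n}
    (hf : ∀ s, coordDeriv s f = 0) {k : Fin n × Fin d → ℤ} (hk : k ≠ 0) : coeffAbs x k f = 0 := by
  obtain ⟨s, hs⟩ := Function.ne_iff.1 hk
  have h := (isMode_coordDeriv s k).modeAbs_map (I := cellInt x) (cellInt_coordDeriv x s) f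
  rw [hf s] at h
  have h0 : modeAbs (cellInt x) (cosMode k) (sinMode k) (0 : SmoothPer d n) = 0 := by
    simp [modeAbs]
  rw [h0, eq_comm, mul_eq_zero] at h
  refine h.resolve_left (abs_ne_zero.2 (mul_ne_zero Real.two_pi_pos.ne' ?_))
  exact_mod_cast hs

lemma coeffAbs_zero_freq (x : Fin d → ℝ) (u : SmoothPer d n) :
    coeffAbs x 0 u = |cellInt x u| := by
  have hc : cosMode (0 : Fin n × Fin d → ℤ) = 1 := by
    ext p
    change cos (phase 0 p) = 1
    simp [phase_apply]
  have hs : sinMode (0 : Fin n × Fin d → ℤ) = 0 := by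
    ext p
    change sin (phase 0 p) = 0
    simp [phase_apply]
  simp [coeffAbs, modeAbs, hc, hs]

/-- The sum over all frequencies of the square root of the analytic decay rate. -/
def decaySum (d n : ℕ) (M : ℝ) : ℝ :=
  ∑' k : Fin n × Fin d → ℤ, rexp (-(π / (M * (n * d)) / 2 * freqAbs k))

lemma decaySum_nonneg (d n : ℕ) (M : ℝ) : 0 ≤ decaySum d n M :=
  tsum_nonneg fun _ => (exp_pos _).le

lemma coeffAbs_resolvent (x : Fin d → ℝ) (δ : Fin n → ℝ) (k : Fin n × Fin d → ℤ) {t : ℝ}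
    (ht : 0 ≤ t) (u : SmoothPer d n) :
    coeffAbs x k (-(∑ l, hatDeriv δ l (hatDeriv δ l u)) + t • u)
      = (∑ l, phase k (hatDir δ l) ^ 2 + t) * coeffAbs x k u := by
  have h1 := cellInt_hatDeriv x δ
  have h2 := fun l => isMode_hatDeriv δ l k
  exact modeAbs_resolvent h1 h2 ht u

lemma coeffAbs_add_le (x : Fin d → ℝ) (k : Fin n × Fin d → ℤ) (f g : SmoothPer d n) :
    coeffAbs x k (f + g) ≤ coeffAbs x k f + coeffAbs x k g := modeAbs_add_le _ _ f g

lemma coeffAbs_resolvent_le {x : Fin d → ℝ} {δ : Fin n → ℝ} (hpos : ∀ i, 0 < δ i)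
    (hle : ∀ i, δ i ≤ 1) (hanti : Antitone δ) {K M τ : ℝ} (hK : 0 ≤ K) (hM : 0 < M)
    (hτ : 0 < τ) (hτ1 : τ ≤ 1)
    (hdec : ∀ i j : Fin n, (i : ℕ) + 1 = j →
      rexp (-(π / (M * (n * d)) / 8 * (δ i / δ j))) ≤ τ)
    {u f g : SmoothPer d n} (heq : -(∑ k, hatDeriv δ k (hatDeriv δ k u)) + τ ^ 2 • u = f + g)
    (hf : ∀ s, coordDeriv s f = 0)
    (hg : ∀ s, Gevrey (cellInt x) (coordDeriv s) K M g) (hu : cellInt x u = 0)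
    (k : Fin n × Fin d → ℤ) :
    (1 + ∑ l, phase k (hatDir δ l) ^ 2) * coeffAbs x k u
      ≤ 8 * K * rexp (-(π / (M * (n * d)) / 2 * freqAbs k)) := by
  by_cases hk : k = 0
  · rw [hk, coeffAbs_zero_freq, hu, abs_zero, mul_zero]
    positivity
  set a := π / (M * (n * d)) with ha
  have ha0 : 0 ≤ a := by positivity
  have h1 : (∑ l, phase k (hatDir δ l) ^ 2 + τ ^ 2) * coeffAbs x k u
      ≤ 4 * K * rexp (-(a / 2 * freqAbs k)) ^ 2 := by
    have h2 := coeffAbs_resolvent x δ k (sq_nonneg τ) u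
    rw [heq] at h2
    have h3 := coeffAbs_add_le x k f g
    rw [coeffAbs_eq_zero_of_macroscopic hf hk, zero_add] at h3
    have h4 := coeffAbs_le_of_gevrey hK hM hg hk
    rw [← Real.exp_nat_mul]
    calc _ = coeffAbs x k (f + g) := h2.symm
      _ ≤ _ := h3.trans h4
      _ = _ := by push_cast; congr 2; ring
  have h5 := symbol_mul_le (Finset.sum_nonneg fun l _ => sq_nonneg (phase k (hatDir δ l)))
    (pow_pos hτ 2) (pow_le_one₀ hτ.le hτ1) (coeffAbs_nonneg x k u)
    (by positivity : 0 ≤ 4 * K) (exp_pos _).le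
    (Real.exp_le_one_iff.2 (neg_nonpos.2 (mul_nonneg (by positivity) (freqAbs_nonneg k)))) h1 ?_
  · linarith
  rcases small_divisor hpos hle hanti hk with ⟨l, hl⟩ | ⟨i, j, hij, hl⟩
  · left
    have h6 := Finset.single_le_sum (f := fun l => phase k (hatDir δ l) ^ 2)
      (fun _ _ => sq_nonneg _) (Finset.mem_univ l)
    have h7 : (1 : ℝ) ≤ |phase k (hatDir δ l)| := by linarith [Real.pi_gt_three]
    have h8 : 1 ≤ phase k (hatDir δ l) ^ 2 := by rw [← sq_abs]; exact one_le_pow₀ h7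
    exact h8.trans h6
  · right
    calc rexp (-(a / 2 * freqAbs k)) ≤ rexp (-(a / 2 * (δ i / (2 * δ j)))) := by gcongr
      _ = rexp (-(a / 8 * (δ i / δ j))) ^ 2 := by
        rw [← Real.exp_nat_mul]
        congr 1
        have := (hpos j).ne'
        push_cast
        field_simp
        ring
      _ ≤ τ ^ 2 := pow_le_pow_left₀ (exp_pos _).le (hdec i j hij) 2

lemma abs_le_decaySum (hd : 0 < d) (hn : 0 < n) {M K : ℝ} (hM : 0 < M) {x : Fin d → ℝ}
    {u : SmoothPer d n}
    (h : ∀ k, coeffAbs x k u ≤ 8 * K * rexp (-(π / (M * (n * d)) / 2 * freqAbs k)))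
    (y : Dom d n) : |u (x, y)| ≤ 8 * K * decaySum d n M := by
  have hs := (summable_exp_neg_mul_freqAbs (Fin n × Fin d)
    (b := π / (M * (n * d)) / 2) (by positivity)).mul_left (8 * K)
  have hc := hs.of_nonneg_of_le (coeffAbs_nonneg x · u) h
  rw [decaySum, ← tsum_mul_left]
  exact (abs_le_tsum_coeffAbs x u hc y).trans (hc.tsum_le_tsum h hs)

lemma resolvent_bounds (hd : 0 < d) (hn : 0 < n) {x : Fin d → ℝ} {δ : Fin n → ℝ}
    (hpos : ∀ i, 0 < δ i)
    (hle : ∀ i, δ i ≤ 1) (hanti : Antitone δ) {K M τ : ℝ} (hK : 0 ≤ K) (hM : 0 < M)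
    (hτ : 0 < τ) (hτ1 : τ ≤ 1)
    (hdec : ∀ i j : Fin n, (i : ℕ) + 1 = j →
      rexp (-(π / (M * (n * d)) / 8 * (δ i / δ j))) ≤ τ)
    {u f g : SmoothPer d n} (heq : -(∑ k, hatDeriv δ k (hatDeriv δ k u)) + τ ^ 2 • u = f + g)
    (hf : ∀ s, coordDeriv s f = 0)
    (hg : ∀ s, Gevrey (cellInt x) (coordDeriv s) K M g) (hu : cellInt x u = 0) (y : Dom d n) :
    (∀ k l, |hatDeriv δ k (hatDeriv δ l u) (x, y)| ≤ 8 * K * decaySum d n M) ∧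
      (∀ k, |hatDeriv δ k u (x, y)| ≤ 8 * K * decaySum d n M) ∧
      |u (x, y)| ≤ 8 * K * decaySum d n M := by
  have key := coeffAbs_resolvent_le hpos hle hanti hK hM hτ hτ1 hdec heq hf hg hu
  have hmode : ∀ k l v, coeffAbs x k (hatDeriv δ l v) = |phase k (hatDir δ l)| * coeffAbs x k v :=
    fun k l v => (isMode_hatDeriv δ l k).modeAbs_map (cellInt_hatDeriv x δ l) v
  have hsq : ∀ (k : Fin n × Fin d → ℤ) (l : Fin d),
      |phase k (hatDir δ l)| ^ 2 ≤ ∑ l, phase k (hatDir δ l) ^ 2 := fun k l => by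
    rw [sq_abs]
    exact Finset.single_le_sum (f := fun l => phase k (hatDir δ l) ^ 2)
      (fun _ _ => sq_nonneg _) (Finset.mem_univ l)
  refine ⟨fun l l' => abs_le_decaySum hd hn hM (fun k => ?_) y,
    fun l => abs_le_decaySum hd hn hM (fun k => ?_) y,
    abs_le_decaySum hd hn hM (fun k => ?_) y⟩
  · rw [hmode, hmode, ← mul_assoc]
    refine le_trans (mul_le_mul_of_nonneg_right ?_ (coeffAbs_nonneg x k u)) (key k)
    nlinarith [hsq k l, hsq k l', sq_nonneg (|phase k (hatDir δ l)| - |phase k (hatDir δ l')|)]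
  · rw [hmode]
    refine le_trans (mul_le_mul_of_nonneg_right ?_ (coeffAbs_nonneg x k u)) (key k)
    nlinarith [hsq k l, sq_nonneg (|phase k (hatDir δ l)| - 1)]
  · refine le_trans (le_mul_of_one_le_left (coeffAbs_nonneg x k u) ?_) (key k)
    linarith [Finset.sum_nonneg fun l (_ : l ∈ Finset.univ) => sq_nonneg (phase k (hatDir δ l))]

end Resolvent

section FluxCorrector

variable {d n : ℕ}

lemma DAbs_nonneg (ℓ : ℕ) (u : Dom d n → ℝ) (y : Dom d n) : 0 ≤ DAbs ℓ u y :=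
  Finset.sum_nonneg fun _ _ => abs_nonneg _

lemma mulGevrey_of_DAbs_le {x : Fin d → ℝ} {K M : ℝ} (hK : 0 ≤ K) (hM : 0 ≤ M)
    {a : SmoothPer d n}
    (h : ∀ ℓ y, DAbs ℓ (fun y' => a (x, y')) y ≤ K * M ^ ℓ * (ℓ.factorial : ℝ))
    (s : Fin n × Fin d) : MulGevrey (cellInt x) (coordDeriv s) K M a := fun ℓ u =>
  sNorm_mul_le x (by positivity)
    (fun y => (abs_iterate_dirDeriv_le_DAbs a x s ℓ y).trans (h ℓ y)) u

lemma gevrey_hatDeriv_corrector {x : Fin d → ℝ} {δ : Fin n → ℝ}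
    {A : Fin d → Fin d → SmoothPer d n} {lam K M K' M' t : ℝ} (hlam : 0 < lam) (hK : 0 ≤ K)
    (hM : 0 ≤ M) (hK' : 0 ≤ K') (hMM : 2 * M ≤ M') (hMK : 4 * (d : ℝ) ^ 2 * K * M ≤ lam * M')
    (ht : 0 ≤ t)
    (hell : ∀ (y : Dom d n) (ξ : Fin d → ℝ),
      lam * ∑ k, ξ k ^ 2 ≤ ∑ k, ξ k * ∑ l, A k l (x, y) * ξ l)
    (hA : ∀ k l s, MulGevrey (S := SmoothPer d n) (cellInt x) (coordDeriv s) K M (A k l))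
    {w : SmoothPer d n} {F : Fin d → SmoothPer d n}
    (heq : -(∑ k, hatDeriv δ k (∑ l, A k l * hatDeriv δ l w)) + t • w = ∑ k, hatDeriv δ k (F k))
    (s : Fin n × Fin d)
    (hF : ∀ k : Fin d, Gevrey (S := SmoothPer d n) (cellInt x) (coordDeriv s) K' M' (F k))
    (k : Fin d) :
    Gevrey (S := SmoothPer d n) (cellInt x) (coordDeriv s) (2 * d * K' / lam) M'
      (hatDeriv δ k w) := by
  have hI := cellInt_mul_self_nonneg (n := n) x
  have hDG : ∀ (k : Fin d) (u : SmoothPer d n),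
      coordDeriv s (hatDeriv δ k u) = hatDeriv δ k (coordDeriv s u) :=
    fun k u => dirDeriv_comm (0, Pi.single s.1 (Pi.single s.2 1)) (hatDir δ k) u
  have hG : ∀ (k : Fin d) (u : SmoothPer d n), cellInt x (hatDeriv δ k u) = 0 :=
    cellInt_hatDeriv x δ
  have hA' := fun k l => hA k l s
  have hco : ∀ g : Fin d → SmoothPer d n,
      lam * ∑ k, cellInt x (g k * g k) ≤ cellInt x (∑ k, g k * ∑ l, A k l * g l) := by
    intro g
    have h : cellInt x (lam • ∑ k, g k * g k) ≤ cellInt x (∑ k, g k * ∑ l, A k l * g l) := by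
      refine cellInt_mono x fun y => ?_
      have := hell y fun k => g k (x, y)
      simpa [← sq] using this
    simpa using h
  have h := gevrey_energy (S := SmoothPer d n) (I := cellInt x) (D := coordDeriv s)
    (G := fun k => hatDeriv δ k) (A := A) (t := t) (w := w) (F := F) hI hDG hG hlam hK hM hK' hMM
    (by rw [Fintype.card_fin]; exact hMK) ht hco hA' heq hF k
  rw [Fintype.card_fin] at h
  exact h

lemma dirDeriv_hatDeriv_comm (w : (Fin d → ℝ) × Dom d n) (δ : Fin n → ℝ) (k : Fin d)
    (u : SmoothPer d n) : dirDeriv w (hatDeriv δ k u) = hatDeriv δ k (dirDeriv w u) :=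
  dirDeriv_comm w (hatDir δ k) u

/-- The part of the right-hand side of the flux-corrector equation which depends on `y`. -/
def fluxSource (δ : Fin n → ℝ) (A : Fin d → Fin d → SmoothPer d n) (X : Fin d → SmoothPer d n)
    (i j : Fin d) : SmoothPer d n := -(A i j + ∑ k, A i k * hatDeriv δ k (X j))

lemma gevrey_fluxSource {x : Fin d → ℝ} {δ : Fin n → ℝ}
    {A : Fin d → Fin d → SmoothPer d n} {lam K M M' t : ℝ} (hlam : 0 < lam) (hK : 0 ≤ K)
    (hM : 0 ≤ M) (hMM : 2 * M ≤ M') (hMK : 4 * (d : ℝ) ^ 2 * K * M ≤ lam * M')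
    (ht : 0 ≤ t)
    (hell : ∀ (y : Dom d n) (ξ : Fin d → ℝ),
      lam * ∑ k, ξ k ^ 2 ≤ ∑ k, ξ k * ∑ l, A k l (x, y) * ξ l)
    (hA : ∀ k l s, MulGevrey (S := SmoothPer d n) (cellInt x) (coordDeriv s) K M (A k l))
    {X : Fin d → SmoothPer d n}
    (heq : ∀ j, -(∑ k, hatDeriv δ k (∑ l, A k l * hatDeriv δ l (X j))) + t • X j
      = ∑ k, hatDeriv δ k (A k j)) (i j : Fin d) (s : Fin n × Fin d) :
    Gevrey (S := SmoothPer d n) (cellInt x) (coordDeriv s)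
      (K + d * (2 * K * (2 * d * K / lam))) M' (fluxSource δ A X i j) := by
  have hI := cellInt_mul_self_nonneg (n := n) x
  have hAG : ∀ k l, Gevrey (S := SmoothPer d n) (cellInt x) (coordDeriv s) K M' (A k l) :=
    fun k l => Gevrey.mono hK (MulGevrey.gevrey (hA k l s) (sNorm_cellInt_one x)) le_rfl hM
      (by linarith)
  have hX := gevrey_hatDeriv_corrector hlam hK hM hK hMM hMK ht hell hA (heq j) s (hAG · j)
  have hP := Gevrey.sum hI fun k => Gevrey.mul hI hK hM (by positivity) hMM (hA i k s) (hX k)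
  rw [Fintype.card_fin] at hP
  exact Gevrey.neg (Gevrey.add hI (hAG i j) hP)

lemma gevrey_dirDeriv_fluxSource {x : Fin d → ℝ} {δ : Fin n → ℝ}
    {A : Fin d → Fin d → SmoothPer d n} {lam K L M M' t : ℝ} (hlam : 0 < lam) (hK : 0 ≤ K)
    (hL : 0 ≤ L)
    (hM : 0 ≤ M) (hMM : 2 * M ≤ M') (hMK : 4 * (d : ℝ) ^ 2 * K * M ≤ lam * M')
    (ht : 0 ≤ t)
    (hell : ∀ (y : Dom d n) (ξ : Fin d → ℝ),
      lam * ∑ k, ξ k ^ 2 ≤ ∑ k, ξ k * ∑ l, A k l (x, y) * ξ l)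
    (hA : ∀ k l s, MulGevrey (S := SmoothPer d n) (cellInt x) (coordDeriv s) K M (A k l))
    {w : (Fin d → ℝ) × Dom d n}
    (hAx : ∀ k l s,
      MulGevrey (S := SmoothPer d n) (cellInt x) (coordDeriv s) L M (dirDeriv w (A k l)))
    {X : Fin d → SmoothPer d n}
    (heq : ∀ j, -(∑ k, hatDeriv δ k (∑ l, A k l * hatDeriv δ l (X j))) + t • X j
      = ∑ k, hatDeriv δ k (A k j)) (i j : Fin d) (s : Fin n × Fin d) :
    Gevrey (S := SmoothPer d n) (cellInt x) (coordDeriv s)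
      ((1 + d * (2 * (2 * d * K / lam) + 2 * K * (2 * d * (1 + d * (2 * (2 * d * K / lam))) / lam)))
        * L) M' (dirDeriv w (fluxSource δ A X i j)) := by
  have hI := cellInt_mul_self_nonneg (n := n) x
  have hAG : ∀ k l, Gevrey (S := SmoothPer d n) (cellInt x) (coordDeriv s) K M' (A k l) :=
    fun k l => Gevrey.mono hK (MulGevrey.gevrey (hA k l s) (sNorm_cellInt_one x)) le_rfl hM
      (by linarith)
  have hAxG : ∀ k l, Gevrey (S := SmoothPer d n) (cellInt x) (coordDeriv s) L M'
      (dirDeriv w (A k l)) :=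
    fun k l => Gevrey.mono hL (MulGevrey.gevrey (hAx k l s) (sNorm_cellInt_one x)) le_rfl hM
      (by linarith)
  have hX := gevrey_hatDeriv_corrector hlam hK hM hK hMM hMK ht hell hA (heq j) s (hAG · j)
  have hB : 0 ≤ 2 * d * K / lam := by positivity
  set B := 2 * d * K / lam
  have hP : ∀ k, Gevrey (S := SmoothPer d n) (cellInt x) (coordDeriv s) (d * (2 * L * B)) M'
      (∑ l, dirDeriv w (A k l) * hatDeriv δ l (X j)) := by
    intro k
    have h := Gevrey.sum hI fun l => Gevrey.mul hI hL hM hB hMM (hAx k l s) (hX l)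
    rw [Fintype.card_fin] at h
    exact h
  have hF : ∀ k, Gevrey (S := SmoothPer d n) (cellInt x) (coordDeriv s) (L + d * (2 * L * B)) M'
      (dirDeriv w (A k j) + ∑ l, dirDeriv w (A k l) * hatDeriv δ l (X j)) := fun k =>
    Gevrey.add hI (hAxG k j) (hP k)
  have heq' : -(∑ k, hatDeriv δ k (∑ l, A k l * hatDeriv δ l (dirDeriv w (X j))))
      + t • dirDeriv w (X j) = ∑ k, hatDeriv δ k
        (dirDeriv w (A k j) + ∑ l, dirDeriv w (A k l) * hatDeriv δ l (X j)) := by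
    have h := congrArg (dirDeriv w) (heq j)
    simp only [map_add, map_neg, map_sum, Derivation.map_smul, dirDeriv_hatDeriv_comm,
      Derivation.leibniz, smul_eq_mul, Finset.sum_add_distrib] at h ⊢
    rw [← h]
    simp only [mul_comm]
    abel
  have hXx := gevrey_hatDeriv_corrector hlam hK hM (by positivity) hMM hMK ht hell hA heq' s hF
  have hQ : Gevrey (S := SmoothPer d n) (cellInt x) (coordDeriv s)
      (d * (2 * K * (2 * d * (L + d * (2 * L * B)) / lam))) M'
      (∑ l, A i l * hatDeriv δ l (dirDeriv w (X j))) := by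
    have h := Gevrey.sum hI fun l =>
      Gevrey.mul hI hK hM (by positivity) hMM (hA i l s) (hXx l)
    rw [Fintype.card_fin] at h
    exact h
  have h := Gevrey.neg (Gevrey.add hI (hAxG i j) (Gevrey.add hI (hP i) hQ))
  convert h using 1
  · field_simp
  · simp only [fluxSource, map_add, map_neg, map_sum, dirDeriv_hatDeriv_comm,
      Derivation.leibniz, smul_eq_mul, Finset.sum_add_distrib]
    simp only [mul_comm]
    abel

lemma coordDeriv_eq_zero {f : SmoothPer d n} {a : (Fin d → ℝ) → ℝ} (h : ∀ x y, f (x, y) = a x)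
    (s : Fin n × Fin d) : coordDeriv s f = 0 := by
  ext ⟨x, y⟩
  change dirDeriv (0, Pi.single s.1 (Pi.single s.2 1)) f (x, y) = 0
  rw [← fderiv_slice]
  simp [h]

lemma cellInt_const {f : SmoothPer d n} {x : Fin d → ℝ} {a : ℝ} (h : ∀ y, f (x, y) = a) :
    cellInt x f = a := by
  rw [cellInt_apply]
  simp [h]

lemma cellInt_resolvent (x : Fin d → ℝ) (δ : Fin n → ℝ) (t : ℝ) (u : SmoothPer d n) :
    cellInt x (-(∑ k, hatDeriv δ k (hatDeriv δ k u)) + t • u) = t * cellInt x u := by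
  simp [cellInt_hatDeriv]

/-- Bounds on a solution of the resolvent equation whose source is a centred analytic function,
and on its macroscopic derivative. -/
lemma centred_resolvent_bounds (hd : 0 < d) (hn : 0 < n) {δ : Fin n → ℝ} (hpos : ∀ i, 0 < δ i)
    (hle : ∀ i, δ i ≤ 1) (hanti : Antitone δ) {K L M τ : ℝ} (hK : 0 ≤ K) (hL : 0 ≤ L)
    (hM : 0 < M) (hτ : 0 < τ) (hτ1 : τ ≤ 1)
    (hdec : ∀ i j : Fin n, (i : ℕ) + 1 = j →
      rexp (-(π / (M * (n * d)) / 8 * (δ i / δ j))) ≤ τ)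
    {u g : SmoothPer d n}
    (heq : ∀ x y, (-(∑ k, hatDeriv δ k (hatDeriv δ k u)) + τ ^ 2 • u : SmoothPer d n) (x, y)
      = g (x, y) - cellInt x g)
    (x e : Fin d → ℝ)
    (hg : ∀ s, Gevrey (S := SmoothPer d n) (cellInt x) (coordDeriv s) K M g)
    (hgx : ∀ s, Gevrey (S := SmoothPer d n) (cellInt x) (coordDeriv s) L M (dirDeriv (e, 0) g))
    (y : Dom d n) :
    ((∀ k l, |hatDeriv δ k (hatDeriv δ l u) (x, y)| ≤ 8 * K * decaySum d n M) ∧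
      (∀ k, |hatDeriv δ k u (x, y)| ≤ 8 * K * decaySum d n M) ∧
      |u (x, y)| ≤ 8 * K * decaySum d n M) ∧
    ((∀ k l, |hatDeriv δ k (hatDeriv δ l (dirDeriv (e, 0) u)) (x, y)|
        ≤ 8 * L * decaySum d n M) ∧
      (∀ k, |hatDeriv δ k (dirDeriv (e, 0) u) (x, y)| ≤ 8 * L * decaySum d n M) ∧
      |dirDeriv (e, 0) u (x, y)| ≤ 8 * L * decaySum d n M) := by
  set f : SmoothPer d n := -(∑ k, hatDeriv δ k (hatDeriv δ k u)) + τ ^ 2 • u - g with hf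
  have hfv : ∀ x y, f (x, y) = -cellInt x g := fun x y => by
    have h := heq x y
    change (-(∑ k, hatDeriv δ k (hatDeriv δ k u)) + τ ^ 2 • u : SmoothPer d n) (x, y)
      - g (x, y) = _
    rw [h]; ring
  have hf0 : ∀ s, coordDeriv s f = 0 := coordDeriv_eq_zero hfv
  have hsum : -(∑ k, hatDeriv δ k (hatDeriv δ k u)) + τ ^ 2 • u = f + g := by
    rw [hf, sub_add_cancel]
  have hu : ∀ x, cellInt x u = 0 := fun x => by
    have h1 := congrArg (cellInt x) hsum
    rw [cellInt_resolvent, map_add, cellInt_const (hfv x), neg_add_cancel] at h1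
    exact (mul_eq_zero.1 h1).resolve_left (pow_pos hτ 2).ne'
  have hsumx : -(∑ k, hatDeriv δ k (hatDeriv δ k (dirDeriv (e, 0) u)))
      + τ ^ 2 • dirDeriv (e, 0) u = dirDeriv (e, 0) f + dirDeriv (e, 0) g := by
    have h := congrArg (dirDeriv (e, 0)) hsum
    simpa only [map_add, map_neg, map_sum, Derivation.map_smul, dirDeriv_hatDeriv_comm] using h
  have hfx0 : ∀ s, coordDeriv s (dirDeriv (e, 0) f) = 0 := fun s => by
    have h : coordDeriv s (dirDeriv (e, 0) f) = dirDeriv (e, 0) (coordDeriv s f) :=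
      dirDeriv_comm (0, Pi.single s.1 (Pi.single s.2 1)) (e, 0) f
    rw [h, hf0, map_zero]
  have hux := cellInt_dirDeriv_fst hu x e
  exact ⟨resolvent_bounds hd hn hpos hle hanti hK hM hτ hτ1 hdec hsum hf0 hg (hu x) y,
    resolvent_bounds hd hn hpos hle hanti hL hM hτ hτ1 hdec hsumx hfx0 hgx hux y⟩

end FluxCorrector

/-- Theorem 4.7: flux-corrector bounds with a macroscopic parameter, linear in the
`x`-Lipschitz constant `L₀`. -/
theorem statement11 (d n : ℕ) (hd : 1 ≤ d) (hn : 2 ≤ n) (lam C₀ Λ₀ : ℝ)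
    (hlam : lam ∈ Set.Ioc (0 : ℝ) 1) (hC₀ : 1 ≤ C₀) (hΛ₀ : 0 < Λ₀) :
    ∃ Ct c C : ℝ, 1 ≤ Ct ∧ 0 < c ∧ 1 ≤ C ∧
      ∀ L₀ : ℝ, 0 ≤ L₀ →
      ∀ (A : (Fin d → ℝ) → Dom d n → Fin d → Fin d → ℝ),
        (∀ k l, ContDiff ℝ (⊤ : ℕ∞) fun p : (Fin d → ℝ) × Dom d n => A p.1 p.2 k l) →
        (∀ x k l, MPeriodic fun y => A x y k l) →
        (∀ x, Elliptic lam (A x)) →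
        (∀ (x : Fin d → ℝ) (ℓ : ℕ) (y : Dom d n),
          (∑ k, ∑ l, DAbs ℓ (fun y' => A x y' k l) y) ≤ C₀ * Λ₀ ^ ℓ * (Nat.factorial ℓ : ℝ)) →
        (∀ (x : Fin d → ℝ) (ℓ : ℕ) (y : Dom d n),
          (∑ m, ∑ k, ∑ l, DAbs ℓ (fun y' => pdx m (fun x' => A x' y' k l) x) y)
            ≤ L₀ * Λ₀ ^ ℓ * (Nat.factorial ℓ : ℝ)) →
      ∀ (ε : ℕ → ℝ), ε 1 ≤ 1 → (∀ j : ℕ, 1 ≤ j → j ≤ n → 0 < ε j) →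
        (∀ j k : ℕ, 1 ≤ j → j < k → k ≤ n → ε k < ε j) →
        (∀ j : ℕ, 1 ≤ j → j ≤ n - 1 → ε (j + 1) ≤ Ct⁻¹ * ε j) →
      ∀ τ : ℝ, τ ∈ Set.Ioc (0 : ℝ) 1 →
        (∀ i : ℕ, 1 ≤ i → i ≤ n - 1 → Real.exp (-(c * ε i / ε (i + 1))) ≤ τ) →
      ∀ (X : Fin d → (Fin d → ℝ) → Dom d n → ℝ),
        (∀ j, ContDiff ℝ (⊤ : ℕ∞) fun p : (Fin d → ℝ) × Dom d n => X j p.1 p.2) →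
        (∀ j x, MPeriodic (X j x)) →
        (∀ (j : Fin d) (x : Fin d → ℝ) (y : Dom d n),
          -(∑ k, gradHatC (fun i => ε ((i : ℕ) + 1) / ε 1) n k
              (fun y' => ∑ l, A x y' k l
                * gradHatC (fun i' => ε ((i' : ℕ) + 1) / ε 1) n l (X j x) y') y)
              + τ ^ 2 * X j x y
            = ∑ k, gradHatC (fun i => ε ((i : ℕ) + 1) / ε 1) n k (fun y' => A x y' k j) y) →
      ∀ (U : (Fin d → ℝ) → Dom d n → Fin d → Fin d → ℝ),
        (∀ i j, ContDiff ℝ (⊤ : ℕ∞) fun p : (Fin d → ℝ) × Dom d n => U p.1 p.2 i j) →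
        (∀ x i j, MPeriodic fun y => U x y i j) →
        (∀ (i j : Fin d) (x : Fin d → ℝ) (y : Dom d n),
          -(∑ k, gradHatC (fun i' => ε ((i' : ℕ) + 1) / ε 1) n k
              (fun y' => gradHatC (fun i'' => ε ((i'' : ℕ) + 1) / ε 1) n k
                (fun y'' => U x y'' i j) y') y)
              + τ ^ 2 * U x y i j
            = (∫ y' in cell d n,
                (A x y' i j + ∑ k, A x y' i k
                  * gradHatC (fun i' => ε ((i' : ℕ) + 1) / ε 1) n k (X j x) y'))
              - A x y i j
              - ∑ k, A x y i k * gradHatC (fun i' => ε ((i' : ℕ) + 1) / ε 1) n k (X j x) y) →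
        (∀ (x : Fin d → ℝ) (y₁ y₂ y₃ : Dom d n),
          (∑ i : Fin d, ∑ j : Fin d, ∑ k : Fin d, ∑ l : Fin d,
              |gradHatC (fun i' => ε ((i' : ℕ) + 1) / ε 1) n k
                (fun y' => gradHatC (fun i'' => ε ((i'' : ℕ) + 1) / ε 1) n l
                  (fun y'' => U x y'' i j) y') y₁|)
            + (∑ i : Fin d, ∑ j : Fin d, ∑ k : Fin d,
                |gradHatC (fun i' => ε ((i' : ℕ) + 1) / ε 1) n k (fun y' => U x y' i j) y₂|)
            + (∑ i : Fin d, ∑ j : Fin d, |U x y₃ i j|)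
            ≤ C) ∧
        (∀ (x : Fin d → ℝ) (y₁ y₂ y₃ : Dom d n),
          (∑ m : Fin d, ∑ i : Fin d, ∑ j : Fin d, ∑ k : Fin d, ∑ l : Fin d,
              |gradHatC (fun i' => ε ((i' : ℕ) + 1) / ε 1) n k
                (fun y' => gradHatC (fun i'' => ε ((i'' : ℕ) + 1) / ε 1) n l
                  (fun y'' => pdx m (fun x' => U x' y'' i j) x) y') y₁|)
            + (∑ m : Fin d, ∑ i : Fin d, ∑ j : Fin d, ∑ k : Fin d,
                |gradHatC (fun i' => ε ((i' : ℕ) + 1) / ε 1) n k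
                  (fun y' => pdx m (fun x' => U x' y' i j) x) y₂|)
            + (∑ m : Fin d, ∑ i : Fin d, ∑ j : Fin d, |pdx m (fun x' => U x' y₃ i j) x|)
            ≤ C * L₀) := by
  obtain ⟨hlam0, hlam1⟩ := hlam
  have hd0 : (0 : ℝ) < d := by exact_mod_cast hd
  have hn0 : (0 : ℝ) < n := by exact_mod_cast (by omega : 0 < n)
  have hC0 : 0 < C₀ := by linarith
  set M : ℝ := 2 * Λ₀ + 4 * d ^ 2 * C₀ * Λ₀ / lam with hM
  have hM0 : 0 < M := by positivity
  have hMM : 2 * Λ₀ ≤ M := by rw [hM]; linarith [show 0 ≤ 4 * d ^ 2 * C₀ * Λ₀ / lam by positivity]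
  have hMK : 4 * (d : ℝ) ^ 2 * C₀ * Λ₀ ≤ lam * M := by
    rw [hM, mul_add, mul_div_cancel₀ _ hlam0.ne']
    linarith [show 0 ≤ lam * (2 * Λ₀) by positivity]
  set K : ℝ := C₀ + d * (2 * C₀ * (2 * d * C₀ / lam)) with hK
  set K' : ℝ := 1 + d * (2 * (2 * d * C₀ / lam)
    + 2 * C₀ * (2 * d * (1 + d * (2 * (2 * d * C₀ / lam))) / lam)) with hK'
  have hK0 : 0 ≤ K := by positivity
  have hK'0 : 0 ≤ K' := by positivity
  have hS : 0 ≤ decaySum d n M := decaySum_nonneg d n M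
  refine ⟨1, π / (M * (n * d)) / 8,
    1 + (d ^ 4 + d ^ 3 + d ^ 2) * (8 * K * decaySum d n M)
      + d * (d ^ 4 + d ^ 3 + d ^ 2) * (8 * K' * decaySum d n M), le_rfl, by positivity,
    by rw [add_assoc]; exact le_add_of_nonneg_right (by positivity), ?_⟩
  intro L₀ hL₀ A hAs hAp hAe hAD hAxD ε hε1 hε0 hεlt _ τ hτ hτexp X hXs hXp hXeq U hUs hUp hUeq
  set δ : Fin n → ℝ := fun i => ε ((i : ℕ) + 1) / ε 1 with hδ
  have hε : 0 < ε 1 := hε0 1 le_rfl (by omega)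
  have hpos : ∀ i, 0 < δ i := fun i => div_pos (hε0 _ (by omega) (by omega)) hε
  have hanti : Antitone δ := by
    intro i j hij
    rcases hij.eq_or_lt with rfl | h
    · exact le_rfl
    · exact div_le_div_of_nonneg_right
        (hεlt _ _ (by omega) (by simpa using h) (by omega)).le hε.le
  have hle : ∀ i, δ i ≤ 1 := fun i => by
    have h := hanti (Fin.mk_le_of_le_val (Nat.zero_le _) : (⟨0, by omega⟩ : Fin n) ≤ i)
    simpa [hδ, hε.ne'] using h
  have hdec : ∀ i j : Fin n, (i : ℕ) + 1 = j →
      rexp (-(π / (M * (n * d)) / 8 * (δ i / δ j))) ≤ τ := fun i j hij => by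
    have h := hτexp ((i : ℕ) + 1) (by omega) (by omega)
    have e : δ i / δ j = ε ((i : ℕ) + 1) / ε ((i : ℕ) + 1 + 1) := by
      simp only [hδ, ← hij]
      exact div_div_div_cancel_right₀ hε.ne' _ _
    rw [e, ← mul_div_assoc]
    exact h
  obtain ⟨a, ha⟩ : ∃ a : Fin d → Fin d → SmoothPer d n, ∀ k l x y, a k l (x, y) = A x y k l :=
    ⟨fun k l => ⟨fun p => A p.1 p.2 k l, hAs k l, fun x => hAp x k l⟩, fun _ _ _ _ => rfl⟩
  obtain ⟨χ, hχ⟩ : ∃ χ : Fin d → SmoothPer d n, ∀ j x y, χ j (x, y) = X j x y :=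
    ⟨fun j => ⟨fun p => X j p.1 p.2, hXs j, fun x => hXp j x⟩, fun _ _ _ => rfl⟩
  obtain ⟨u, hu⟩ : ∃ u : Fin d → Fin d → SmoothPer d n, ∀ i j x y, u i j (x, y) = U x y i j :=
    ⟨fun i j => ⟨fun p => U p.1 p.2 i j, hUs i j, fun x => hUp x i j⟩, fun _ _ _ _ => rfl⟩
  have hgrad : ∀ (k : Fin d) (v : SmoothPer d n) x y,
      gradHatC δ n k (fun y' => v (x, y')) y = hatDeriv δ k v (x, y) :=
    fun k v x y => gradHatC_slice δ k v x y
  have hdx : ∀ (m : Fin d) (v : SmoothPer d n) x y,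
      pdx m (fun x' => v (x', y)) x = dirDeriv (Pi.single m 1, 0) v (x, y) :=
    fun m v x y => pdx_slice v x y m
  have hell : ∀ (x : Fin d → ℝ) (y : Dom d n) (ξ : Fin d → ℝ),
      lam * ∑ k, ξ k ^ 2 ≤ ∑ k, ξ k * ∑ l, a k l (x, y) * ξ l := fun x y ξ => by
    simpa only [ha] using (hAe x y ξ).1
  have hAG : ∀ x k l s,
      MulGevrey (S := SmoothPer d n) (cellInt x) (coordDeriv s) C₀ Λ₀ (a k l) := by
    intro x k l s
    refine mulGevrey_of_DAbs_le hC0.le hΛ₀.le (fun ℓ y => ?_) s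
    simp only [ha]
    refine le_trans ?_ (hAD x ℓ y)
    refine le_trans ?_ (Finset.single_le_sum (fun k _ => Finset.sum_nonneg
      fun l _ => DAbs_nonneg _ _ _) (Finset.mem_univ k))
    exact Finset.single_le_sum (f := fun l => DAbs ℓ (fun y' => A x y' k l) y)
      (fun l _ => DAbs_nonneg _ _ _) (Finset.mem_univ l)
  have hAxG : ∀ x m k l s, MulGevrey (S := SmoothPer d n) (cellInt x) (coordDeriv s) L₀ Λ₀
      (dirDeriv (Pi.single m 1, 0) (a k l)) := by
    intro x m k l s
    refine mulGevrey_of_DAbs_le hL₀ hΛ₀.le (fun ℓ y => ?_) s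
    simp only [← hdx, ha]
    refine le_trans ?_ (hAxD x ℓ y)
    refine le_trans ?_ (Finset.single_le_sum (fun m _ => Finset.sum_nonneg fun k _ =>
      Finset.sum_nonneg fun l _ => DAbs_nonneg _ _ _) (Finset.mem_univ m))
    refine le_trans ?_ (Finset.single_le_sum (fun k _ => Finset.sum_nonneg
      fun l _ => DAbs_nonneg _ _ _) (Finset.mem_univ k))
    exact Finset.single_le_sum
      (f := fun l => DAbs ℓ (fun y' => pdx m (fun x' => A x' y' k l) x) y)
      (fun l _ => DAbs_nonneg _ _ _) (Finset.mem_univ l)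
  have hXE : ∀ j, -(∑ k, hatDeriv δ k (∑ l, a k l * hatDeriv δ l (χ j))) + τ ^ 2 • χ j
      = ∑ k, hatDeriv δ k (a k j) := by
    intro j
    ext ⟨x, y⟩
    have h := hXeq j x y
    have e1 : ∀ k y', ∑ l, A x y' k l * gradHatC δ n l (X j x) y'
        = (∑ l, a k l * hatDeriv δ l (χ j) : SmoothPer d n) (x, y') := fun k y' => by
      simp [← ha, ← hgrad, hχ]
    simp only [e1, hgrad] at h
    simp only [← ha, ← hχ, hgrad] at h
    simpa using h
  have hUE : ∀ i j x y,
      (-(∑ k, hatDeriv δ k (hatDeriv δ k (u i j))) + τ ^ 2 • u i j : SmoothPer d n) (x, y)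
      = fluxSource δ a χ i j (x, y) - cellInt x (fluxSource δ a χ i j) := by
    intro i j x y
    have h := hUeq i j x y
    have e1 : ∀ y', A x y' i j + ∑ k, A x y' i k * gradHatC δ n k (X j x) y'
        = (a i j + ∑ k, a i k * hatDeriv δ k (χ j) : SmoothPer d n) (x, y') := fun y' => by
      simp [← ha, ← hgrad, hχ]
    have e2 : (fluxSource δ a χ i j) (x, y)
        = -(A x y i j + ∑ k, A x y i k * gradHatC δ n k (X j x) y) := by
      rw [e1]; rfl
    simp only [e1, ← cellInt_apply] at h
    simp only [← hu, hgrad] at h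
    rw [e2, fluxSource, map_neg]
    have e3 : (-(∑ k, hatDeriv δ k (hatDeriv δ k (u i j))) + τ ^ 2 • u i j : SmoothPer d n) (x, y)
        = -(∑ k, hatDeriv δ k (hatDeriv δ k (u i j)) (x, y)) + τ ^ 2 * u i j (x, y) := by simp
    rw [e3, h]
    ring
  have key : ∀ (x y) (m i j : Fin d), _ := fun x y m i j =>
    centred_resolvent_bounds (by omega) (by omega) hpos hle hanti hK0 (mul_nonneg hK'0 hL₀) hM0
      hτ.1 hτ.2 hdec (hUE i j) x (Pi.single m 1)
      (gevrey_fluxSource hlam0 hC0.le hΛ₀.le hMM hMK (sq_nonneg τ) (hell x) (hAG x) hXE i j)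
      (gevrey_dirDeriv_fluxSource hlam0 hC0.le hL₀ hΛ₀.le hMM hMK (sq_nonneg τ) (hell x) (hAG x)
        (hAxG x m) hXE i j) y
  have hsum : ∀ (f : Fin d → ℝ) (B : ℝ), (∀ i, f i ≤ B) → ∑ i, f i ≤ d * B := fun f B h => by
    simpa using Finset.sum_le_card_nsmul Finset.univ f B fun i _ => h i
  simp only [← hu, hgrad, hdx]
  have m₀ : Fin d := ⟨0, by omega⟩
  constructor
  · intro x y₁ y₂ y₃
    have b1 := hsum _ _ fun i => hsum _ _ fun j => hsum _ _ fun k => hsum _ _ fun l =>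
      (key x y₁ m₀ i j).1.1 k l
    have b2 := hsum _ _ fun i => hsum _ _ fun j => hsum _ _ fun k => (key x y₂ m₀ i j).1.2.1 k
    have b3 := hsum _ _ fun i => hsum _ _ fun j => (key x y₃ m₀ i j).1.2.2
    refine (add_le_add (add_le_add b1 b2) b3).trans ?_
    have : 0 ≤ d * (d ^ 4 + d ^ 3 + d ^ 2) * (8 * K' * decaySum d n M) := by positivity
    linarith
  · intro x y₁ y₂ y₃
    have b1 := hsum _ _ fun m => hsum _ _ fun i => hsum _ _ fun j => hsum _ _ fun k =>
      hsum _ _ fun l => (key x y₁ m i j).2.1 k l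
    have b2 := hsum _ _ fun m => hsum _ _ fun i => hsum _ _ fun j => hsum _ _ fun k =>
      (key x y₂ m i j).2.2.1 k
    have b3 := hsum _ _ fun m => hsum _ _ fun i => hsum _ _ fun j => (key x y₃ m i j).2.2.2
    refine (add_le_add (add_le_add b1 b2) b3).trans ?_
    have : 0 ≤ (1 + (d ^ 4 + d ^ 3 + d ^ 2) * (8 * K * decaySum d n M)) * L₀ := by positivity
    linarith

end MS
end
end

section
/- Quadratic accuracy of the zero-order regularization of the single-scale homogenized matrix (from the proof of Proposition 4.6): Let d ≥ 1, λ ∈ (0,1] and τ > 0. Let A : ℝ^d → ℝ^{d×d} be smooth and ℤ^d-periodic with ξ·A(y)ξ ≥ λ|ξ|² and |A(y)ξ| ≤ λ⁻¹|ξ| for all y, ξ ∈ ℝ^d. Fix j ∈ {1,…,d} and let ψ_τ, ψ₀ : ℝ^d → ℝ be smooth ℤ^d-periodic functions with ∫_{[0,1]^d} ψ₀ = 0, satisfying −∇·(A∇ψ_τ) + τ²·ψ_τ = ∇·(A eⱼ) and −∇·(A∇ψ₀) = ∇·(A eⱼ) pointwise on ℝ^d. Then there exists a constant C, depending only on d and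 λ, such that (∫_{[0,1]^d} |∇ψ_τ − ∇ψ₀|²)^{1/2} ≤ C·τ², and consequently the vector ∫_{[0,1]^d} A·(∇ψ_τ − ∇ψ₀) has Euclidean norm at most C·τ². -/
open MeasureTheory Real

noncomputable section

namespace MS12

/-- Partial derivative in the k-th coordinate direction of `ℝ^d`. -/
def pd1 {d : ℕ} (k : Fin d) (u : (Fin d → ℝ) → ℝ) (y : Fin d → ℝ) : ℝ :=
  fderiv ℝ u y (Pi.single k 1)

/-- ℤ^d-periodicity. -/
def ZPeriodic {d : ℕ} (u : (Fin d → ℝ) → ℝ) : Prop :=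
  ∀ (y : Fin d → ℝ) (z : Fin d → ℤ), u (fun k => y k + (z k : ℝ)) = u y

/-- The unit cell `[0,1]^d`. -/
def cell1 (d : ℕ) : Set (Fin d → ℝ) := Set.Icc 0 1

section Averages

/-- Jensen's inequality for the square function. -/
theorem sq_integral_le_integral_sq {α : Type*} [MeasurableSpace α] {μ : Measure α}
    [IsProbabilityMeasure μ] {f : α → ℝ} (hf : Integrable f μ)
    (hf2 : Integrable (fun x => f x ^ 2) μ) : (∫ x, f x ∂μ) ^ 2 ≤ ∫ x, f x ^ 2 ∂μ := by
  set m := ∫ x, f x ∂μ with hm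
  have h0 : 0 ≤ ∫ x, (f x - m) ^ 2 ∂μ := integral_nonneg fun x => sq_nonneg _
  have h1 : ∫ x, (f x - m) ^ 2 ∂μ = (∫ x, f x ^ 2 ∂μ) - 2 * m * m + m ^ 2 := by
    have e : (fun x => (f x - m) ^ 2) = fun x => f x ^ 2 - 2 * m * f x + m ^ 2 := by
      ext x; ring
    rw [e, integral_add (f := fun x => f x ^ 2 - 2 * m * f x) (hf2.sub (hf.const_mul _))
      (integrable_const _),
      integral_sub hf2 (hf.const_mul _), integral_const_mul, ← hm]
    simp
  nlinarith

/-- Fubini's theorem for a continuous function on a product of compact sets. -/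
theorem setIntegral_setIntegral_swap_of_continuous {X Y : Type*}
    [TopologicalSpace X] [MeasurableSpace X] [OpensMeasurableSpace X] [SecondCountableTopology X]
    [T2Space X] [TopologicalSpace Y] [MeasurableSpace Y] [OpensMeasurableSpace Y] [T2Space Y]
    {μ : Measure X} {ν : Measure Y} [IsFiniteMeasureOnCompacts μ] [IsFiniteMeasureOnCompacts ν]
    [SFinite μ] [SFinite ν]
    {K : Set X} {L : Set Y} (hK : IsCompact K) (hL : IsCompact L) {f : X → Y → ℝ}
    (hf : Continuous (Function.uncurry f)) :
    ∫ x in K, ∫ y in L, f x y ∂ν ∂μ = ∫ y in L, ∫ x in K, f x y ∂μ ∂ν := by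
  apply integral_integral_swap
  rw [Measure.prod_restrict]
  refine hf.continuousOn.integrableOn_of_subset_isCompact (hK.prod hL)
    (hK.measurableSet.prod hL.measurableSet) subset_rfl ?_
  rw [Measure.prod_prod]
  exact ENNReal.mul_ne_top hK.measure_lt_top.ne hL.measure_lt_top.ne

end Averages

variable {d : ℕ}

theorem isCompact_cell1 : IsCompact (cell1 d) := isCompact_Icc

theorem volume_cell1 : volume (cell1 d) = 1 := by
  simp [cell1, Real.volume_Icc_pi]

instance isProbabilityMeasure_cell1 : IsProbabilityMeasure (volume.restrict (cell1 d)) :=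
  ⟨by simp [volume_cell1]⟩

instance isProbabilityMeasure_Icc : IsProbabilityMeasure (volume.restrict (Set.Icc (0 : ℝ) 1)) :=
  ⟨by simp⟩

theorem integrable_cell1 {f : (Fin d → ℝ) → ℝ} (hf : Continuous f) :
    Integrable f (volume.restrict (cell1 d)) :=
  hf.continuousOn.integrableOn_compact isCompact_cell1

theorem integrable_Icc {f : ℝ → ℝ} (hf : Continuous f) :
    Integrable f (volume.restrict (Set.Icc (0 : ℝ) 1)) :=
  hf.continuousOn.integrableOn_compact isCompact_Icc

namespace ZPeriodic

variable {u v : (Fin d → ℝ) → ℝ}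

theorem mul (hu : ZPeriodic u) (hv : ZPeriodic v) : ZPeriodic fun y => u y * v y := fun y z => by
  simp only [hu y z, hv y z]

theorem sub (hu : ZPeriodic u) (hv : ZPeriodic v) : ZPeriodic fun y => u y - v y := fun y z => by
  simp only [hu y z, hv y z]

theorem sum {ι : Type*} {s : Finset ι} {f : ι → (Fin d → ℝ) → ℝ} (hf : ∀ i, ZPeriodic (f i)) :
    ZPeriodic fun y => ∑ i ∈ s, f i y := fun y z => by
  simp only [fun i => hf i y z]

theorem pow (hu : ZPeriodic u) (n : ℕ) : ZPeriodic fun y => u y ^ n := fun y z => by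
  simp only [hu y z]

theorem partialDeriv (hu : ZPeriodic u) (k : Fin d) : ZPeriodic (pd1 k u) := fun y z => by
  have h : (fun x => u (x + fun k => (z k : ℝ))) = u := funext fun x => hu x z
  have h2 := fderiv_comp_add_right (𝕜 := ℝ) (f := u) (x := y) (fun k => (z k : ℝ))
  rw [h] at h2
  unfold pd1
  rw [h2]
  rfl

/-- The integral of a periodic function over the unit cell is invariant under translation. -/
theorem integral_add_right (hu : ZPeriodic u) (h : Fin d → ℝ) :
    ∫ y in cell1 d, u (y + h) = ∫ y in cell1 d, u y := by
  have key : ∀ f : (Fin d → ℝ) → ℝ, ∫ y in cell1 d, f y =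
      ∫ y in ZSpan.fundamentalDomain (Pi.basisFun ℝ (Fin d)), f y := fun f => by
    rw [ZSpan.fundamentalDomain_pi_basisFun]
    exact (setIntegral_congr_set Measure.univ_pi_Ico_ae_eq_Icc).symm
  rw [key, key]
  set D := ZSpan.fundamentalDomain (Pi.basisFun ℝ (Fin d))
  have hD := ZSpan.isAddFundamentalDomain' (Pi.basisFun ℝ (Fin d)) volume
  have hDh := hD.vadd_of_comm h
  have : ∫ y in D, u (y + h) = ∫ y in (fun y => y + h) '' D, u y := by
    rw [(measurePreserving_add_right volume h).setIntegral_image_emb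
      (measurableEmbedding_addRight h)]
  have hset : (fun y => y + h) '' D = (fun y => h +ᵥ y) '' D :=
    Set.image_congr fun y _ => add_comm y h
  rw [this, hset]
  have : Countable (Submodule.span ℤ (Set.range (Pi.basisFun ℝ (Fin d)))).toAddSubgroup :=
    inferInstanceAs (Countable (Submodule.span ℤ (Set.range (Pi.basisFun ℝ (Fin d)))))
  refine hDh.setIntegral_eq hD fun g x => ?_
  have hg := ((Pi.basisFun ℝ (Fin d)).mem_span_iff_repr_mem ℤ g.1).mp g.2
  choose z hz using hg
  rw [← hu x z]
  congr 1
  ext k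
  have := hz k
  simp only [Pi.basisFun_repr] at this
  change g.1 k + x k = _
  rw [← this, add_comm]
  simp

end ZPeriodic

section Calculus

variable {u v : (Fin d → ℝ) → ℝ}

theorem contDiff_pd1 (hu : ContDiff ℝ (⊤ : ℕ∞) u) (k : Fin d) : ContDiff ℝ (⊤ : ℕ∞) (pd1 k u) :=
  (hu.fderiv_right (by simp)).clm_apply contDiff_const

theorem continuous_pd1 (hu : ContDiff ℝ (⊤ : ℕ∞) u) (k : Fin d) : Continuous (pd1 k u) :=
  (contDiff_pd1 hu k).continuous

theorem pd1_sub (hu : ContDiff ℝ (⊤ : ℕ∞) u) (hv : ContDiff ℝ (⊤ : ℕ∞) v) (k : Fin d)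
    (y : Fin d → ℝ) : pd1 k (fun x => u x - v x) y = pd1 k u y - pd1 k v y := by
  unfold pd1
  rw [fderiv_fun_sub (hu.differentiable (by simp) y) (hv.differentiable (by simp) y)]
  rfl

theorem pd1_mul (hu : ContDiff ℝ (⊤ : ℕ∞) u) (hv : ContDiff ℝ (⊤ : ℕ∞) v) (k : Fin d)
    (y : Fin d → ℝ) : pd1 k (fun x => u x * v x) y = u y * pd1 k v y + pd1 k u y * v y := by
  unfold pd1
  rw [fderiv_fun_mul (hu.differentiable (by simp) y) (hv.differentiable (by simp) y)]
  simp [mul_comm]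

theorem fderiv_apply_eq_sum_pd1 (y h : Fin d → ℝ) :
    fderiv ℝ u y h = ∑ k, h k * pd1 k u y := by
  have := LinearMap.pi_apply_eq_sum_univ (fderiv ℝ u y).toLinearMap h
  simp only [ContinuousLinearMap.coe_coe, smul_eq_mul] at this
  rw [this]
  refine Finset.sum_congr rfl fun k _ => ?_
  unfold pd1
  congr 2
  ext i
  simp [Pi.single_apply, eq_comm]

theorem continuous_fderiv_shift (hu : ContDiff ℝ (⊤ : ℕ∞) u) (h : Fin d → ℝ) :
    Continuous fun p : (Fin d → ℝ) × ℝ => fderiv ℝ u (p.1 + p.2 • h) h :=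
  ((hu.continuous_fderiv (by simp)).comp (by fun_prop)).clm_apply continuous_const

theorem sub_eq_integral_fderiv (hu : ContDiff ℝ (⊤ : ℕ∞) u) (x h : Fin d → ℝ) :
    u (x + h) - u x = ∫ t in Set.Icc (0 : ℝ) 1, fderiv ℝ u (x + t • h) h := by
  have hd : ∀ t ∈ Set.uIcc (0 : ℝ) 1,
      HasDerivAt (fun t : ℝ => u (x + t • h)) (fderiv ℝ u (x + t • h) h) t := fun t _ => by
    have h1 : HasDerivAt (fun t : ℝ => x + t • h) h t := by
      simpa using ((hasDerivAt_id t).smul_const h).const_add x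
    exact (hu.differentiable (by simp) _).hasFDerivAt.comp_hasDerivAt t h1
  have hc : Continuous fun t : ℝ => fderiv ℝ u (x + t • h) h :=
    (continuous_fderiv_shift hu h).comp (Continuous.prodMk_right x)
  have := intervalIntegral.integral_eq_sub_of_hasDerivAt hd (hc.intervalIntegrable _ _)
  rw [integral_Icc_eq_integral_Ioc, ← intervalIntegral.integral_of_le zero_le_one, this]
  simp

theorem integral_pd1_eq_zero (hu : ContDiff ℝ (⊤ : ℕ∞) u) (hp : ZPeriodic u) (k : Fin d) :
    ∫ y in cell1 d, pd1 k u y = 0 := by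
  set e : Fin d → ℝ := Pi.single k 1 with he
  have h1 : ∀ x, ∫ t in Set.Icc (0 : ℝ) 1, fderiv ℝ u (x + t • e) e = 0 := fun x => by
    rw [← sub_eq_integral_fderiv hu, sub_eq_zero]
    conv_rhs => rw [← hp x (Pi.single k 1)]
    congr 1
    ext i
    by_cases hi : i = k
    · subst hi; simp [he]
    · simp [he, hi]
  have h2 := setIntegral_setIntegral_swap_of_continuous (μ := volume) (ν := volume)
    (isCompact_cell1 (d := d)) (isCompact_Icc (a := (0 : ℝ)) (b := 1))
    (f := fun x t => fderiv ℝ u (x + t • e) e) (continuous_fderiv_shift hu e)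
  simp only [h1, integral_zero] at h2
  have h3 : ∀ t : ℝ, ∫ y in cell1 d, fderiv ℝ u (y + t • e) e = ∫ y in cell1 d, pd1 k u y :=
    fun t => (hp.partialDeriv k).integral_add_right (t • e)
  simp only [h3] at h2
  simpa using h2.symm

/-- Integration by parts for periodic functions on the unit cell. -/
theorem integral_div_mul {F : Fin d → (Fin d → ℝ) → ℝ} (hF : ∀ k, ContDiff ℝ (⊤ : ℕ∞) (F k))
    (hFp : ∀ k, ZPeriodic (F k)) (hv : ContDiff ℝ (⊤ : ℕ∞) v) (hvp : ZPeriodic v) :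
    ∫ y in cell1 d, (∑ k, pd1 k (F k) y) * v y = -∫ y in cell1 d, ∑ k, F k y * pd1 k v y := by
  have c1 : ∀ k, Continuous fun y => F k y * pd1 k v y := fun k =>
    (hF k).continuous.mul (continuous_pd1 hv k)
  have c2 : ∀ k, Continuous fun y => pd1 k (F k) y * v y := fun k =>
    (continuous_pd1 (hF k) k).mul hv.continuous
  rw [eq_neg_iff_add_eq_zero]
  simp only [Finset.sum_mul]
  rw [integral_finsetSum _ fun k _ => integrable_cell1 (c2 k),
    integral_finsetSum _ fun k _ => integrable_cell1 (c1 k), ← Finset.sum_add_distrib]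
  refine Finset.sum_eq_zero fun k _ => ?_
  rw [← integral_add (integrable_cell1 (c2 k)) (integrable_cell1 (c1 k)),
    ← integral_pd1_eq_zero ((hF k).mul hv) ((hFp k).mul hvp) k]
  congr 1
  ext y
  rw [pd1_mul (hF k) hv, add_comm]

theorem continuous_sum_pd1_sq (hu : ContDiff ℝ (⊤ : ℕ∞) u) :
    Continuous fun y => ∑ k, pd1 k u y ^ 2 :=
  continuous_finsetSum _ fun k _ => (continuous_pd1 hu k).pow 2

/-- The mean square increment of a periodic function is controlled by its gradient. -/
theorem integral_sq_shift_sub_le (hu : ContDiff ℝ (⊤ : ℕ∞) u) (hp : ZPeriodic u)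
    {h : Fin d → ℝ} (hh : h ∈ cell1 d) :
    ∫ x in cell1 d, (u (x + h) - u x) ^ 2 ≤ d * ∫ y in cell1 d, ∑ k, pd1 k u y ^ 2 := by
  have hc := continuous_fderiv_shift hu h
  have hc2 : Continuous fun p : (Fin d → ℝ) × ℝ => (fderiv ℝ u (p.1 + p.2 • h) h) ^ 2 := hc.pow 2
  have hc' : ∀ x, Continuous fun t : ℝ => fderiv ℝ u (x + t • h) h := fun x =>
    hc.comp (Continuous.prodMk_right x)
  have hG : ∀ t : ℝ, ∫ x in cell1 d, ∑ k, pd1 k u (x + t • h) ^ 2 =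
      ∫ y in cell1 d, ∑ k, pd1 k u y ^ 2 := fun t =>
    (ZPeriodic.sum fun k => (hp.partialDeriv k).pow 2).integral_add_right (t • h)
  calc ∫ x in cell1 d, (u (x + h) - u x) ^ 2
      ≤ ∫ x in cell1 d, ∫ t in Set.Icc (0 : ℝ) 1, (fderiv ℝ u (x + t • h) h) ^ 2 := by
        refine integral_mono (integrable_cell1 ?_) ?_ fun x => ?_
        · have := hu.continuous
          fun_prop
        · exact integrable_cell1
            (continuous_parametric_integral_of_continuous (hc.pow 2) isCompact_Icc)
        · rw [sub_eq_integral_fderiv hu]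
          exact sq_integral_le_integral_sq (integrable_Icc (hc' x)) (integrable_Icc ((hc' x).pow 2))
    _ = ∫ t in Set.Icc (0 : ℝ) 1, ∫ x in cell1 d, (fderiv ℝ u (x + t • h) h) ^ 2 :=
        setIntegral_setIntegral_swap_of_continuous (f := fun x t => (fderiv ℝ u (x + t • h) h) ^ 2)
          isCompact_cell1 isCompact_Icc hc2
    _ ≤ ∫ t in Set.Icc (0 : ℝ) 1, (d : ℝ) * ∫ y in cell1 d, ∑ k, pd1 k u y ^ 2 := by
        refine integral_mono (integrable_Icc ?_) (integrable_const _) fun t => ?_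
        · exact continuous_parametric_integral_of_continuous
            ((hc.comp continuous_swap).pow 2) isCompact_cell1
        · simp only
          rw [← hG t, ← integral_const_mul]
          refine integral_mono (integrable_cell1 ?_) (integrable_cell1 ?_) fun x => ?_
          · exact (hc.comp (Continuous.prodMk_left t)).pow 2
          · exact continuous_const.mul ((continuous_sum_pd1_sq hu).comp (by fun_prop))
          · simp only
            rw [fderiv_apply_eq_sum_pd1]
            refine (Finset.sum_mul_sq_le_sq_mul_sq _ _ _).trans ?_
            refine mul_le_mul_of_nonneg_right ?_ (Finset.sum_nonneg fun k _ => sq_nonneg _)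
            calc ∑ k, h k ^ 2 ≤ ∑ _k : Fin d, (1 : ℝ) :=
                  Finset.sum_le_sum fun k _ => pow_le_one₀ (hh.1 k) (hh.2 k)
              _ = d := by simp
    _ = d * ∫ y in cell1 d, ∑ k, pd1 k u y ^ 2 := by simp

/-- Poincaré's inequality for periodic functions of mean zero on the unit cell. -/
theorem two_mul_integral_sq_le (hu : ContDiff ℝ (⊤ : ℕ∞) u) (hp : ZPeriodic u)
    (h0 : ∫ y in cell1 d, u y = 0) :
    2 * ∫ y in cell1 d, u y ^ 2 ≤ d * ∫ y in cell1 d, ∑ k, pd1 k u y ^ 2 := by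
  have huc := hu.continuous
  have hexp : ∀ h : Fin d → ℝ, ∫ x in cell1 d, (u (x + h) - u x) ^ 2 =
      2 * (∫ y in cell1 d, u y ^ 2) - 2 * ∫ x in cell1 d, u (x + h) * u x := fun h => by
    have e : (fun x => (u (x + h) - u x) ^ 2) =
        fun x => u (x + h) ^ 2 + u x ^ 2 - 2 * (u (x + h) * u x) := by
      ext x; ring
    rw [e, integral_sub (integrable_cell1 (by fun_prop)) (integrable_cell1 (by fun_prop)),
      integral_add (integrable_cell1 (by fun_prop)) (integrable_cell1 (by fun_prop)),
      (hp.pow 2).integral_add_right h, integral_const_mul]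
    ring
  have hcross : ∫ h in cell1 d, ∫ x in cell1 d, u (x + h) * u x = 0 := by
    rw [setIntegral_setIntegral_swap_of_continuous (f := fun h x => u (x + h) * u x)
      isCompact_cell1 isCompact_cell1 (by fun_prop)]
    refine integral_eq_zero_of_ae (Filter.Eventually.of_forall fun x => ?_)
    simp only [Pi.zero_apply]
    rw [integral_mul_const]
    simp only [add_comm x]
    rw [hp.integral_add_right x, h0, zero_mul]
  have hcc : Continuous fun h => ∫ x in cell1 d, u (x + h) * u x :=
    continuous_parametric_integral_of_continuous (by fun_prop) isCompact_cell1
  have hle : ∫ h in cell1 d, (2 * (∫ y in cell1 d, u y ^ 2) -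
      2 * ∫ x in cell1 d, u (x + h) * u x) ≤
      ∫ _h in cell1 d, (d : ℝ) * ∫ y in cell1 d, ∑ k, pd1 k u y ^ 2 := by
    refine setIntegral_mono_on (integrable_cell1 (by fun_prop)) (integrable_const _)
      isCompact_cell1.measurableSet fun h hh => ?_
    rw [← hexp]
    exact integral_sq_shift_sub_le hu hp hh
  rw [integral_sub (integrable_const _) (integrable_cell1 (by fun_prop)),
    integral_const_mul 2 fun h => ∫ x in cell1 d, u (x + h) * u x, hcross] at hle
  simpa using hle

end Calculus

section Coefficients

variable {lam : ℝ} {A : (Fin d → ℝ) → Fin d → Fin d → ℝ}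

theorem sum_sq_mulVec_le {y ξ : Fin d → ℝ}
    (hA : √(∑ k, (∑ l, A y k l * ξ l) ^ 2) ≤ lam⁻¹ * √(∑ k, ξ k ^ 2)) :
    ∑ k, (∑ l, A y k l * ξ l) ^ 2 ≤ lam⁻¹ ^ 2 * ∑ k, ξ k ^ 2 := by
  have h1 : 0 ≤ ∑ k, (∑ l, A y k l * ξ l) ^ 2 := Finset.sum_nonneg fun k _ => sq_nonneg _
  have h2 : 0 ≤ ∑ k, ξ k ^ 2 := Finset.sum_nonneg fun k _ => sq_nonneg _
  have := pow_le_pow_left₀ (Real.sqrt_nonneg _) hA 2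
  rwa [Real.sq_sqrt h1, mul_pow, Real.sq_sqrt h2] at this

theorem contDiff_flux (hA : ∀ k l, ContDiff ℝ (⊤ : ℕ∞) fun y => A y k l) {u : (Fin d → ℝ) → ℝ}
    (hu : ContDiff ℝ (⊤ : ℕ∞) u) (k : Fin d) :
    ContDiff ℝ (⊤ : ℕ∞) fun y => ∑ l, A y k l * pd1 l u y :=
  ContDiff.sum fun l _ => (hA k l).mul (contDiff_pd1 hu l)

theorem ZPeriodic.flux (hA : ∀ k l, ZPeriodic fun y => A y k l) {u : (Fin d → ℝ) → ℝ}
    (hu : ZPeriodic u) (k : Fin d) : ZPeriodic fun y => ∑ l, A y k l * pd1 l u y :=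
  ZPeriodic.sum fun l => (hA k l).mul (hu.partialDeriv l)

/-- Energy estimate for the exact corrector. -/
theorem corrector_energy_le (hlam : 0 < lam)
    (hA : ∀ k l, ContDiff ℝ (⊤ : ℕ∞) fun y => A y k l)
    (hAp : ∀ k l, ZPeriodic fun y => A y k l)
    (hell : ∀ (y : Fin d → ℝ) (ξ : Fin d → ℝ),
      lam * ∑ k, ξ k ^ 2 ≤ ∑ k, ξ k * ∑ l, A y k l * ξ l)
    (hbd : ∀ (y : Fin d → ℝ) (ξ : Fin d → ℝ),
      √(∑ k, (∑ l, A y k l * ξ l) ^ 2) ≤ lam⁻¹ * √(∑ k, ξ k ^ 2))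
    {j : Fin d} {ψ : (Fin d → ℝ) → ℝ} (hψ : ContDiff ℝ (⊤ : ℕ∞) ψ) (hψp : ZPeriodic ψ)
    (heq : ∀ y : Fin d → ℝ, -(∑ k, pd1 k (fun y' => ∑ l, A y' k l * pd1 l ψ y') y)
      = ∑ k, pd1 k (fun y' => A y' k j) y) :
    ∫ y in cell1 d, ∑ k, pd1 k ψ y ^ 2 ≤ lam⁻¹ ^ 4 := by
  have hweak : ∫ y in cell1 d, ∑ k, (∑ l, A y k l * pd1 l ψ y) * pd1 k ψ y =
      -∫ y in cell1 d, ∑ k, A y k j * pd1 k ψ y := by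
    rw [← integral_div_mul (fun k => hA k j) (fun k => hAp k j) hψ hψp]
    simp only [← heq, neg_mul, integral_neg]
    rw [integral_div_mul (contDiff_flux hA hψ) (ZPeriodic.flux hAp hψp) hψ hψp, neg_neg]
  have hG := continuous_sum_pd1_sq hψ
  have hF : Continuous fun y => ∑ k, (∑ l, A y k l * pd1 l ψ y) * pd1 k ψ y :=
    continuous_finsetSum _ fun k _ =>
      (contDiff_flux hA hψ k).continuous.mul (continuous_pd1 hψ k)
  have hf : Continuous fun y => ∑ k, A y k j * pd1 k ψ y :=
    continuous_finsetSum _ fun k _ => (hA k j).continuous.mul (continuous_pd1 hψ k)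
  have hcoer : lam * ∫ y in cell1 d, ∑ k, pd1 k ψ y ^ 2 ≤
      ∫ y in cell1 d, ∑ k, (∑ l, A y k l * pd1 l ψ y) * pd1 k ψ y := by
    rw [← integral_const_mul]
    refine integral_mono (integrable_cell1 (hG.const_mul lam)) (integrable_cell1 hF) fun y => ?_
    simpa only [mul_comm] using hell y fun k => pd1 k ψ y
  have hyoung : -∫ y in cell1 d, ∑ k, A y k j * pd1 k ψ y ≤
      ∫ y in cell1 d, (lam / 2 * ∑ k, pd1 k ψ y ^ 2 + lam⁻¹ ^ 3 / 2) := by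
    rw [← integral_neg]
    refine integral_mono (integrable_cell1 hf.neg)
      (integrable_cell1 ((hG.const_mul _).add continuous_const)) fun y => ?_
    simp only
    have hcol : ∑ k, A y k j ^ 2 ≤ lam⁻¹ ^ 2 := by
      simpa [Pi.single_apply] using sum_sq_mulVec_le (hbd y (Pi.single j 1))
    calc -∑ k, A y k j * pd1 k ψ y
        ≤ ∑ k, (lam / 2 * pd1 k ψ y ^ 2 + lam⁻¹ / 2 * A y k j ^ 2) := by
          rw [← Finset.sum_neg_distrib]
          refine Finset.sum_le_sum fun k _ => ?_
          have : lam / 2 * pd1 k ψ y ^ 2 + lam⁻¹ / 2 * A y k j ^ 2 + A y k j * pd1 k ψ y =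
            lam⁻¹ / 2 * (lam * pd1 k ψ y + A y k j) ^ 2 := by field_simp; ring
          have : 0 ≤ lam⁻¹ / 2 * (lam * pd1 k ψ y + A y k j) ^ 2 := by positivity
          linarith
      _ = lam / 2 * ∑ k, pd1 k ψ y ^ 2 + lam⁻¹ / 2 * ∑ k, A y k j ^ 2 := by
          rw [Finset.sum_add_distrib, Finset.mul_sum, Finset.mul_sum]
      _ ≤ _ := by
          have := mul_le_mul_of_nonneg_left hcol (by positivity : 0 ≤ lam⁻¹ / 2)
          linarith [show lam⁻¹ / 2 * lam⁻¹ ^ 2 = lam⁻¹ ^ 3 / 2 by ring]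
  rw [integral_add (integrable_cell1 (hG.const_mul _)) (integrable_const _),
    integral_const_mul] at hyoung
  simp only [integral_const, probReal_univ, smul_eq_mul, one_mul] at hyoung
  have h : lam * ∫ y in cell1 d, ∑ k, pd1 k ψ y ^ 2 ≤ lam * lam⁻¹ ^ 4 := by
    rw [show lam * lam⁻¹ ^ 4 = lam⁻¹ ^ 3 by field_simp]
    linarith
  exact le_of_mul_le_mul_left h hlam

/-- The regularized corrector has mean zero. -/
theorem integral_regularized_corrector {τ : ℝ} (hτ : 0 < τ)
    (hA : ∀ k l, ContDiff ℝ (⊤ : ℕ∞) fun y => A y k l)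
    (hAp : ∀ k l, ZPeriodic fun y => A y k l)
    {j : Fin d} {ψ : (Fin d → ℝ) → ℝ} (hψ : ContDiff ℝ (⊤ : ℕ∞) ψ) (hψp : ZPeriodic ψ)
    (heq : ∀ y : Fin d → ℝ,
      -(∑ k, pd1 k (fun y' => ∑ l, A y' k l * pd1 l ψ y') y) + τ ^ 2 * ψ y
        = ∑ k, pd1 k (fun y' => A y' k j) y) :
    ∫ y in cell1 d, ψ y = 0 := by
  have hdiv : ∀ F : Fin d → (Fin d → ℝ) → ℝ, (∀ k, ContDiff ℝ (⊤ : ℕ∞) (F k)) →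
      (∀ k, ZPeriodic (F k)) → ∫ y in cell1 d, ∑ k, pd1 k (F k) y = 0 := fun F hF hFp => by
    rw [integral_finsetSum _ fun k _ => integrable_cell1 (continuous_pd1 (hF k) k)]
    exact Finset.sum_eq_zero fun k _ => integral_pd1_eq_zero (hF k) (hFp k) k
  have hc : ∀ F : Fin d → (Fin d → ℝ) → ℝ, (∀ k, ContDiff ℝ (⊤ : ℕ∞) (F k)) →
      Continuous fun y => ∑ k, pd1 k (F k) y := fun F hF =>
    continuous_finsetSum _ fun k _ => continuous_pd1 (hF k) k
  have h : τ ^ 2 * ∫ y in cell1 d, ψ y = 0 := by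
    rw [← integral_const_mul]
    have e : (fun y => τ ^ 2 * ψ y) = fun y => (∑ k, pd1 k (fun y' => A y' k j) y) +
        ∑ k, pd1 k (fun y' => ∑ l, A y' k l * pd1 l ψ y') y := by
      ext y; linarith [heq y]
    rw [e, integral_add (integrable_cell1 (hc _ fun k => hA k j))
      (integrable_cell1 (hc _ (contDiff_flux hA hψ))), hdiv _ (fun k => hA k j) fun k => hAp k j,
      hdiv _ (contDiff_flux hA hψ) (ZPeriodic.flux hAp hψp), add_zero]
  exact (mul_eq_zero.mp h).resolve_left (by positivity)

end Coefficients

/-- From the proof of Proposition 4.6: quadratic accuracy of the zero-order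
regularization of the single-scale corrector and homogenized matrix. -/
theorem statement12 (d : ℕ) (hd : 1 ≤ d) (lam : ℝ) (hlam : lam ∈ Set.Ioc (0 : ℝ) 1) :
    ∃ C : ℝ, 0 < C ∧
      ∀ (τ : ℝ), 0 < τ →
      ∀ (A : (Fin d → ℝ) → Fin d → Fin d → ℝ),
        (∀ k l, ContDiff ℝ (⊤ : ℕ∞) fun y => A y k l) →
        (∀ k l, ZPeriodic fun y => A y k l) →
        (∀ (y : Fin d → ℝ) (ξ : Fin d → ℝ),
          lam * ∑ k, ξ k ^ 2 ≤ ∑ k, ξ k * ∑ l, A y k l * ξ l) →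
        (∀ (y : Fin d → ℝ) (ξ : Fin d → ℝ),
          Real.sqrt (∑ k, (∑ l, A y k l * ξ l) ^ 2) ≤ lam⁻¹ * Real.sqrt (∑ k, ξ k ^ 2)) →
      ∀ (j : Fin d) (ψτ ψ₀ : (Fin d → ℝ) → ℝ),
        ContDiff ℝ (⊤ : ℕ∞) ψτ → ZPeriodic ψτ →
        ContDiff ℝ (⊤ : ℕ∞) ψ₀ → ZPeriodic ψ₀ →
        (∫ y in cell1 d, ψ₀ y) = 0 →
        (∀ y : Fin d → ℝ,
          -(∑ k, pd1 k (fun y' => ∑ l, A y' k l * pd1 l ψτ y') y) + τ ^ 2 * ψτ y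
            = ∑ k, pd1 k (fun y' => A y' k j) y) →
        (∀ y : Fin d → ℝ,
          -(∑ k, pd1 k (fun y' => ∑ l, A y' k l * pd1 l ψ₀ y') y)
            = ∑ k, pd1 k (fun y' => A y' k j) y) →
        Real.sqrt (∫ y in cell1 d, ∑ k, (pd1 k ψτ y - pd1 k ψ₀ y) ^ 2) ≤ C * τ ^ 2 ∧
        Real.sqrt (∑ k, (∫ y in cell1 d,
            ∑ l, A y k l * (pd1 l ψτ y - pd1 l ψ₀ y)) ^ 2) ≤ C * τ ^ 2 := by
  obtain ⟨hl0, hl1⟩ := hlam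
  have hd0 : (0 : ℝ) < d := by exact_mod_cast hd
  have hli : 1 ≤ lam⁻¹ := (one_le_inv₀ hl0).mpr hl1
  refine ⟨d * lam⁻¹ ^ 4, by positivity, ?_⟩
  intro τ hτ A hA hAp hell hbd j ψτ ψ₀ hψτ hψτp hψ₀ hψ₀p hmean heqτ heq0
  have hG0 := corrector_energy_le hl0 hA hAp hell hbd hψ₀ hψ₀p heq0
  have hmeanτ := integral_regularized_corrector hτ hA hAp hψτ hψτp heqτ
  set w : (Fin d → ℝ) → ℝ := fun y => ψτ y - ψ₀ y with hw
  have hws : ContDiff ℝ (⊤ : ℕ∞) w := hψτ.sub hψ₀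
  have hwp : ZPeriodic w := hψτp.sub hψ₀p
  have hwm : ∫ y in cell1 d, w y = 0 := by
    rw [hw, integral_sub (integrable_cell1 hψτ.continuous) (integrable_cell1 hψ₀.continuous),
      hmean, hmeanτ, sub_zero]
  have hP := two_mul_integral_sq_le hws hwp hwm
  have hP0 := two_mul_integral_sq_le hψ₀ hψ₀p hmean
  simp only [← pd1_sub hψτ hψ₀, ← hw]
  have hGc := continuous_sum_pd1_sq hws
  have hFc : ∀ k, Continuous fun y => ∑ l, A y k l * pd1 l w y := fun k =>
    (contDiff_flux hA hws k).continuous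
  set G := ∫ y in cell1 d, ∑ k, pd1 k w y ^ 2 with hGdef
  have hcw := hws.continuous
  have hc0 := hψ₀.continuous
  have hdiff : ∀ y, (∑ k, pd1 k (fun y' => ∑ l, A y' k l * pd1 l w y') y) =
      τ ^ 2 * (w y + ψ₀ y) := fun y => by
    have e : ∀ k, pd1 k (fun y' => ∑ l, A y' k l * pd1 l w y') y =
        pd1 k (fun y' => ∑ l, A y' k l * pd1 l ψτ y') y -
          pd1 k (fun y' => ∑ l, A y' k l * pd1 l ψ₀ y') y := fun k => by
      rw [← pd1_sub (contDiff_flux hA hψτ k) (contDiff_flux hA hψ₀ k)]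
      congr 1
      ext x
      rw [← Finset.sum_sub_distrib]
      refine Finset.sum_congr rfl fun l _ => ?_
      rw [hw, pd1_sub hψτ hψ₀, mul_sub]
    simp only [e, Finset.sum_sub_distrib]
    have := heqτ y
    have := heq0 y
    simp only [hw, sub_add_cancel]
    linarith
  have hweak := integral_div_mul (contDiff_flux hA hws) (ZPeriodic.flux hAp hwp) hws hwp
  simp only [hdiff] at hweak
  have hcoer : lam * G ≤ ∫ y in cell1 d, ∑ k, (∑ l, A y k l * pd1 l w y) * pd1 k w y := by
    rw [hGdef, ← integral_const_mul]
    refine integral_mono (integrable_cell1 (hGc.const_mul lam)) (integrable_cell1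
      (continuous_finsetSum _ fun k _ => (hFc k).mul (continuous_pd1 hws k))) fun y => ?_
    simpa only [mul_comm] using hell y fun k => pd1 k w y
  -- Young's inequality absorbs the right-hand side into the gradient term.
  have hyoung : -∫ y in cell1 d, τ ^ 2 * (w y + ψ₀ y) * w y ≤
      ∫ y in cell1 d, (τ ^ 4 * d / (4 * lam) * ψ₀ y ^ 2 + lam / d * w y ^ 2) := by
    rw [← integral_neg]
    refine integral_mono (integrable_cell1 (by fun_prop)) (integrable_cell1 (by fun_prop))
      fun y => ?_
    simp only
    have e : τ ^ 4 * d / (4 * lam) * ψ₀ y ^ 2 + lam / d * w y ^ 2 + τ ^ 2 * (w y + ψ₀ y) * w y =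
        lam / d * (w y + τ ^ 2 * d / (2 * lam) * ψ₀ y) ^ 2 + τ ^ 2 * w y ^ 2 := by
      field_simp; ring
    have : 0 ≤ lam / d * (w y + τ ^ 2 * d / (2 * lam) * ψ₀ y) ^ 2 + τ ^ 2 * w y ^ 2 := by
      positivity
    linarith
  rw [integral_add (integrable_cell1 (by fun_prop)) (integrable_cell1 (by fun_prop)),
    integral_const_mul, integral_const_mul] at hyoung
  have hG : G ≤ (d * lam⁻¹ ^ 3 * τ ^ 2) ^ 2 := by
    have h1 : lam / d * ∫ y in cell1 d, w y ^ 2 ≤ lam / 2 * G := by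
      have := mul_le_mul_of_nonneg_left hP (by positivity : 0 ≤ lam / (2 * d))
      have e1 : lam / (2 * d) * (2 * ∫ y in cell1 d, w y ^ 2) =
        lam / d * ∫ y in cell1 d, w y ^ 2 := by field_simp
      have e2 : lam / (2 * d) * (d * G) = lam / 2 * G := by field_simp
      linarith
    have h2 : τ ^ 4 * d / (4 * lam) * ∫ y in cell1 d, ψ₀ y ^ 2 ≤
        τ ^ 4 * d / (4 * lam) * (d / 2 * lam⁻¹ ^ 4) := by
      refine mul_le_mul_of_nonneg_left ?_ (by positivity)
      have := mul_le_mul_of_nonneg_left hG0 hd0.le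
      linarith
    have h3 : lam / 2 * G ≤ lam / 2 * (d * lam⁻¹ ^ 3 * τ ^ 2) ^ 2 := by
      have e : lam / 2 * (d * lam⁻¹ ^ 3 * τ ^ 2) ^ 2 =
        4 * (τ ^ 4 * d / (4 * lam) * (d / 2 * lam⁻¹ ^ 4)) := by field_simp
      have : 0 ≤ τ ^ 4 * d / (4 * lam) * (d / 2 * lam⁻¹ ^ 4) := by positivity
      linarith
    exact le_of_mul_le_mul_left h3 (by positivity)
  have hlast : d * lam⁻¹ ^ 3 * τ ^ 2 ≤ d * lam⁻¹ ^ 4 * τ ^ 2 := by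
    have := pow_le_pow_right₀ hli (show 3 ≤ 4 by norm_num)
    gcongr
  refine ⟨(Real.sqrt_le_iff.mpr ⟨by positivity, hG⟩).trans hlast,
    Real.sqrt_le_iff.mpr ⟨by positivity, ?_⟩⟩
  calc ∑ k, (∫ y in cell1 d, ∑ l, A y k l * pd1 l w y) ^ 2
      ≤ ∑ k, ∫ y in cell1 d, (∑ l, A y k l * pd1 l w y) ^ 2 :=
        Finset.sum_le_sum fun k _ => sq_integral_le_integral_sq (integrable_cell1 (hFc k))
          (integrable_cell1 ((hFc k).pow 2))
    _ = ∫ y in cell1 d, ∑ k, (∑ l, A y k l * pd1 l w y) ^ 2 :=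
        (integral_finsetSum _ fun k _ => integrable_cell1 ((hFc k).pow 2)).symm
    _ ≤ ∫ y in cell1 d, lam⁻¹ ^ 2 * ∑ k, pd1 k w y ^ 2 :=
        integral_mono (integrable_cell1 (continuous_finsetSum _ fun k _ => (hFc k).pow 2))
          (integrable_cell1 (hGc.const_mul _)) fun y =>
            sum_sq_mulVec_le (hbd y fun k => pd1 k w y)
    _ = lam⁻¹ ^ 2 * G := integral_const_mul _ _
    _ ≤ lam⁻¹ ^ 2 * (d * lam⁻¹ ^ 3 * τ ^ 2) ^ 2 := by gcongr
    _ = (d * lam⁻¹ ^ 4 * τ ^ 2) ^ 2 := by ring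

end MS12
end
end

section
/- Scale-group dichotomy (Lemma 5.2): Let n ≥ 3 and m be integers with 2 ≤ m < n, let 1 ≥ ε₁ > ε₂ > ⋯ > εₙ > 0 be reals, and let cⱼ > 0 for 2 ≤ j ≤ n. Assume: (i) for every integer j with n−m+2 ≤ j ≤ n, εⱼ ≤ 2^{m−n}·cⱼ·εⱼ₋₁/(1 + log(ε_{n−m+1}/εⱼ₋₁)); and (ii) there exists an integer p with n−m+1 ≤ p ≤ n such that ε_p > 2^{m+1−n}·c_p·ε_{p−1}/(1 + log(ε_{n−m}/ε_{p−1})). Then either ε_{n−m+1} > 2^{m+1−n}·c_{n−m+1}·ε_{n−m}, or there exists an integer p with n−m+2 ≤ p ≤ n such that ε_p > 2^{m−n}·c_p·ε_{p−1}/(1 + log(ε_{n−m}/ε_{n−m+1})). -/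
open Real

/-- If `y` lies strictly above `2 * x / (1 + (a + b))` and at most at `x / (1 + b)`, then it lies
strictly above `x / (1 + a)`. -/
lemma div_one_add_lt_of_two_mul_div_lt {x y a b : ℝ} (hx : 0 < x) (ha : 0 < a) (hb : 0 ≤ b)
    (hle : y ≤ x / (1 + b)) (hlt : 2 * x / (1 + (a + b)) < y) : x / (1 + a) < y := by
  have hab : b < a := by
    have h := hlt.trans_le hle
    rw [div_lt_div_iff₀ (by linarith) (by linarith)] at h
    nlinarith
  refine lt_of_le_of_lt ?_ hlt
  rw [div_le_div_iff₀ (by linarith) (by linarith)]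
  nlinarith

/-- Lemma 5.2: scale-group dichotomy. -/
theorem statement13 (n m : ℕ) (hn : 3 ≤ n) (hm2 : 2 ≤ m) (hmn : m < n)
    (ε : ℕ → ℝ) (hε1 : ε 1 ≤ 1)
    (hpos : ∀ j : ℕ, 1 ≤ j → j ≤ n → 0 < ε j)
    (hdec : ∀ j k : ℕ, 1 ≤ j → j < k → k ≤ n → ε k < ε j)
    (c : ℕ → ℝ) (hc : ∀ j : ℕ, 2 ≤ j → j ≤ n → 0 < c j)
    (h1 : ∀ j : ℕ, n - m + 2 ≤ j → j ≤ n →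
      ε j ≤ (2 : ℝ) ^ ((m : ℤ) - n) * c j * ε (j - 1)
          / (1 + Real.log (ε (n - m + 1) / ε (j - 1))))
    (h2 : ∃ p : ℕ, n - m + 1 ≤ p ∧ p ≤ n ∧
      (2 : ℝ) ^ ((m : ℤ) + 1 - n) * c p * ε (p - 1)
          / (1 + Real.log (ε (n - m) / ε (p - 1))) < ε p) :
    ((2 : ℝ) ^ ((m : ℤ) + 1 - n) * c (n - m + 1) * ε (n - m) < ε (n - m + 1)) ∨
    (∃ p : ℕ, n - m + 2 ≤ p ∧ p ≤ n ∧
      (2 : ℝ) ^ ((m : ℤ) - n) * c p * ε (p - 1)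
          / (1 + Real.log (ε (n - m) / ε (n - m + 1))) < ε p) := by
  obtain ⟨p, hp, hpn, hlt⟩ := h2
  have hq : 0 < ε (n - m) := hpos _ (by omega) (by omega)
  have hq1 : 0 < ε (n - m + 1) := hpos _ (by omega) (by omega)
  rcases Nat.eq_or_lt_of_le hp with rfl | hp'
  · left
    simpa [div_self hq.ne'] using hlt
  · right
    refine ⟨p, hp', hpn, ?_⟩
    have hr : 0 < ε (p - 1) := hpos _ (by omega) (by omega)
    have hcp : 0 < c p := hc p (by omega) hpn
    have hle : ε (p - 1) ≤ ε (n - m + 1) := by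
      rcases Nat.eq_or_lt_of_le (show n - m + 1 ≤ p - 1 by omega) with h | h
      · rw [h]
      · exact (hdec _ _ (by omega) h (by omega)).le
    have hlog : Real.log (ε (n - m) / ε (p - 1)) =
        Real.log (ε (n - m) / ε (n - m + 1)) + Real.log (ε (n - m + 1) / ε (p - 1)) := by
      rw [← Real.log_mul (by positivity) (by positivity), div_mul_div_cancel₀ hq1.ne']
    have hpow : (2 : ℝ) ^ ((m : ℤ) + 1 - n) = 2 * 2 ^ ((m : ℤ) - n) := by
      rw [show (m : ℤ) + 1 - n = 1 + (m - n) by ring, zpow_add₀ two_ne_zero, zpow_one]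
    rw [hlog, hpow, mul_assoc 2, mul_assoc 2] at hlt
    exact div_one_add_lt_of_two_mul_div_lt (by positivity)
      (Real.log_pos ((one_lt_div hq1).2 (hdec _ _ (by omega) (by omega) (by omega))))
      (Real.log_nonneg ((one_le_div hr).2 hle)) (h1 p hp' hpn) hlt
end

section
/- Iteration lemma for large-scale regularity (Lemma 6.2): For every real C₀ ≥ 1 and every θ ∈ (0, 1/8) there exists c₀ > 0, depending only on C₀ and θ, with the following property. For every nonnegative nondecreasing function ω : [0,1] → ℝ with ω(0) = 0 and ∫₀¹ ω(s)/s ds < ∞, there exists C > 0, depending only on C₀, θ and ω, such that: for all ρ ∈ (0, 1/4), all γ ≥ 0 with γ ≤ c₀/|log ρ|, and all nonnegative continuous functions H, h : (0,1] → ℝ satisfying, for every r ∈ [ρ, 1/2], (a) max over t ∈ [r, 2r] of H(t) ≤ C₀·H(2r), (b) |h(t) − h(s)| ≤ C₀·H(2r) for all t, s ∈ [r, 2r], and (c) H(θr) ≤ (1/2)·H(r) + C₀·(ω(ρ/r) + γ)·(H(2r) + h(2r)), one has max over r ∈ [ρ, 1] of (H(r) + h(r)) ≤ C·(H(1) + h(1)).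 -/
open Real MeasureTheory

/-- A two-step discrete Grönwall inequality. -/
theorem le_mul_exp_sum_of_two_step {x a : ℕ → ℝ} {B : ℝ} {m : ℕ} (hB : 0 ≤ B)
    (ha : ∀ k < m, 0 ≤ a k) (h0 : x 0 ≤ B) (h1 : x 1 ≤ B)
    (hx : ∀ k < m, x (k + 2) ≤ x (k + 1) + a k * x k) :
    ∀ k ≤ m, x k ≤ B * exp (∑ j ∈ Finset.range k, a j) ∧
      x (k + 1) ≤ B * exp (∑ j ∈ Finset.range k, a j) := by
  intro k
  induction k with
  | zero => simp [h0, h1]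
  | succ k ih =>
    intro hk
    obtain ⟨i0, i1⟩ := ih (by omega)
    have hak := ha k hk
    have hxk := hx k hk
    rw [Finset.sum_range_succ, exp_add]
    set E := exp (∑ j ∈ Finset.range k, a j)
    have hBE : 0 ≤ B * E := mul_nonneg hB (exp_pos _).le
    have he : a k + 1 ≤ exp (a k) := add_one_le_exp _
    have key : B * E * (a k + 1) ≤ B * (E * exp (a k)) := by
      rw [← mul_assoc]; gcongr
    constructor
    · nlinarith
    · nlinarith [mul_le_mul_of_nonneg_left i0 hak]

/-- Iterating one-octave estimates over `n` octaves. -/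
theorem octave_iterate {C₀ ρ : ℝ} (hC₀ : 1 ≤ C₀) (hρ : 0 < ρ) {H h : ℝ → ℝ}
    (hH : ∀ r ∈ Set.Ioc (0 : ℝ) 1, 0 ≤ H r)
    (hHd : ∀ r, ρ ≤ r → r ≤ 1 / 2 → ∀ t, r ≤ t → t ≤ 2 * r → H t ≤ C₀ * H (2 * r))
    (hhd : ∀ r, ρ ≤ r → r ≤ 1 / 2 → ∀ t s, r ≤ t → t ≤ 2 * r → r ≤ s → s ≤ 2 * r →
      |h t - h s| ≤ C₀ * H (2 * r))
    {s : ℝ} (hs : 2 * ρ ≤ s) (hs1 : s ≤ 1) (n : ℕ) :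
    ∀ t, ρ ≤ t → t ≤ s → s ≤ 2 ^ n * t →
      H t ≤ C₀ ^ n * H s ∧ |h t - h s| ≤ n * C₀ ^ n * H s := by
  have hHs : 0 ≤ H s := hH s ⟨by linarith, hs1⟩
  induction n with
  | zero =>
    intro t _ hts hst
    obtain rfl : t = s := le_antisymm hts (by simpa using hst)
    simp
  | succ n ih =>
    intro t hρt hts hst
    have hp : 1 ≤ C₀ ^ n := one_le_pow₀ hC₀
    have hpC : C₀ ≤ C₀ ^ n * C₀ := le_mul_of_one_le_left (by linarith) hp
    have hn : (0 : ℝ) ≤ n := n.cast_nonneg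
    push_cast
    rw [pow_succ C₀]
    have h1 : C₀ * H s ≤ C₀ ^ n * C₀ * H s := by gcongr
    have h2 : 0 ≤ n * (C₀ ^ n * C₀ * H s) := by positivity
    rcases le_or_gt s (2 * t) with hc | hc
    · have e : 2 * (s / 2) = s := by ring
      have a1 := hHd (s / 2) (by linarith) (by linarith) t (by linarith) (by linarith)
      have a2 := hhd (s / 2) (by linarith) (by linarith) t s (by linarith) (by linarith)
        (by linarith) (by linarith)
      rw [e] at a1 a2
      exact ⟨a1.trans h1, by nlinarith⟩
    · obtain ⟨i1, i2⟩ := ih (2 * t) (by linarith) hc.le (by rw [pow_succ] at hst; linarith)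
      have a1 := hHd t hρt (by linarith) t le_rfl (by linarith)
      have a2 := hhd t hρt (by linarith) t (2 * t) le_rfl (by linarith) (by linarith) le_rfl
      have h3 : C₀ * H (2 * t) ≤ C₀ ^ n * C₀ * H s := by
        calc C₀ * H (2 * t) ≤ C₀ * (C₀ ^ n * H s) := by gcongr
          _ = _ := by ring
      have h4 : n * C₀ ^ n * H s ≤ n * (C₀ ^ n * C₀ * H s) := by
        rw [mul_assoc]
        gcongr
        exact le_mul_of_one_le_right (by positivity) hC₀
      refine ⟨a1.trans h3, ?_⟩
      have := abs_sub_le (h t) (h (2 * t)) (h s)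
      linarith

/-- A Dini modulus is summable along a geometric sequence, with a quantitative bound. -/
theorem sum_dini_geometric_le {ω : ℝ → ℝ} {θ : ℝ} (hθ : 0 < θ) (hθ1 : θ < 1)
    (h0 : ∀ s ∈ Set.Icc (0 : ℝ) 1, 0 ≤ ω s) (hmono : MonotoneOn ω (Set.Icc 0 1))
    (hint : IntegrableOn (fun s => ω s / s) (Set.Ioc (0 : ℝ) 1)) (m : ℕ) :
    (1 - θ) * ∑ i ∈ Finset.range m, ω (θ ^ (i + 1)) ≤ ∫ s in Set.Ioc (0 : ℝ) 1, ω s / s := by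
  have hle : ∀ i : ℕ, θ ^ (i + 1) ≤ θ ^ i := fun i =>
    pow_le_pow_of_le_one hθ.le hθ1.le i.le_succ
  have hle1 : ∀ i : ℕ, θ ^ i ≤ 1 := fun i => pow_le_one₀ hθ.le hθ1.le
  have hpos : ∀ i : ℕ, 0 < θ ^ i := fun i => pow_pos hθ i
  have hI : ∀ a b : ℝ, 0 ≤ a → a ≤ b → b ≤ 1 →
      IntervalIntegrable (fun s => ω s / s) volume a b := fun a b ha hab hb =>
    (intervalIntegrable_iff_integrableOn_Ioc_of_le hab).2
      (hint.mono_set (Set.Ioc_subset_Ioc ha hb))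
  have hstep : ∀ i : ℕ, (1 - θ) * ω (θ ^ (i + 1)) ≤ ∫ s in (θ ^ (i + 1))..(θ ^ i), ω s / s := by
    intro i
    have hc : ∫ _ in (θ ^ (i + 1))..(θ ^ i), ω (θ ^ (i + 1)) / θ ^ i
        = (1 - θ) * ω (θ ^ (i + 1)) := by
      rw [intervalIntegral.integral_const, smul_eq_mul, pow_succ]
      have := (hpos i).ne'
      field_simp
    rw [← hc]
    refine intervalIntegral.integral_mono_on (hle i) intervalIntegrable_const
      (hI _ _ (hpos _).le (hle i) (hle1 i)) fun s hs => ?_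
    have hs0 : 0 < s := (hpos _).trans_le hs.1
    have hs1 : s ≤ 1 := hs.2.trans (hle1 i)
    exact div_le_div₀ (h0 s ⟨hs0.le, hs1⟩)
      (hmono ⟨(hpos _).le, hle1 _⟩ ⟨hs0.le, hs1⟩ hs.1) hs0 hs.2
  have hsum : (1 - θ) * ∑ i ∈ Finset.range m, ω (θ ^ (i + 1))
      ≤ ∫ s in (θ ^ m)..1, ω s / s := by
    induction m with
    | zero => simp
    | succ m ih =>
      rw [Finset.sum_range_succ, mul_add, ← intervalIntegral.integral_add_adjacent_intervals
        (hI _ _ (hpos _).le (hle m) (hle1 m)) (hI _ _ (hpos _).le (hle1 m) le_rfl)]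
      linarith [hstep m]
  refine hsum.trans ?_
  rw [intervalIntegral.integral_of_le (hle1 m)]
  refine setIntegral_mono_set hint ?_ (Set.Ioc_subset_Ioc_left (hpos m).le).eventuallyLE
  filter_upwards [ae_restrict_mem measurableSet_Ioc] with s hs
  exact div_nonneg (h0 s ⟨hs.1.le, hs.2⟩) hs.1.le

/-- The total perturbation `∑ (ω (ρ / θ ^ j) + γ)` over the scales `θ ^ j ≥ ρ` is bounded
independently of `ρ` and `γ`. -/
theorem sum_perturbation_le {ω : ℝ → ℝ} {θ ρ γ : ℝ} (hθ : 0 < θ) (hθ1 : θ < 1 / 8)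
    (h0 : ∀ s ∈ Set.Icc (0 : ℝ) 1, 0 ≤ ω s) (hmono : MonotoneOn ω (Set.Icc 0 1))
    (hint : IntegrableOn (fun s => ω s / s) (Set.Ioc (0 : ℝ) 1))
    (hρ : 0 < ρ) (hρ1 : ρ < 1) (hγ0 : 0 ≤ γ) (hγ : γ ≤ 1 / |log ρ|) {m : ℕ}
    (hm : ρ ≤ θ ^ (m + 1)) :
    ∑ j ∈ Finset.range m, (ω (ρ / θ ^ (j + 1)) + γ) ≤
      2 * (∫ s in Set.Ioc (0 : ℝ) 1, ω s / s) + 1 := by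
  have hω : ∑ j ∈ Finset.range m, ω (ρ / θ ^ (j + 1)) ≤
      ∑ i ∈ Finset.range m, ω (θ ^ (i + 1)) := by
    rw [← Finset.sum_range_reflect (fun i => ω (θ ^ (i + 1)))]
    refine Finset.sum_le_sum fun j hj => ?_
    have hj := Finset.mem_range.1 hj
    have hle : ρ / θ ^ (j + 1) ≤ θ ^ (m - 1 - j + 1) := by
      rw [div_le_iff₀ (by positivity), ← pow_add]
      exact hm.trans_eq (by congr 1; omega)
    have h1 : θ ^ (m - 1 - j + 1) ≤ 1 := pow_le_one₀ hθ.le (by linarith)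
    exact hmono ⟨by positivity, hle.trans h1⟩ ⟨by positivity, h1⟩ hle
  have hsum := sum_dini_geometric_le hθ (by linarith) h0 hmono hint m
  have hnn : 0 ≤ ∑ i ∈ Finset.range m, ω (θ ^ (i + 1)) :=
    Finset.sum_nonneg fun i _ => h0 _ ⟨by positivity, pow_le_one₀ hθ.le (by linarith)⟩
  have hlogρ : log ρ < 0 := log_neg hρ hρ1
  have hlogθ : log θ ≤ -1 := by
    rw [← exp_le_exp, exp_log hθ, exp_neg]
    have : exp 1 < 8 := exp_one_lt_d9.trans (by norm_num)
    rw [le_inv_comm₀ hθ (exp_pos _)]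
    have : 8 ≤ θ⁻¹ := by rw [le_inv_comm₀ (by norm_num) hθ]; linarith
    linarith
  have hmlog : (m : ℝ) ≤ |log ρ| := by
    have := log_le_log hρ hm
    rw [log_pow] at this
    push_cast at this
    rw [abs_of_neg hlogρ]
    nlinarith [m.cast_nonneg (α := ℝ)]
  have hγm : m * γ ≤ 1 := by
    rw [le_div_iff₀ (abs_pos.2 hlogρ.ne)] at hγ
    nlinarith
  rw [Finset.sum_add_distrib, Finset.sum_const, Finset.card_range, nsmul_eq_mul]
  nlinarith

/-- Lemma 6.2: iteration lemma for large-scale regularity. -/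
theorem statement14 (C₀ θ : ℝ) (hC₀ : 1 ≤ C₀) (hθ : θ ∈ Set.Ioo (0 : ℝ) (1 / 8)) :
    ∃ c₀ : ℝ, 0 < c₀ ∧
      ∀ ω : ℝ → ℝ,
        (∀ s ∈ Set.Icc (0 : ℝ) 1, 0 ≤ ω s) →
        (∀ s t, s ∈ Set.Icc (0 : ℝ) 1 → t ∈ Set.Icc (0 : ℝ) 1 → s ≤ t → ω s ≤ ω t) →
        ω 0 = 0 →
        IntegrableOn (fun s => ω s / s) (Set.Ioc (0 : ℝ) 1) →
        ∃ C : ℝ, 0 < C ∧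
          ∀ (ρ γ : ℝ), ρ ∈ Set.Ioo (0 : ℝ) (1 / 4) → 0 ≤ γ → γ ≤ c₀ / |Real.log ρ| →
          ∀ H h : ℝ → ℝ,
            ContinuousOn H (Set.Ioc (0 : ℝ) 1) → ContinuousOn h (Set.Ioc (0 : ℝ) 1) →
            (∀ r ∈ Set.Ioc (0 : ℝ) 1, 0 ≤ H r) → (∀ r ∈ Set.Ioc (0 : ℝ) 1, 0 ≤ h r) →
            (∀ r, ρ ≤ r → r ≤ 1 / 2 →
              ∀ t, r ≤ t → t ≤ 2 * r → H t ≤ C₀ * H (2 * r)) →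
            (∀ r, ρ ≤ r → r ≤ 1 / 2 →
              ∀ t s, r ≤ t → t ≤ 2 * r → r ≤ s → s ≤ 2 * r →
                |h t - h s| ≤ C₀ * H (2 * r)) →
            (∀ r, ρ ≤ r → r ≤ 1 / 2 →
              H (θ * r) ≤ (1 / 2) * H r + C₀ * (ω (ρ / r) + γ) * (H (2 * r) + h (2 * r))) →
            ∀ r, ρ ≤ r → r ≤ 1 → H r + h r ≤ C * (H 1 + h 1) := by
  obtain ⟨hθ0, hθ1⟩ := hθ
  refine ⟨1, one_pos, fun ω hω0 hωm _ hint => ?_⟩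
  have hmono : MonotoneOn ω (Set.Icc 0 1) := fun s hs t ht hst => hωm s t hs ht hst
  obtain ⟨n, hn⟩ : ∃ n : ℕ, (θ ^ 2)⁻¹ < 2 ^ n := pow_unbounded_of_one_lt _ one_lt_two
  have hn : 1 ≤ 2 ^ n * θ ^ 2 := by
    rw [inv_lt_iff_one_lt_mul₀ (by positivity)] at hn
    linarith
  obtain ⟨K, hK⟩ : ∃ K : ℝ, K = (n + 1) * C₀ ^ n := ⟨_, rfl⟩
  have hp : 1 ≤ C₀ ^ n := one_le_pow₀ hC₀
  have hnK : n * C₀ ^ n ≤ K := by rw [hK]; linarith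
  have hpK : C₀ ^ n ≤ K := by
    rw [hK]; nlinarith [mul_nonneg n.cast_nonneg (zero_le_one.trans hp) (α := ℝ)]
  have hK1 : 1 ≤ K := hp.trans hpK
  set T := 2 * (∫ s in Set.Ioc (0 : ℝ) 1, ω s / s) + 1 with hT
  refine ⟨4 * K ^ 2 * exp (2 * K * C₀ * T), by positivity, ?_⟩
  intro ρ γ ⟨hρ, hρ1⟩ hγ0 hγ H h _ _ hH hh ha hb hc r hρr hr1
  have hoct : ∀ s t, 2 * ρ ≤ s → s ≤ 1 → ρ ≤ t → t ≤ s → θ ^ 2 * s ≤ t →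
      H t ≤ K * H s ∧ h t ≤ h s + K * H s := by
    intro s t hs hs1 hρt hts hst
    have hHs : 0 ≤ H s := hH s ⟨by linarith, hs1⟩
    have hst' : s ≤ 2 ^ n * t := by
      calc s ≤ 2 ^ n * θ ^ 2 * s := le_mul_of_one_le_left (by linarith) hn
        _ = 2 ^ n * (θ ^ 2 * s) := by ring
        _ ≤ 2 ^ n * t := by gcongr
    obtain ⟨h1, h2⟩ := octave_iterate hC₀ hρ hH ha hb hs hs1 n t hρt hts hst'
    have h3 := mul_le_mul_of_nonneg_right hpK hHs
    have h4 := mul_le_mul_of_nonneg_right hnK hHs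
    exact ⟨h1.trans h3, by linarith [le_abs_self (h t - h s)]⟩
  have hpow1 : ∀ k : ℕ, θ ^ k ≤ 1 := fun k => pow_le_one₀ hθ0.le (by linarith)
  have hpow0 : ∀ k : ℕ, 0 < θ ^ k := fun k => pow_pos hθ0 k
  have hanti : ∀ {i j : ℕ}, i ≤ j → θ ^ j ≤ θ ^ i := fun hij =>
    pow_le_pow_of_le_one hθ0.le (by linarith) hij
  have hA : ∀ k : ℕ, 0 ≤ H (θ ^ k) := fun k => hH _ ⟨hpow0 k, hpow1 k⟩
  have hB : ∀ k : ℕ, 0 ≤ h (θ ^ k) := fun k => hh _ ⟨hpow0 k, hpow1 k⟩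
  have hH1 : 0 ≤ H 1 := by simpa using hA 0
  have hh1 : 0 ≤ h 1 := by simpa using hB 0
  have hstep : ∀ k : ℕ, ρ ≤ θ ^ (k + 1) → 2 * ρ ≤ θ ^ k := fun k hk => by
    rw [pow_succ] at hk; nlinarith [hpow0 k]
  have hI0 : 0 ≤ T := by
    have : 0 ≤ ∫ s in Set.Ioc (0 : ℝ) 1, ω s / s :=
      setIntegral_nonneg measurableSet_Ioc fun s hs =>
        div_nonneg (hω0 s ⟨hs.1.le, hs.2⟩) hs.1.le
    linarith
  have hE : 1 ≤ exp (2 * K * C₀ * T) := one_le_exp (by positivity)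
  -- Geometric scales are controlled through the functional `h + 2 K H`.
  have hscale : ∀ m : ℕ, ρ ≤ θ ^ (m + 1) →
      h (θ ^ m) + 2 * K * H (θ ^ m) ≤ 4 * K ^ 2 * (H 1 + h 1) * exp (2 * K * C₀ * T) := by
    intro m hm
    have hρk : ∀ k ≤ m + 1, ρ ≤ θ ^ k := fun k hk => hm.trans (hanti hk)
    have hε : ∀ k < m, 0 ≤ ω (ρ / θ ^ (k + 1)) + γ := fun k hk =>
      add_nonneg (hω0 _ ⟨(div_pos hρ (hpow0 _)).le,
        (div_le_one (hpow0 _)).2 (hρk _ (by omega))⟩) hγ0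
    have hnext : ∀ k ≤ m, H (θ ^ (k + 1)) ≤ K * H (θ ^ k) ∧
        h (θ ^ (k + 1)) ≤ h (θ ^ k) + K * H (θ ^ k) := fun k hk =>
      hoct _ _ (hstep k (hρk _ (by omega))) (hpow1 k) (hρk _ (by omega)) (hanti (by omega))
        (by rw [← pow_add]; exact hanti (by omega))
    have hgron := (le_mul_exp_sum_of_two_step (m := m)
      (x := fun k => h (θ ^ k) + 2 * K * H (θ ^ k))
      (a := fun k => 2 * K * C₀ * (ω (ρ / θ ^ (k + 1)) + γ)) (B := 4 * K ^ 2 * (H 1 + h 1))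
      (by positivity) (fun k hk => mul_nonneg (by positivity) (hε k hk)) ?_ ?_ ?_ m le_rfl).1
    · refine hgron.trans ?_
      rw [← Finset.mul_sum]
      gcongr
      exact sum_perturbation_le hθ0 hθ1 hω0 hmono hint hρ (by linarith) hγ0 hγ hm
    · simp only [pow_zero]
      nlinarith [mul_nonneg (sub_nonneg.2 hK1) hH1, mul_nonneg (sub_nonneg.2 hK1) hh1,
        mul_nonneg (mul_nonneg (sub_nonneg.2 hK1) (zero_le_one.trans hK1)) hH1,
        mul_nonneg (mul_nonneg (sub_nonneg.2 hK1) (zero_le_one.trans hK1)) hh1]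
    · obtain ⟨g1, g2⟩ := hnext 0 (Nat.zero_le _)
      simp only [zero_add, pow_zero, pow_one] at g1 g2 ⊢
      nlinarith [mul_nonneg (sub_nonneg.2 hK1) hH1, mul_nonneg (sub_nonneg.2 hK1) hh1,
        mul_nonneg (mul_nonneg (sub_nonneg.2 hK1) (zero_le_one.trans hK1)) hH1,
        mul_nonneg (mul_nonneg (sub_nonneg.2 hK1) (zero_le_one.trans hK1)) hh1,
        mul_le_mul_of_nonneg_left g1 (zero_le_one.trans hK1)]
    · intro k hk
      have hk1 := hρk (k + 1) (by omega)
      have e : θ ^ (k + 1) = θ * θ ^ k := pow_succ' θ k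
      have e2 : θ * θ ^ (k + 1) = θ ^ (k + 2) := (pow_succ' θ (k + 1)).symm
      have h2 : 2 * θ ^ (k + 1) ≤ θ ^ k := by rw [e]; nlinarith [hpow0 k]
      have hhalf : θ ^ (k + 1) ≤ 1 / 2 := by linarith [hpow1 k]
      obtain ⟨d1, d2⟩ := hoct (θ ^ k) (2 * θ ^ (k + 1)) (hstep k hk1) (hpow1 k)
        (by linarith) h2 (by
          have : θ ^ 2 * θ ^ k ≤ θ ^ (k + 1) := by rw [← pow_add]; exact hanti (by omega)
          linarith [hpow0 (k + 1)])
      have hcc := hc _ hk1 hhalf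
      rw [e2] at hcc
      have hsum : C₀ * (ω (ρ / θ ^ (k + 1)) + γ) * (H (2 * θ ^ (k + 1)) + h (2 * θ ^ (k + 1))) ≤
          C₀ * (ω (ρ / θ ^ (k + 1)) + γ) * (h (θ ^ k) + 2 * K * H (θ ^ k)) :=
        mul_le_mul_of_nonneg_left (by linarith) (mul_nonneg (by linarith) (hε k hk))
      have hmul := mul_le_mul_of_nonneg_left (hcc.trans (add_le_add_right hsum _))
        (by positivity : 0 ≤ 2 * K)
      have := (hnext (k + 1) (by omega)).2
      simp only [add_assoc, Nat.reduceAdd] at this ⊢ hmul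
      nlinarith
  obtain ⟨k, hk1, hk2⟩ := exists_nat_pow_near_of_lt_one (hρ.trans_le hρr) hr1 hθ0
    (by linarith : θ < 1)
  rcases k with _ | k
  · rw [zero_add, pow_one] at hk1
    obtain ⟨d1, d2⟩ := hoct 1 r (by linarith) le_rfl hρr hr1 (by nlinarith)
    have : 1 * (4 * K ^ 2 * (H 1 + h 1)) ≤ exp (2 * K * C₀ * T) * (4 * K ^ 2 * (H 1 + h 1)) := by
      gcongr
    nlinarith [mul_nonneg (sub_nonneg.2 hK1) hH1, mul_nonneg (sub_nonneg.2 hK1) hh1,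
      mul_nonneg (mul_nonneg (sub_nonneg.2 hK1) (zero_le_one.trans hK1)) hH1,
      mul_nonneg (mul_nonneg (sub_nonneg.2 hK1) (zero_le_one.trans hK1)) hh1]
  · have hρk : ρ ≤ θ ^ (k + 1) := hρr.trans hk2
    obtain ⟨d1, d2⟩ := hoct (θ ^ k) r (hstep k hρk) (hpow1 k) hρr
      (hk2.trans (hanti (by omega))) (by rw [← pow_add, add_comm]; exact hk1.le)
    linarith [hscale k hρk]
end

section
/- Optimality of the exponential convergence rate (Section 7.2 lower bound): There exist constants c ∈ (0,1) and K ≥ 1 such that the following holds. Let β₀ ≥ 2 be an integer and ε ∈ (0, 1/2] a real with ε ≤ K⁻¹·β₀·e^{−β₀}; set β = β₀ + ε and a(x) = ( 1 + (β₀!/β₀^{β₀})·sin(2πβ₀x/ε)·sin(2πβx/ε) )⁻¹ for x ∈ [0,1]. Suppose u : [0,1] → ℝ is continuous with u(0) = u(1) = 0, differentiable on (0,1), and such that the function x ↦ a(x)·u′(x) is differentiable on (0,1) with derivative identically equal to −1 on (0,1). Then for every real ā > 0: ( ∫₀¹ | u(x) − x(1−x)/(2ā) |² dx )^{1/2} ≥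 c·e^{−β}. -/
open Real MeasureTheory

/-- The test function whose derivative is paired with the error: its integrals against `1`, `x`
and `cos (2πx)` over `[0,1]` vanish. -/
noncomputable def testFun (x : ℝ) : ℝ := sin (2 * π * x) - 2 * sin (4 * π * x)

/-- The derivative of `testFun`. -/
noncomputable def testFunDeriv (x : ℝ) : ℝ := 2 * π * cos (2 * π * x) - 8 * π * cos (4 * π * x)

lemma hasDerivAt_sin_const_mul (k x : ℝ) :
    HasDerivAt (fun t => sin (k * t)) (k * cos (k * x)) x := by
  have h := ((hasDerivAt_id x).const_mul k).sin
  simp only [id, mul_one] at h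
  rwa [mul_comm] at h

lemma hasDerivAt_cos_const_mul (k x : ℝ) :
    HasDerivAt (fun t => cos (k * t)) (-(k * sin (k * x))) x := by
  have h := ((hasDerivAt_id x).const_mul k).cos
  simp only [id, mul_one] at h
  convert h using 1
  ring

lemma hasDerivAt_testFun (x : ℝ) : HasDerivAt testFun (testFunDeriv x) x := by
  refine HasDerivAt.congr_deriv ((hasDerivAt_sin_const_mul (2 * π) x).sub
    ((hasDerivAt_sin_const_mul (4 * π) x).const_mul 2)) ?_
  unfold testFunDeriv
  ring

lemma continuous_testFun : Continuous testFun := by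
  unfold testFun
  fun_prop

lemma continuous_testFunDeriv : Continuous testFunDeriv := by
  unfold testFunDeriv
  fun_prop

lemma testFun_zero : testFun 0 = 0 := by simp [testFun]

lemma testFun_one : testFun 1 = 0 := by
  have h : sin (4 * π * 1) = 0 := by
    simpa using sin_nat_mul_pi 4
  simp [testFun] at h ⊢
  exact h

lemma abs_testFun_le (x : ℝ) : |testFun x| ≤ 3 := by
  unfold testFun
  rw [abs_le]
  constructor <;>
  linarith [neg_one_le_sin (2 * π * x), sin_le_one (2 * π * x), neg_one_le_sin (4 * π * x),
    sin_le_one (4 * π * x)]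

lemma abs_testFunDeriv_le (x : ℝ) : |testFunDeriv x| ≤ 32 := by
  have hp := pi_pos
  have hp' := pi_lt_d2
  unfold testFunDeriv
  rw [abs_le]
  constructor <;>
  nlinarith [neg_one_le_cos (2 * π * x), cos_le_one (2 * π * x), neg_one_le_cos (4 * π * x),
    cos_le_one (4 * π * x)]

/-- An antiderivative of `(A - x) sin (k x)`. -/
noncomputable def linSinPrim (A k x : ℝ) : ℝ := -((A - x) * cos (k * x)) / k - sin (k * x) / k ^ 2

lemma hasDerivAt_linSinPrim (A x : ℝ) {k : ℝ} (hk : k ≠ 0) :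
    HasDerivAt (linSinPrim A k) ((A - x) * sin (k * x)) x := by
  refine HasDerivAt.congr_deriv (((((hasDerivAt_id x).const_sub A).mul
    (hasDerivAt_cos_const_mul k x)).neg.div_const k).sub ((hasDerivAt_sin_const_mul k x).div_const (k ^ 2))) ?_
  simp only [id]
  field_simp
  ring

lemma linSinPrim_one_sub_zero (A : ℝ) {n : ℕ} (hn : n ≠ 0) :
    linSinPrim A (2 * n * π) 1 - linSinPrim A (2 * n * π) 0 = 1 / (2 * n * π) := by
  have hs : sin (2 * n * π) = 0 := by
    have := sin_nat_mul_pi (2 * n)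
    push_cast at this
    exact this
  have hc : cos (2 * n * π) = 1 := by
    have := cos_nat_mul_two_pi n
    rwa [show (n : ℝ) * (2 * π) = 2 * n * π by ring] at this
  have hn' : (n : ℝ) ≠ 0 := by exact_mod_cast hn
  have hp := pi_ne_zero
  simp only [linSinPrim, mul_one, mul_zero, hs, hc, sin_zero, cos_zero]
  field_simp
  ring

/-- An antiderivative of `((C - x) (1 + δ/2 cos (2πx)) - m (1 - 2x)) * testFun x`. -/
noncomputable def resonantPrim (C δ m x : ℝ) : ℝ :=
  (1 - δ / 2) * linSinPrim C (2 * (1 : ℕ) * π) x + (δ / 4 - 2) * linSinPrim C (2 * (2 : ℕ) * π) x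
    - δ / 2 * linSinPrim C (2 * (3 : ℕ) * π) x
    - 2 * m * (linSinPrim (1 / 2) (2 * (1 : ℕ) * π) x - 2 * linSinPrim (1 / 2) (2 * (2 : ℕ) * π) x)

lemma hasDerivAt_resonantPrim (C δ m x : ℝ) :
    HasDerivAt (resonantPrim C δ m)
      (((C - x) * (1 + δ / 2 * cos (2 * π * x)) - m * (1 - 2 * x)) * testFun x) x := by
  have hk (n : ℕ) (hn : n ≠ 0) : (2 * n * π : ℝ) ≠ 0 := by
    have := pi_ne_zero
    positivity
  have h1 := hk 1 (by norm_num)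
  have h2 := hk 2 (by norm_num)
  have h3 := hk 3 (by norm_num)
  refine HasDerivAt.congr_deriv (((((hasDerivAt_linSinPrim C x h1).const_mul (1 - δ / 2)).add
    ((hasDerivAt_linSinPrim C x h2).const_mul (δ / 4 - 2))).sub
    ((hasDerivAt_linSinPrim C x h3).const_mul (δ / 2))).sub
    (((hasDerivAt_linSinPrim (1 / 2) x h1).sub
      ((hasDerivAt_linSinPrim (1 / 2) x h2).const_mul 2)).const_mul (2 * m))) ?_
  have e2 : sin (4 * π * x) = 2 * sin (2 * π * x) * cos (2 * π * x) := by
    rw [← sin_two_mul]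
    ring_nf
  have e3 : sin (2 * (3 : ℕ) * π * x) = 3 * sin (2 * π * x) - 4 * sin (2 * π * x) ^ 3 := by
    rw [← sin_three_mul]
    push_cast
    ring_nf
  rw [e3, show (2 * (1 : ℕ) * π * x : ℝ) = 2 * π * x by push_cast; ring,
    show (2 * (2 : ℕ) * π * x : ℝ) = 4 * π * x by push_cast; ring, testFun, e2]
  have hsc : sin (2 * π * x) ^ 3 = sin (2 * π * x) * (1 - cos (2 * π * x) ^ 2) := by
    rw [← sin_sq (2 * π * x)]
    ring
  rw [hsc]
  ring

lemma resonantPrim_one_sub_zero (C δ m : ℝ) :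
    resonantPrim C δ m 1 - resonantPrim C δ m 0 = -(13 * δ / (48 * π)) := by
  have h1 := linSinPrim_one_sub_zero C (n := 1) (by norm_num)
  have h2 := linSinPrim_one_sub_zero C (n := 2) (by norm_num)
  have h3 := linSinPrim_one_sub_zero C (n := 3) (by norm_num)
  have h4 := linSinPrim_one_sub_zero (1 / 2) (n := 1) (by norm_num)
  have h5 := linSinPrim_one_sub_zero (1 / 2) (n := 2) (by norm_num)
  have hp := pi_ne_zero
  have key : (1 - δ / 2) * (1 / (2 * (1 : ℕ) * π)) + (δ / 4 - 2) * (1 / (2 * (2 : ℕ) * π))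
      - δ / 2 * (1 / (2 * (3 : ℕ) * π))
      - 2 * m * (1 / (2 * (1 : ℕ) * π) - 2 * (1 / (2 * (2 : ℕ) * π))) = -(13 * δ / (48 * π)) := by
    push_cast
    field_simp
    ring
  rw [← key]
  unfold resonantPrim
  linear_combination (1 - δ / 2) * h1 + (δ / 4 - 2) * h2 - δ / 2 * h3 - 2 * m * h4 + 4 * m * h5

/-- Pairing the error `w` with `testFunDeriv` leaves the resonant contribution and an oscillatory
remainder of size `δ / Ω`. -/
lemma integral_mul_testFunDeriv {w w' : ℝ → ℝ} {C δ m Ω : ℝ} (hΩ : Ω ≠ 0)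
    (hw : ContinuousOn w (Set.Icc 0 1))
    (hw' : ∀ x ∈ Set.Ioo (0 : ℝ) 1, HasDerivAt w (w' x) x)
    (heq : ∀ x ∈ Set.Ioo (0 : ℝ) 1,
      w' x = (C - x) * (1 + δ / 2 * (cos (2 * π * x) - cos (Ω * x))) - m * (1 - 2 * x)) :
    ∫ x in (0 : ℝ)..1, w x * testFunDeriv x = 13 * δ / (48 * π) -
      ∫ x in (0 : ℝ)..1, δ / (2 * Ω) * ((-testFun x + (C - x) * testFunDeriv x) * sin (Ω * x)) := by
  have hcw : ContinuousOn (fun x => w x * testFunDeriv x) (Set.uIcc 0 1) := by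
    rw [Set.uIcc_of_le zero_le_one]
    exact hw.mul continuous_testFunDeriv.continuousOn
  have hcr : Continuous fun x =>
      δ / (2 * Ω) * ((-testFun x + (C - x) * testFunDeriv x) * sin (Ω * x)) := by
    have := continuous_testFun
    have := continuous_testFunDeriv
    fun_prop
  have hosc (x : ℝ) : HasDerivAt (fun t => δ / (2 * Ω) * ((C - t) * testFun t * sin (Ω * t)))
      (δ / (2 * Ω) * ((-testFun x + (C - x) * testFunDeriv x) * sin (Ω * x))
        + δ / 2 * ((C - x) * testFun x * cos (Ω * x))) x := by
    refine HasDerivAt.congr_deriv (((((hasDerivAt_id x).const_sub C).mul (hasDerivAt_testFun x)).mul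
      (hasDerivAt_sin_const_mul Ω x)).const_mul (δ / (2 * Ω))) ?_
    simp only [id, Pi.mul_apply]
    field_simp
  have hcP : Continuous (resonantPrim C δ m) :=
    continuous_iff_continuousAt.2 fun x => (hasDerivAt_resonantPrim C δ m x).continuousAt
  have hcQ : Continuous fun t => δ / (2 * Ω) * ((C - t) * testFun t * sin (Ω * t)) :=
    continuous_iff_continuousAt.2 fun x => (hosc x).continuousAt
  have hftc := intervalIntegral.integral_eq_sub_of_hasDerivAt_of_le zero_le_one
    (f := fun x => w x * testFun x - resonantPrim C δ m x
      + δ / (2 * Ω) * ((C - x) * testFun x * sin (Ω * x)))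
    (f' := fun x => w x * testFunDeriv x
      + δ / (2 * Ω) * ((-testFun x + (C - x) * testFunDeriv x) * sin (Ω * x)))
    (((hw.mul continuous_testFun.continuousOn).sub hcP.continuousOn).add hcQ.continuousOn)
    (fun x hx => by
      refine HasDerivAt.congr_deriv ((((hw' x hx).mul (hasDerivAt_testFun x)).sub
        (hasDerivAt_resonantPrim C δ m x)).add (hosc x)) ?_
      rw [heq x hx]
      ring)
    (hcw.intervalIntegrable.add (hcr.intervalIntegrable 0 1))
  rw [intervalIntegral.integral_add hcw.intervalIntegrable (hcr.intervalIntegrable 0 1)] at hftc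
  have hP := resonantPrim_one_sub_zero C δ m
  simp only [testFun_zero, testFun_one] at hftc
  linarith

/-- Quantitative lower bound on the squared `L²` norm of the error. -/
lemma sq_le_integral_sq {w w' : ℝ → ℝ} {C δ m Ω : ℝ} (hδ : 0 < δ) (hC : C ∈ Set.Icc (0 : ℝ) 1)
    (hΩ : 400 * π ≤ Ω)
    (hw : ContinuousOn w (Set.Icc 0 1))
    (hw' : ∀ x ∈ Set.Ioo (0 : ℝ) 1, HasDerivAt w (w' x) x)
    (heq : ∀ x ∈ Set.Ioo (0 : ℝ) 1,
      w' x = (C - x) * (1 + δ / 2 * (cos (2 * π * x) - cos (Ω * x))) - m * (1 - 2 * x)) :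
    (δ / 512) ^ 2 ≤ ∫ x in (0 : ℝ)..1, w x ^ 2 := by
  have hp := pi_pos
  have hΩ0 : 0 < Ω := by linarith
  have hI := integral_mul_testFunDeriv hΩ0.ne' hw hw' heq
  have hrem : ‖∫ x in (0 : ℝ)..1,
      δ / (2 * Ω) * ((-testFun x + (C - x) * testFunDeriv x) * sin (Ω * x))‖
      ≤ δ / (2 * Ω) * 35 * |1 - 0| := by
    refine intervalIntegral.norm_integral_le_of_norm_le_const fun x hx => ?_
    rw [Set.uIoc_of_le zero_le_one] at hx
    have hCx : |C - x| ≤ 1 := abs_le.2 ⟨by linarith [hC.1, hx.2], by linarith [hC.2, hx.1]⟩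
    have hG : |-testFun x + (C - x) * testFunDeriv x| ≤ 35 := by
      calc |-testFun x + (C - x) * testFunDeriv x|
          ≤ |testFun x| + |C - x| * |testFunDeriv x| := by
            simpa [abs_mul] using abs_add_le (-testFun x) ((C - x) * testFunDeriv x)
        _ ≤ 3 + 1 * 32 := by
            gcongr
            exacts [abs_testFun_le x, abs_testFunDeriv_le x]
        _ = 35 := by norm_num
    rw [norm_mul, norm_mul, norm_of_nonneg (by positivity : 0 ≤ δ / (2 * Ω)), norm_eq_abs,
      norm_eq_abs]
    have := mul_le_mul hG (abs_sin_le_one (Ω * x)) (abs_nonneg _) (by norm_num)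
    rw [mul_one] at this
    gcongr
  have hrem' : δ / (2 * Ω) * 35 * |1 - 0| ≤ δ * 35 / (800 * π) := by
    rw [sub_zero, abs_one, mul_one, div_mul_eq_mul_div]
    exact div_le_div_of_nonneg_left (by positivity) (by positivity) (by linarith)
  have hL : δ / 16 ≤ ∫ x in (0 : ℝ)..1, w x * testFunDeriv x := by
    have h1 := (abs_le.1 (hrem.trans hrem')).2
    have h2 : δ / 16 ≤ 13 * δ / (48 * π) - δ * 35 / (800 * π) := by
      have : 13 * δ / (48 * π) - δ * 35 / (800 * π) = δ * (545 / (2400 * π)) := by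
        field_simp
        norm_num
      rw [this, div_eq_mul_one_div]
      gcongr ?_ * ?_
      rw [div_le_div_iff₀ (by norm_num) (by positivity)]
      linarith [pi_lt_d2]
    linarith
  have hcw : ContinuousOn (fun x => w x * testFunDeriv x) (Set.uIcc 0 1) := by
    rw [Set.uIcc_of_le zero_le_one]
    exact hw.mul continuous_testFunDeriv.continuousOn
  have hcs : ContinuousOn (fun x => 8192 / δ * w x ^ 2) (Set.uIcc 0 1) := by
    rw [Set.uIcc_of_le zero_le_one]
    exact continuousOn_const.mul (hw.pow 2)
  have hcc : IntervalIntegrable (fun _ : ℝ => δ / 32) volume 0 1 := intervalIntegrable_const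
  have hmono := intervalIntegral.integral_mono_on zero_le_one hcw.intervalIntegrable
    (hcs.intervalIntegrable.add hcc) (fun x _ => by
      have hb := sq_le_sq' (by linarith [(abs_le.1 (abs_testFunDeriv_le x)).1])
        (abs_le.1 (abs_testFunDeriv_le x)).2
      have h := sq_nonneg (512 * w x - δ / 32 * testFunDeriv x)
      have h' : 8192 / δ * w x ^ 2 + δ / 32 - w x * testFunDeriv x
          = ((512 * w x - δ / 32 * testFunDeriv x) ^ 2
            + (δ / 32) ^ 2 * (32 ^ 2 - testFunDeriv x ^ 2)) / (32 * δ) := by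
        field_simp
        ring
      have h'' : 0 ≤ 8192 / δ * w x ^ 2 + δ / 32 - w x * testFunDeriv x := by
        rw [h']
        have := mul_nonneg (sq_nonneg (δ / 32)) (sub_nonneg.2 hb)
        positivity
      linarith)
  rw [intervalIntegral.integral_add hcs.intervalIntegrable hcc,
    intervalIntegral.integral_const_mul, intervalIntegral.integral_const] at hmono
  simp only [sub_zero, one_smul] at hmono
  have h3 : δ / 32 ≤ 8192 / δ * ∫ x in (0 : ℝ)..1, w x ^ 2 := by linarith
  rw [div_mul_eq_mul_div, le_div_iff₀ hδ] at h3
  nlinarith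

lemma factorial_div_pow_lt_one {n : ℕ} (hn : 2 ≤ n) : (n.factorial : ℝ) / (n : ℝ) ^ n < 1 := by
  have hn0 : (0 : ℝ) < n := by exact_mod_cast (by omega : 0 < n)
  rw [div_lt_one (by positivity)]
  obtain ⟨m, rfl⟩ : ∃ m, n = m + 1 := ⟨n - 1, by omega⟩
  have h : (m + 1).factorial < (m + 1) ^ (m + 1) := by
    rw [Nat.factorial_succ, pow_succ']
    exact Nat.mul_lt_mul_of_pos_left
      (m.factorial_le_pow.trans_lt (Nat.pow_lt_pow_left m.lt_succ_self (by omega))) m.succ_pos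
  exact_mod_cast h

lemma exp_neg_le_factorial_div_pow {n : ℕ} (hn : n ≠ 0) :
    exp (-(n : ℝ)) ≤ (n.factorial : ℝ) / (n : ℝ) ^ n := by
  have hn0 : (0 : ℝ) < n := by exact_mod_cast Nat.pos_of_ne_zero hn
  have h := pow_div_factorial_le_exp (n : ℝ) hn0.le n
  rw [exp_neg, ← inv_div]
  exact inv_anti₀ (by positivity) h

/-- A function with derivative `-1` on `(0,1)` is `C - x` there. -/
lemma exists_eq_const_sub {f : ℝ → ℝ} (hf : ∀ x ∈ Set.Ioo (0 : ℝ) 1, HasDerivAt f (-1) x) :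
    ∃ C, ∀ x ∈ Set.Ioo (0 : ℝ) 1, f x = C - x := by
  have hg : ∀ x ∈ Set.Ioo (0 : ℝ) 1, HasDerivAt (fun t => f t + t) 0 x := fun x hx => by
    exact ((hf x hx).add (hasDerivAt_id x)).congr_deriv (by norm_num)
  obtain ⟨C, hC⟩ := isOpen_Ioo.exists_is_const_of_deriv_eq_zero isPreconnected_Ioo
    (fun x hx => (hg x hx).differentiableAt.differentiableWithinAt) (fun x hx => (hg x hx).deriv)
  exact ⟨C, fun x hx => eq_sub_of_add_eq (hC x hx)⟩

/-- Section 7.2 lower bound: optimality of the exponential convergence rate.  No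
constant-coefficient homogenized solution approximates `u` better than `c·e^{−β}`. -/
theorem statement17 :
    ∃ c K : ℝ, 0 < c ∧ c < 1 ∧ 1 ≤ K ∧
      ∀ (β₀ : ℕ) (ε : ℝ), 2 ≤ β₀ → ε ∈ Set.Ioc (0 : ℝ) (1 / 2) →
        ε ≤ K⁻¹ * (β₀ : ℝ) * Real.exp (-(β₀ : ℝ)) →
        ∀ u u' : ℝ → ℝ,
          ContinuousOn u (Set.Icc (0 : ℝ) 1) → u 0 = 0 → u 1 = 0 →
          (∀ x ∈ Set.Ioo (0 : ℝ) 1, HasDerivAt u (u' x) x) →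
          (∀ x ∈ Set.Ioo (0 : ℝ) 1,
            HasDerivAt
              (fun t => (1 + ((Nat.factorial β₀ : ℝ) / (β₀ : ℝ) ^ β₀)
                  * Real.sin (2 * Real.pi * (β₀ : ℝ) * t / ε)
                  * Real.sin (2 * Real.pi * ((β₀ : ℝ) + ε) * t / ε))⁻¹ * u' t)
              (-1) x) →
          ∀ abar : ℝ, 0 < abar →
            c * Real.exp (-((β₀ : ℝ) + ε)) ≤
              Real.sqrt (∫ x in Set.Icc (0 : ℝ) 1,
                (u x - x * (1 - x) / (2 * abar)) ^ 2) := by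
  refine ⟨1 / 512, 100, by norm_num, by norm_num, by norm_num, ?_⟩
  rintro n ε hn ⟨hε, -⟩ hεK u u' hu hu0 hu1 hu' hflux abar -
  set δ : ℝ := (n.factorial : ℝ) / (n : ℝ) ^ n with hδdef
  have hn0 : (0 : ℝ) < n := by exact_mod_cast (by omega : 0 < n)
  have hδ : 0 < δ := by positivity
  have hδ1 : δ < 1 := factorial_div_pow_lt_one hn
  have hexp : exp (-(n : ℝ)) ≤ δ := exp_neg_le_factorial_div_pow (by omega)
  have hpos (t : ℝ) :
      0 < 1 + δ * sin (2 * π * n * t / ε) * sin (2 * π * (n + ε) * t / ε) := by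
    have h : |sin (2 * π * n * t / ε) * sin (2 * π * (n + ε) * t / ε)| ≤ 1 := by
      rw [abs_mul]
      exact mul_le_one₀ (abs_sin_le_one _) (abs_nonneg _) (abs_sin_le_one _)
    nlinarith [(abs_le.1 h).1]
  obtain ⟨C, hC⟩ := exists_eq_const_sub hflux
  have hu'eq (x : ℝ) (hx : x ∈ Set.Ioo (0 : ℝ) 1) :
      u' x = (C - x) * (1 + δ * sin (2 * π * n * x / ε) * sin (2 * π * (n + ε) * x / ε)) := by
    rw [← hC x hx, mul_comm, mul_inv_cancel_left₀ (hpos x).ne']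
  have hC01 : C ∈ Set.Icc (0 : ℝ) 1 := by
    obtain ⟨x, hx, hx0⟩ := exists_hasDerivAt_eq_zero zero_lt_one hu (hu0.trans hu1.symm) hu'
    rw [hu'eq x hx] at hx0
    have : C = x := sub_eq_zero.1 ((mul_eq_zero.1 hx0).resolve_right (hpos x).ne')
    exact this ▸ Set.Ioo_subset_Icc_self hx
  have hΩ : 400 * π ≤ 2 * π * (2 * n + ε) / ε := by
    have h1 : exp (-(n : ℝ)) ≤ 1 := exp_le_one_iff.2 (by linarith)
    have h2 : ε ≤ n / 100 := by nlinarith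
    rw [le_div_iff₀ hε]
    nlinarith [pi_pos]
  have hprod (x : ℝ) : sin (2 * π * n * x / ε) * sin (2 * π * (n + ε) * x / ε)
      = (cos (2 * π * x) - cos (2 * π * (2 * n + ε) / ε * x)) / 2 := by
    rw [show 2 * π * (n + ε) * x / ε = 2 * π * n * x / ε + 2 * π * x by field_simp,
      show 2 * π * (2 * n + ε) / ε * x = 2 * π * n * x / ε + (2 * π * n * x / ε + 2 * π * x) by
        field_simp; ring,
      cos_add (2 * π * n * x / ε), sin_add, cos_add]
    linear_combination (cos (2 * π * x) / 2) * sin_sq_add_cos_sq (2 * π * n * x / ε)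
  have hw' (x : ℝ) (hx : x ∈ Set.Ioo (0 : ℝ) 1) :
      HasDerivAt (fun x => u x - x * (1 - x) / (2 * abar))
        (u' x - 1 / (2 * abar) * (1 - 2 * x)) x := by
    refine HasDerivAt.congr_deriv ((hu' x hx).sub
      (((hasDerivAt_id x).mul ((hasDerivAt_id x).const_sub 1)).div_const (2 * abar))) ?_
    simp only [id]
    ring
  have hJ := sq_le_integral_sq (m := 1 / (2 * abar)) hδ hC01 hΩ (hu.sub (by fun_prop)) hw' (fun x hx => by
    rw [hu'eq x hx, mul_assoc δ, hprod]
    ring)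
  rw [integral_Icc_eq_integral_Ioc, ← intervalIntegral.integral_of_le zero_le_one]
  refine le_sqrt_of_sq_le (le_trans ?_ hJ)
  have h1 : exp (-(n + ε)) ≤ δ := (exp_le_exp.2 (by linarith)).trans hexp
  gcongr
  linarith
end
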